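/- Near-axis Boozer coordinates (Theorem 3): Let B : U → ℝ³ and p : U → ℝ be C^∞ on an open set U ⊆ ℝ³ with B nowhere vanishing, div B = 0, and (curl B) × B = ∇p on U (MHS integrability, with J := curl B), and let γ ⊆ U be a nondegenerate elliptic magnetic axis. Then there exist r > 0, δ > 0, a C^∞ map Φ : D_r × ℝ → U where D_r = {(x,y) ∈ ℝ² : x² + y² < r²}, and C^∞ functions P, f, g, k, l : (−δ, r²/2) → ℝ such that: (i) Φ(x,y,φ+2π) = Φ(x,y,φ); (ii) Φ has everywhere invertible differential, its image is an open neighborhood of γ, Φ({(0,0)} × ℝ) = γ, and Φ(x,y,φ) = Φ(x',y',φ') iff (x,y) = (x',y') and φ − φ' ∈ 2πℤ; (iii) for all (x,y,φ) ∈ D_r × ℝ, writing ψ = (x² + y²)/2: p(Φ(x,y,φ)) = P(ψ), det(DΦ) · (DΦ)⁻¹ (B∘Φ) = (−g′(ψ)·y, g′(ψ)·x, f′(ψ)), and det(DΦ) · (DΦ)⁻¹ ((B × ∇p)∘Φ) = (−l′(ψ)·y, l′(ψ)·x, k′(ψ)) at (x,y,φ). -/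

import Mathlib

noncomputable section

open RealInnerProductSpace

/-- `ℝ³` as a Euclidean space. -/
abbrev R3 : Type := EuclideanSpace ℝ (Fin 3)

/-- The point `(x, y, z)` of `ℝ³`. -/
def pt (x y z : ℝ) : R3 := !₂[x, y, z]

/-- Divergence of a vector field: the trace of its derivative. -/
def divg (v : R3 → R3) (z : R3) : ℝ :=
  LinearMap.trace ℝ R3 (fderiv ℝ v z).toLinearMap

/-- Cross product on `ℝ³`. -/
def cross3 (u v : R3) : R3 :=
  pt (u 1 * v 2 - u 2 * v 1) (u 2 * v 0 - u 0 * v 2) (u 0 * v 1 - u 1 * v 0)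

/-- Standard basis vectors of `ℝ³`. -/
def e3 (i : Fin 3) : R3 := EuclideanSpace.single i 1

/-- Curl of a vector field on `ℝ³`. -/
def curl (v : R3 → R3) (z : R3) : R3 :=
  pt (fderiv ℝ v z (e3 1) 2 - fderiv ℝ v z (e3 2) 1)
     (fderiv ℝ v z (e3 2) 0 - fderiv ℝ v z (e3 0) 2)
     (fderiv ℝ v z (e3 0) 1 - fderiv ℝ v z (e3 1) 0)

/-- The Hessian of `p` at `z`, as a bilinear form. -/
def hess (p : R3 → ℝ) (z : R3) (u v : R3) : ℝ :=
  (iteratedFDeriv ℝ 2 p z) ![u, v]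

/-- `γ` is the image of a periodic integral curve of `B` lying in `U`. -/
def IsPeriodicOrbit (U : Set R3) (B : R3 → R3) (γ : Set R3) : Prop :=
  ∃ (c : ℝ → R3) (T : ℝ), 0 < T ∧ (∀ t, c t ∈ U) ∧
    (∀ t, c (t + T) = c t) ∧ (∀ t, HasDerivAt c (B (c t)) t) ∧ Set.range c = γ

/-- An integrable magnetic field `(B, J, p)` on an open set `U ⊆ ℝ³`. -/
structure IntegrableMagneticField (U : Set R3) (B J : R3 → R3) (p : R3 → ℝ) : Prop where
  isOpen_U : IsOpen U
  smooth_B : ContDiffOn ℝ (⊤ : ℕ∞) B U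
  smooth_J : ContDiffOn ℝ (⊤ : ℕ∞) J U
  smooth_p : ContDiffOn ℝ (⊤ : ℕ∞) p U
  B_ne_zero : ∀ z ∈ U, B z ≠ 0
  div_B : ∀ z ∈ U, divg B z = 0
  div_J : ∀ z ∈ U, divg J z = 0
  hamiltonian : ∀ z ∈ U, cross3 (J z) (B z) = gradient p z

/-- A nondegenerate elliptic magnetic axis: a compact image of a periodic integral
curve of `B` on which `∇p = 0` and the Hessian of `p`, restricted to the plane
orthogonal to `B`, is positive or negative definite. -/
def IsNondegenerateEllipticAxis (U : Set R3) (B : R3 → R3) (p : R3 → ℝ)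
    (γ : Set R3) : Prop :=
  IsCompact γ ∧ γ ⊆ U ∧ IsPeriodicOrbit U B γ ∧
  (∀ z ∈ γ, gradient p z = 0) ∧
  ∀ z ∈ γ,
    (∀ u : R3, u ≠ 0 → ⟪u, B z⟫ = 0 → 0 < hess p z u u) ∨
    (∀ u : R3, u ≠ 0 → ⟪u, B z⟫ = 0 → hess p z u u < 0)

/-- The solid cylinder `D_r × ℝ = {(x,y,φ) : x² + y² < r²}` in `ℝ³`. -/
def Dset (r : ℝ) : Set R3 := {q | (q 0) ^ 2 + (q 1) ^ 2 < r ^ 2}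

open scoped ContDiff

section ParametricIntegral

variable {E G : Type} [NormedAddCommGroup E] [NormedSpace ℝ E] [ProperSpace E]
  [NormedAddCommGroup G] [NormedSpace ℝ G]

theorem hasFDerivAt_integral_param {F : E × ℝ → G} (hF : ContDiff ℝ 1 F) (a b : ℝ) (x : E) :
    HasFDerivAt (fun x => ∫ t in a..b, F (x, t))
      (∫ t in a..b, (fderiv ℝ F (x, t)).comp (ContinuousLinearMap.inl ℝ E ℝ)) x := by
  have hF' : Continuous fun z => (fderiv ℝ F z).comp (ContinuousLinearMap.inl ℝ E ℝ) :=
    (hF.continuous_fderiv one_ne_zero).clm_comp continuous_const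
  obtain ⟨C, hC⟩ := ((isCompact_closedBall x 1).prod (isCompact_uIcc (a := a) (b := b))
    ).exists_bound_of_continuousOn hF'.continuousOn
  refine intervalIntegral.hasFDerivAt_integral_of_dominated_of_fderiv_le
    (F' := fun x t => (fderiv ℝ F (x, t)).comp (ContinuousLinearMap.inl ℝ E ℝ))
    (bound := fun _ => C) (Metric.ball_mem_nhds x one_pos) ?_ ?_ ?_ ?_ ?_ ?_
  · exact Filter.Eventually.of_forall fun y =>
      (hF.continuous.comp (by fun_prop : Continuous fun t : ℝ => (y, t))).aestronglyMeasurable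
  · exact (hF.continuous.comp (by fun_prop : Continuous fun t : ℝ => (x, t))).intervalIntegrable _ _
  · exact (hF'.comp (by fun_prop : Continuous fun t : ℝ => (x, t))).aestronglyMeasurable
  · refine Filter.Eventually.of_forall fun t ht y hy => hC (y, t) ⟨Metric.ball_subset_closedBall hy, ?_⟩
    exact Set.uIoc_subset_uIcc ht
  · exact intervalIntegrable_const
  · refine Filter.Eventually.of_forall fun t ht y hy => ?_
    have h1 : HasFDerivAt F (fderiv ℝ F (y, t)) (y, t) :=
      (hF.differentiable one_ne_zero (y, t)).hasFDerivAt
    exact h1.comp y (hasFDerivAt_prodMk_left y t)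

theorem contDiff_integral_param_nat (n : ℕ) :
    ∀ {G : Type} [NormedAddCommGroup G] [NormedSpace ℝ G] {F : E × ℝ → G}
      (_ : ContDiff ℝ ∞ F) (a b : ℝ), ContDiff ℝ n (fun x => ∫ t in a..b, F (x, t)) := by
  induction n with
  | zero =>
    intro G _ _ F hF a b
    refine contDiff_zero.2 (continuous_iff_continuousAt.2 fun x => ?_)
    exact (hasFDerivAt_integral_param (hF.of_le (by exact_mod_cast le_top)) a b x).continuousAt
  | succ n ih =>
    intro G _ _ F hF a b
    refine contDiff_succ_iff_hasFDerivAt.2 ⟨_, ?_, fun x =>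
      hasFDerivAt_integral_param (hF.of_le (by exact_mod_cast le_top)) a b x⟩
    exact ih (F := fun z => (fderiv ℝ F z).comp (ContinuousLinearMap.inl ℝ E ℝ))
      ((hF.fderiv_right (by simp)).clm_comp contDiff_const) a b

/-- Integrals depending smoothly on a parameter are smooth. -/
theorem contDiff_integral_param {F : E × ℝ → G} (hF : ContDiff ℝ ∞ F) (a b : ℝ) :
    ContDiff ℝ ∞ (fun x => ∫ t in a..b, F (x, t)) :=
  contDiff_infty.2 fun n => contDiff_integral_param_nat n hF a b

theorem fderiv_integral_param_apply [CompleteSpace G] {F : E × ℝ → G} (hF : ContDiff ℝ ∞ F)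
    (a b : ℝ) (x v : E) :
    fderiv ℝ (fun x => ∫ t in a..b, F (x, t)) x v =
      ∫ t in a..b, fderiv ℝ (fun y => F (y, t)) x v := by
  have hF1 : ContDiff ℝ 1 F := hF.of_le (by exact_mod_cast le_top)
  have hF' : Continuous fun t => (fderiv ℝ F (x, t)).comp (ContinuousLinearMap.inl ℝ E ℝ) :=
    ((hF1.continuous_fderiv one_ne_zero).comp (by fun_prop : Continuous fun t : ℝ => (x, t))).clm_comp
      continuous_const
  rw [(hasFDerivAt_integral_param hF1 a b x).fderiv,
    ContinuousLinearMap.intervalIntegral_apply (hF'.intervalIntegrable _ _)]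
  refine intervalIntegral.integral_congr fun t _ => ?_
  have h1 : HasFDerivAt F (fderiv ℝ F (x, t)) (x, t) :=
    (hF1.differentiable one_ne_zero (x, t)).hasFDerivAt
  have h2 : HasFDerivAt (fun y => F (y, t))
      ((fderiv ℝ F (x, t)).comp (ContinuousLinearMap.inl ℝ E ℝ)) x :=
    HasFDerivAt.comp (f := fun y => (y, t)) x h1 (hasFDerivAt_prodMk_left x t)
  simp only [h2.fderiv]

end ParametricIntegral

section EvenFunctions

/-- Hadamard's lemma on the line. -/
theorem exists_contDiff_eq_mul {e : ℝ → ℝ} (he : ContDiff ℝ ∞ e) (h0 : e 0 = 0) :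
    ∃ w : ℝ → ℝ, ContDiff ℝ ∞ w ∧ ∀ t, e t = t * w t := by
  have hd : ContDiff ℝ ∞ (deriv e) := (contDiff_infty_iff_deriv.1 he).2
  refine ⟨fun t => ∫ u in (0 : ℝ)..1, deriv e (u * t), contDiff_integral_param
    (F := fun z : ℝ × ℝ => deriv e (z.2 * z.1)) (hd.comp (by fun_prop)) 0 1, fun t => ?_⟩
  have h := intervalIntegral.mul_integral_comp_mul_right (f := deriv e) (a := 0) (b := 1) t
  rw [h, zero_mul, one_mul, intervalIntegral.integral_deriv_eq_sub
    (fun x _ => (he.differentiable (by simp)) x) (hd.continuous.intervalIntegrable _ _), h0, sub_zero]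

/-- A smooth function divisible by every power of the variable. -/
def IsFlat (e : ℝ → ℝ) : Prop :=
  ∀ n : ℕ, ∃ w : ℝ → ℝ, ContDiff ℝ ∞ w ∧ ∀ t, e t = t ^ n * w t

theorem IsFlat.contDiff {e : ℝ → ℝ} (h : IsFlat e) : ContDiff ℝ ∞ e := by
  obtain ⟨w, hw, hew⟩ := h 0
  convert hw using 1
  ext t; simp [hew]

theorem IsFlat.exists_div {e : ℝ → ℝ} (h : IsFlat e) :
    ∃ d : ℝ → ℝ, IsFlat d ∧ ∀ t, deriv e t = 2 * t * d t := by
  obtain ⟨d, hd, hed⟩ := h 2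
  have key : ∀ w : ℝ → ℝ, ∀ n : ℕ, ContDiff ℝ ∞ w → (∀ t, e t = t ^ (n + 2) * w t) → ∀ t,
      deriv e t = t ^ (n + 1) * ((n + 2) * w t + t * deriv w t) := by
    intro w n hw hew t
    have : e = fun t => t ^ (n + 2) * w t := funext hew
    rw [this]
    have := ((hasDerivAt_pow (n + 2) t).mul ((hw.differentiable (by simp) t).hasDerivAt)).deriv
    change deriv (fun t => t ^ (n + 2) * w t) t = _ at this
    rw [this, show n + 2 - 1 = n + 1 from rfl]; push_cast; ring
  refine ⟨fun t => (2 * d t + t * deriv d t) / 2, fun n => ?_, fun t => ?_⟩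
  · obtain ⟨w, hw, hew⟩ := h (n + 2)
    have hw' : ContDiff ℝ ∞ (deriv w) := (contDiff_infty_iff_deriv.1 hw).2
    have hd' : ContDiff ℝ ∞ (deriv d) := (contDiff_infty_iff_deriv.1 hd).2
    refine ⟨fun t => ((n + 2) * w t + t * deriv w t) / 2, by fun_prop, ?_⟩
    refine congrFun (Continuous.ext_on
      (f := fun t => (2 * d t + t * deriv d t) / 2)
      (g := fun t => t ^ n * (((n + 2) * w t + t * deriv w t) / 2))
      (dense_compl_singleton (0 : ℝ)) ?_ ?_ ?_)
    · have := hd.continuous; have := hd'.continuous; fun_prop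
    · have := hw.continuous; have := hw'.continuous; fun_prop
    · intro t ht
      have ht : t ≠ 0 := ht
      have h1 := key w n hw hew t
      have h2 := key d 0 hd (by simpa using hed) t
      rw [h1] at h2
      have : t * ((2 * d t + t * deriv d t) / 2) =
          t * (t ^ n * (((n + 2) * w t + t * deriv w t) / 2)) := by
        simp at h2; linear_combination - h2 / 2
      exact mul_left_cancel₀ ht this
  · rw [key d 0 hd (by simpa using hed) t]; simp; ring

theorem IsFlat.contDiff_sqrt_nat (n : ℕ) : ∀ {e : ℝ → ℝ}, IsFlat e →
    ContDiff ℝ n (fun s => if 0 < s then e √s else 0) := by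
  induction n with
  | zero =>
    intro e he
    obtain ⟨w, hw, hew⟩ := he 1
    have : (fun s => if 0 < s then e √s else 0) = fun s => e √s := by
      ext s
      split_ifs with hs
      · rfl
      · rw [Real.sqrt_eq_zero_of_nonpos (not_lt.1 hs), hew]; simp
    rw [this]
    exact contDiff_zero.2 (he.contDiff.continuous.comp Real.continuous_sqrt)
  | succ n ih =>
    intro e he
    obtain ⟨d, hd, hed⟩ := he.exists_div
    have hde := he.contDiff.differentiable (by simp)
    have hder : ∀ s, HasDerivAt (fun s => if 0 < s then e √s else 0)
        (if 0 < s then d √s else 0) s := by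
      intro s
      rcases lt_trichotomy s 0 with hs | hs | hs
      · rw [if_neg hs.not_gt]
        refine (hasDerivAt_const s (0 : ℝ)).congr_of_eventuallyEq ?_
        filter_upwards [Iio_mem_nhds hs] with y hy
        rw [if_neg (not_lt.2 (le_of_lt hy))]
      · subst hs
        obtain ⟨w, hw, hew⟩ := he 3
        have hc : Continuous fun s : ℝ => √s * w √s :=
          Real.continuous_sqrt.mul (hw.continuous.comp Real.continuous_sqrt)
        have heq : (fun s => if 0 < s then e √s else 0) = fun s => s * (√s * w √s) := by
          ext s
          split_ifs with hs
          · rw [hew]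
            have := Real.sq_sqrt hs.le
            linear_combination (√s * w √s) * this
          · rw [Real.sqrt_eq_zero_of_nonpos (not_lt.1 hs)]; simp
        rw [heq, if_neg (lt_irrefl _), hasDerivAt_iff_tendsto_slope]
        have h0 : Filter.Tendsto (fun s : ℝ => √s * w √s) (nhdsWithin 0 {0}ᶜ) (nhds 0) := by
          have := hc.tendsto 0
          simp only [Real.sqrt_zero, zero_mul] at this
          exact this.mono_left nhdsWithin_le_nhds
        refine h0.congr' ?_
        filter_upwards [self_mem_nhdsWithin] with s hs
        have hs : s ≠ 0 := hs
        rw [slope_def_field, zero_mul, sub_zero, sub_zero, mul_div_cancel_left₀ _ hs]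
      · rw [if_pos hs]
        have hsq : 0 < √s := Real.sqrt_pos.2 hs
        have h1 := (hde √s).hasDerivAt.comp s (Real.hasDerivAt_sqrt hs.ne')
        rw [hed, show 2 * √s * d √s * (1 / (2 * √s)) = d √s by field_simp] at h1
        have h2 : HasDerivAt (fun s => e √s) (d √s) s := h1
        refine h2.congr_of_eventuallyEq ?_
        filter_upwards [Ioi_mem_nhds hs] with y hy
        rw [if_pos (show 0 < y from hy)]
    have : ((n + 1 : ℕ) : WithTop ℕ∞) = n + 1 := by norm_cast
    rw [this, contDiff_succ_iff_deriv]
    refine ⟨fun s => (hder s).differentiableAt, by simp, ?_⟩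
    rw [funext fun s => (hder s).deriv]
    exact ih hd

theorem IsFlat.contDiff_sqrt {e : ℝ → ℝ} (he : IsFlat e) :
    ContDiff ℝ ∞ (fun s => if 0 < s then e √s else 0) :=
  contDiff_infty.2 fun n => IsFlat.contDiff_sqrt_nat n he

end EvenFunctions

section Borel

theorem exists_contDiff_eq_pow_mul {v : ℝ → ℝ} (hv : ContDiff ℝ ∞ v) (h0 : v =ᶠ[nhds 0] 0) (n : ℕ) :
    ∃ w : ℝ → ℝ, ContDiff ℝ ∞ w ∧ ∀ s, v s = s ^ n * w s := by
  refine ⟨fun s => v s / s ^ n, ?_, fun s => ?_⟩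
  · refine contDiff_iff_contDiffAt.2 fun s => ?_
    by_cases hs : s = 0
    · subst hs
      refine (contDiffAt_const (c := (0 : ℝ))).congr_of_eventuallyEq ?_
      filter_upwards [h0] with s hs
      simp [hs]
    · exact hv.contDiffAt.div (contDiffAt_id.pow n) (pow_ne_zero n hs)
  · by_cases hs : s = 0
    · subst hs
      have := h0.self_of_nhds
      simp [this]
    · exact (mul_div_cancel₀ _ (pow_ne_zero n hs)).symm

/-- Borel's lemma: every formal power series is the Taylor series of a smooth function,
with smooth Taylor remainders. -/
theorem exists_contDiff_taylor (c : ℕ → ℝ) : ∃ b : ℝ → ℝ, ContDiff ℝ ∞ b ∧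
    ∀ n : ℕ, ∃ w : ℝ → ℝ, ContDiff ℝ ∞ w ∧
      ∀ s, b s = ∑ k ∈ Finset.range n, c k * s ^ k + s ^ n * w s := by
  let φ : ContDiffBump (0 : ℝ) := ⟨1, 2, one_pos, one_lt_two⟩
  have hφ : ContDiff ℝ ∞ φ := φ.contDiff
  let f : ℕ → ℝ → ℝ := fun m x => x ^ m * φ x
  have hf : ∀ m, ContDiff ℝ ∞ (f m) := fun m => (contDiff_id.pow m).mul hφ
  have hbd : ∀ m j : ℕ, ∃ C : ℝ, ∀ x, ‖iteratedDeriv j (f m) x‖ ≤ C := by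
    intro m j
    have hc : HasCompactSupport (f m) := φ.hasCompactSupport.mul_left
    have h1 : Continuous (iteratedFDeriv ℝ j (f m)) :=
      (hf m).continuous_iteratedFDeriv (by exact_mod_cast le_top)
    obtain ⟨C, hC⟩ := h1.bounded_above_of_compact_support (hc.iteratedFDeriv j)
    exact ⟨C, fun x => by rw [← norm_iteratedFDeriv_eq_norm_iteratedDeriv]; exact hC x⟩
  choose M hM using hbd
  let S : ℕ → ℝ := fun k => ∑ m ∈ Finset.range (k + 1), ∑ j ∈ Finset.range (k + 1), |M m j|
  have hS0 : ∀ k, 0 ≤ S k := fun k => Finset.sum_nonneg fun _ _ => Finset.sum_nonneg fun _ _ => abs_nonneg _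
  have hS : ∀ k m j, m ≤ k → j ≤ k → M m j ≤ S k := by
    intro k m j hm hj
    refine (le_abs_self _).trans ?_
    refine (Finset.single_le_sum (f := fun j => |M m j|) (fun _ _ => abs_nonneg _)
      (Finset.mem_range_succ_iff.2 hj)).trans ?_
    exact Finset.single_le_sum (f := fun m => ∑ j ∈ Finset.range (k + 1), |M m j|)
      (fun _ _ => Finset.sum_nonneg fun _ _ => abs_nonneg _) (Finset.mem_range_succ_iff.2 hm)
  let L : ℕ → ℝ := fun k => 2 ^ k * (1 + |c k|) * (1 + S k)
  have hL1 : ∀ k, 1 ≤ L k := fun k => by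
    have h1 : (1 : ℝ) ≤ 2 ^ k := one_le_pow₀ one_le_two
    have h2 : (1 : ℝ) ≤ 1 + |c k| := by linarith [abs_nonneg (c k)]
    have h3 : (1 : ℝ) ≤ 1 + S k := by linarith [hS0 k]
    exact one_le_mul_of_one_le_of_one_le (one_le_mul_of_one_le_of_one_le h1 h2) h3
  have hL : ∀ k, 2 ^ k * (|c k| * S k) ≤ L k := fun k => by
    have : |c k| * S k ≤ (1 + |c k|) * (1 + S k) := by nlinarith [hS0 k, abs_nonneg (c k)]
    have h1 : (0 : ℝ) ≤ 2 ^ k := by positivity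
    calc 2 ^ k * (|c k| * S k) ≤ 2 ^ k * ((1 + |c k|) * (1 + S k)) := by gcongr
      _ = L k := by simp only [L]; ring
  let g : ℕ → ℕ → ℝ → ℝ := fun n k s => c (k + n) * (s ^ k * φ (L (k + n) * s))
  have hg : ∀ n k, ContDiff ℝ ∞ (g n k) := fun n k =>
    contDiff_const.mul ((contDiff_id.pow k).mul (hφ.comp (contDiff_const.mul contDiff_id)))
  have hgf : ∀ n k, g n k = fun s => (c (k + n) * (L (k + n))⁻¹ ^ k) * f k (L (k + n) * s) := by
    intro n k
    have : L (k + n) ≠ 0 := by linarith [hL1 (k + n)]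
    ext s
    have h1 : (L (k + n))⁻¹ ^ k * L (k + n) ^ k = 1 := by
      rw [← mul_pow, inv_mul_cancel₀ this, one_pow]
    simp only [g, f, mul_pow]
    linear_combination - (c (k + n) * s ^ k * φ (L (k + n) * s)) * h1
  have hbound : ∀ n j k : ℕ, j + 1 ≤ k → ∀ s, ‖iteratedFDeriv ℝ j (g n k) s‖ ≤ (1 / 2) ^ k := by
    intro n j k hjk s
    have hLp : 0 < L (k + n) := by linarith [hL1 (k + n)]
    have hfj : ContDiff ℝ j (f k) := (hf k).of_le (by exact_mod_cast le_top)
    rw [norm_iteratedFDeriv_eq_norm_iteratedDeriv, hgf, iteratedDeriv_const_mul_field,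
      iteratedDeriv_comp_const_mul hfj]
    rw [norm_mul, norm_mul, norm_mul, norm_pow, norm_pow, norm_inv, Real.norm_of_nonneg hLp.le,
      Real.norm_eq_abs (c _)]
    have h1 := (hM k j (L (k + n) * s)).trans (hS (k + n) k j (by omega) (by omega))
    obtain ⟨d, rfl⟩ := Nat.exists_eq_add_of_le hjk
    have h2 : (L (j + 1 + d + n))⁻¹ ^ (j + 1 + d) * L (j + 1 + d + n) ^ j ≤ (L (j + 1 + d + n))⁻¹ := by
      have : (L (j + 1 + d + n))⁻¹ ^ (j + 1 + d) * L (j + 1 + d + n) ^ j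
          = (L (j + 1 + d + n))⁻¹ * (L (j + 1 + d + n))⁻¹ ^ d := by
        have h3 : (L (j + 1 + d + n))⁻¹ ^ j * L (j + 1 + d + n) ^ j = 1 := by
          rw [← mul_pow, inv_mul_cancel₀ hLp.ne', one_pow]
        rw [pow_add, pow_add, pow_one]
        linear_combination (L (j + 1 + d + n))⁻¹ * (L (j + 1 + d + n))⁻¹ ^ d * h3
      rw [this]
      refine mul_le_of_le_one_right (inv_nonneg.2 hLp.le) (pow_le_one₀ (inv_nonneg.2 hLp.le) ?_)
      exact inv_le_one_of_one_le₀ (hL1 _)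
    set K := j + 1 + d
    calc |c (K + n)| * (L (K + n))⁻¹ ^ K * (L (K + n) ^ j * ‖iteratedDeriv j (f K) (L (K + n) * s)‖)
        = |c (K + n)| * ((L (K + n))⁻¹ ^ K * L (K + n) ^ j) *
            ‖iteratedDeriv j (f K) (L (K + n) * s)‖ := by ring
      _ ≤ |c (K + n)| * (L (K + n))⁻¹ * S (K + n) := by gcongr
      _ = (|c (K + n)| * S (K + n)) / L (K + n) := by ring
      _ ≤ (1 / 2) ^ (K + n) := by
        rw [div_le_iff₀ hLp]
        have := hL (K + n)
        have h2 : (0 : ℝ) < 2 ^ (K + n) := by positivity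
        rw [one_div, inv_pow, inv_mul_eq_div, le_div_iff₀ h2]
        linarith
      _ ≤ (1 / 2) ^ K := pow_le_pow_of_le_one (by norm_num) (by norm_num) (by omega)
  have hsum : Summable fun k : ℕ => (1 / 2 : ℝ) ^ k := summable_geometric_two
  have hev : ∀ n j : ℕ, ∀ᶠ k in Filter.cofinite, ∀ s, ‖iteratedFDeriv ℝ j (g n k) s‖ ≤ (1 / 2) ^ k := by
    intro n j
    rw [Nat.cofinite_eq_atTop]
    filter_upwards [Filter.eventually_ge_atTop (j + 1)] with k hk
    exact hbound n j k hk
  have hW : ∀ n, ContDiff ℝ ∞ fun s => ∑' k, g n k s := fun n =>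
    contDiff_tsum_of_eventually (v := fun _ k => (1 / 2 : ℝ) ^ k) (fun k => hg n k)
      (fun _ _ => hsum) (fun j _ => hev n j)
  refine ⟨_, hW 0, fun n => ?_⟩
  have hq : ∀ k, ∃ w : ℝ → ℝ, ContDiff ℝ ∞ w ∧ ∀ s, g 0 k s - c k * s ^ k = s ^ n * w s := by
    intro k
    refine exists_contDiff_eq_pow_mul ((hg 0 k).sub (by fun_prop)) ?_ n
    have hc : Filter.Tendsto (fun s : ℝ => L k * s) (nhds 0) (nhds 0) := by
      have : Continuous fun s : ℝ => L k * s := by fun_prop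
      simpa using this.tendsto 0
    filter_upwards [hc.eventually φ.eventuallyEq_one] with s hs
    simp [g, hs]
  choose w hw hgw using hq
  refine ⟨fun s => (∑ k ∈ Finset.range n, w k s) + ∑' k, g n k s,
    (ContDiff.sum fun k _ => hw k).add (hW n), fun s => ?_⟩
  have hsm : Summable fun k => g 0 k s := by
    refine Summable.of_norm_bounded_eventually hsum ?_
    filter_upwards [hev 0 0] with k hk
    simpa using hk s
  rw [← hsm.sum_add_tsum_nat_add n, mul_add, Finset.mul_sum, ← tsum_mul_left, ← add_assoc,
    ← Finset.sum_add_distrib]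
  congr 1
  · refine Finset.sum_congr rfl fun k _ => ?_
    rw [← hgw]; ring
  · refine tsum_congr fun k => ?_
    change c (k + n + 0) * (s ^ (k + n) * φ (L (k + n + 0) * s)) =
      s ^ n * (c (k + n) * (s ^ k * φ (L (k + n) * s)))
    rw [add_zero]; ring

theorem exists_even_quotient {e : ℝ → ℝ} (he : ContDiff ℝ ∞ e) (hev : ∀ t, e (-t) = e t) :
    ∃ d : ℝ → ℝ, (ContDiff ℝ ∞ d ∧ ∀ t, d (-t) = d t) ∧ ∀ t, e t = e 0 + t ^ 2 * d t := by
  obtain ⟨w, hw, hew⟩ := exists_contDiff_eq_mul (e := fun t => e t - e 0) (by fun_prop) (by simp)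
  have hodd : (fun t => w t + w (-t)) = fun _ => 0 := by
    refine Continuous.ext_on (dense_compl_singleton (0 : ℝ))
      (by have := hw.continuous; fun_prop) continuous_const ?_
    intro t ht
    have h1 := hew t
    have h2 := hew (-t)
    rw [hev] at h2
    have : t * (w t + w (-t)) = t * 0 := by linear_combination h2 - h1
    exact mul_left_cancel₀ ht this
  have hw0 : w 0 = 0 := by have := congrFun hodd 0; simp at this; linarith
  obtain ⟨d, hd, hwd⟩ := exists_contDiff_eq_mul hw hw0
  refine ⟨d, ⟨hd, fun t => ?_⟩, fun t => ?_⟩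
  · by_cases ht : t = 0
    · simp [ht]
    · have h1 := hwd t
      have h2 := hwd (-t)
      have h3 : w t + w (-t) = 0 := congrFun hodd t
      have : t * d (-t) = t * d t := by linear_combination h1 + h2 - h3
      exact mul_left_cancel₀ ht this
  · have := hew t
    rw [hwd] at this
    linear_combination this

/-- Whitney's theorem: a smooth even function is a smooth function of the square. -/
theorem exists_contDiff_comp_sq {e : ℝ → ℝ} (he : ContDiff ℝ ∞ e) (hev : ∀ t, e (-t) = e t) :
    ∃ A : ℝ → ℝ, ContDiff ℝ ∞ A ∧ ∀ t, e t = A (t ^ 2 / 2) := by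
  have hq : ∀ e : {e : ℝ → ℝ // ContDiff ℝ ∞ e ∧ ∀ t, e (-t) = e t},
      ∃ d : {e : ℝ → ℝ // ContDiff ℝ ∞ e ∧ ∀ t, e (-t) = e t},
        ∀ t, e.1 t = e.1 0 + t ^ 2 * d.1 t := fun e => by
    obtain ⟨d, hd, h⟩ := exists_even_quotient e.2.1 e.2.2
    exact ⟨⟨d, hd⟩, h⟩
  choose D hD using hq
  let E : ℕ → {e : ℝ → ℝ // ContDiff ℝ ∞ e ∧ ∀ t, e (-t) = e t} := fun n => D^[n] ⟨e, he, hev⟩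
  have hE : ∀ n t, e t = ∑ k ∈ Finset.range n, (E k).1 0 * (t ^ 2) ^ k + (t ^ 2) ^ n * (E n).1 t := by
    intro n t
    induction n with
    | zero => simp [E]
    | succ n ih =>
      have h1 : E (n + 1) = D (E n) := Function.iterate_succ_apply' _ _ _
      rw [ih, Finset.sum_range_succ, hD (E n) t, h1]
      ring
  obtain ⟨b, hb, hbw⟩ := exists_contDiff_taylor fun k => (E k).1 0
  have hflat : IsFlat fun t => e t - b (t ^ 2) := by
    intro n
    obtain ⟨w, hw, hbw⟩ := hbw n
    have := (E n).2.1
    refine ⟨fun t => t ^ n * ((E n).1 t - w (t ^ 2)), ?_, fun t => ?_⟩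
    · exact (contDiff_id.pow n).mul (this.sub (hw.comp (contDiff_id.pow 2)))
    · simp only
      rw [hbw, hE n t]
      ring
  have hH := hflat.contDiff_sqrt
  refine ⟨fun x => b (2 * x) + (if 0 < 2 * x then e √(2 * x) - b (√(2 * x) ^ 2) else 0),
    (hb.comp (contDiff_const.mul contDiff_id)).add (hH.comp (contDiff_const.mul contDiff_id)),
    fun t => ?_⟩
  have h2 : 2 * (t ^ 2 / 2) = t ^ 2 := by ring
  simp only [h2]
  split_ifs with ht
  · rw [Real.sqrt_sq_eq_abs, sq_abs]
    rcases abs_choice t with h | h <;> rw [h] <;> simp [hev]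
  · have ht0 : t = 0 := by
      by_contra h
      exact ht (by positivity)
    obtain ⟨w, -, hw⟩ := hflat 1
    have := hw 0
    simp at this
    simp [ht0]
    linarith

end Borel

section Coordinates

@[simp] theorem pt_zero (x y z : ℝ) : pt x y z 0 = x := rfl
@[simp] theorem pt_one (x y z : ℝ) : pt x y z 1 = y := rfl
@[simp] theorem pt_two (x y z : ℝ) : pt x y z 2 = z := rfl

theorem R3_ext {u v : R3} (h0 : u 0 = v 0) (h1 : u 1 = v 1) (h2 : u 2 = v 2) : u = v := by
  ext i
  fin_cases i
  exacts [h0, h1, h2]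

@[simp] theorem pt_eta (q : R3) : pt (q 0) (q 1) (q 2) = q := R3_ext rfl rfl rfl

theorem contDiff_coord (i : Fin 3) {n : WithTop ℕ∞} : ContDiff ℝ n fun q : R3 => q i :=
  (EuclideanSpace.proj (𝕜 := ℝ) i).contDiff

@[fun_prop]
theorem ContDiff.pt {E : Type*} [NormedAddCommGroup E] [NormedSpace ℝ E] {n : WithTop ℕ∞}
    {f g h : E → ℝ} (hf : ContDiff ℝ n f) (hg : ContDiff ℝ n g) (hh : ContDiff ℝ n h) :
    ContDiff ℝ n fun x => pt (f x) (g x) (h x) := by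
  rw [contDiff_euclidean]
  intro i
  fin_cases i
  exacts [hf, hg, hh]

@[fun_prop]
theorem ContDiffOn.pt {E : Type*} [NormedAddCommGroup E] [NormedSpace ℝ E] {n : WithTop ℕ∞}
    {s : Set E} {f g h : E → ℝ} (hf : ContDiffOn ℝ n f s) (hg : ContDiffOn ℝ n g s)
    (hh : ContDiffOn ℝ n h s) : ContDiffOn ℝ n (fun x => pt (f x) (g x) (h x)) s := by
  rw [contDiffOn_euclidean]
  intro i
  fin_cases i
  exacts [hf, hg, hh]

theorem DifferentiableAt.pt {E : Type*} [NormedAddCommGroup E] [NormedSpace ℝ E]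
    {f g h : E → ℝ} {x : E} (hf : DifferentiableAt ℝ f x) (hg : DifferentiableAt ℝ g x)
    (hh : DifferentiableAt ℝ h x) : DifferentiableAt ℝ (fun x => pt (f x) (g x) (h x)) x := by
  rw [differentiableAt_euclidean]
  intro i
  fin_cases i
  exacts [hf, hg, hh]

theorem HasDerivAt.pt {f g h : ℝ → ℝ} {f' g' h' t : ℝ} (hf : HasDerivAt f f' t)
    (hg : HasDerivAt g g' t) (hh : HasDerivAt h h' t) :
    HasDerivAt (fun x => pt (f x) (g x) (h x)) (pt f' g' h') t := by
  have h1 := (hf.differentiableAt.pt hg.differentiableAt hh.differentiableAt).hasDerivAt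
  have h2 : ∀ i : Fin 3, HasDerivAt (fun x => _root_.pt (f x) (g x) (h x) i) _ t := fun i =>
    (EuclideanSpace.proj (𝕜 := ℝ) i).hasFDerivAt.comp_hasDerivAt t h1
  exact h1.congr_deriv (R3_ext ((h2 0).unique hf) ((h2 1).unique hg) ((h2 2).unique hh))

theorem HasFDerivAt.pt_apply {E : Type*} [NormedAddCommGroup E] [NormedSpace ℝ E]
    {f g h : E → ℝ} {f' g' h' : E →L[ℝ] ℝ} {q : E}
    (hf : HasFDerivAt f f' q) (hg : HasFDerivAt g g' q) (hh : HasFDerivAt h h' q) (v : E) :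
    fderiv ℝ (fun x => pt (f x) (g x) (h x)) q v = pt (f' v) (g' v) (h' v) := by
  have h1 := (hf.differentiableAt.pt hg.differentiableAt hh.differentiableAt).hasFDerivAt
  have h2 : ∀ i : Fin 3, HasFDerivAt (fun x => pt (f x) (g x) (h x) i) _ q := fun i =>
    (EuclideanSpace.proj (𝕜 := ℝ) i).hasFDerivAt.comp q h1
  refine R3_ext ?_ ?_ ?_
  · exact DFunLike.congr_fun ((h2 0).unique hf) v
  · exact DFunLike.congr_fun ((h2 1).unique hg) v
  · exact DFunLike.congr_fun ((h2 2).unique hh) v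

/-- The generator of rotations about the third axis. -/
def rotGen (q : R3) : R3 := pt (-(q 1)) (q 0) 0

/-- The rotation by the angle `t` about the third axis. -/
def rot (t : ℝ) (q : R3) : R3 :=
  pt (q 0 * Real.cos t - q 1 * Real.sin t) (q 0 * Real.sin t + q 1 * Real.cos t) (q 2)

/-- The translation by `t` along the third axis. -/
def shift (t : ℝ) (q : R3) : R3 := q + pt 0 0 t

/-- The energy `(x² + y²) / 2`. -/
def psi (q : R3) : ℝ := ((q 0) ^ 2 + (q 1) ^ 2) / 2

theorem contDiff_psi : ContDiff ℝ ∞ psi := by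
  have h0 := contDiff_coord 0 (n := ∞)
  have h1 := contDiff_coord 1 (n := ∞)
  unfold psi
  fun_prop

theorem contDiff_rotGen : ContDiff ℝ ∞ rotGen := by
  have h0 := contDiff_coord 0 (n := ∞)
  have h1 := contDiff_coord 1 (n := ∞)
  unfold rotGen
  fun_prop

theorem contDiff_rot : ContDiff ℝ ∞ fun z : R3 × ℝ => rot z.2 z.1 := by
  have h0 := (contDiff_coord 0 (n := ∞)).comp (contDiff_fst (F := ℝ))
  have h1 := (contDiff_coord 1 (n := ∞)).comp (contDiff_fst (F := ℝ))
  have h2 := (contDiff_coord 2 (n := ∞)).comp (contDiff_fst (F := ℝ))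
  have hc := Real.contDiff_cos.comp (contDiff_snd (𝕜 := ℝ) (n := ∞) (E := R3) (F := ℝ))
  have hs := Real.contDiff_sin.comp (contDiff_snd (𝕜 := ℝ) (n := ∞) (E := R3) (F := ℝ))
  exact ContDiff.pt ((h0.mul hc).sub (h1.mul hs)) ((h0.mul hs).add (h1.mul hc)) h2

theorem contDiff_shift : ContDiff ℝ ∞ fun z : R3 × ℝ => shift z.2 z.1 := by
  unfold shift
  fun_prop

theorem hasDerivAt_rot (t : ℝ) (q : R3) :
    HasDerivAt (fun t => rot t q) (rotGen (rot t q)) t := by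
  have hc := Real.hasDerivAt_cos t
  have hs := Real.hasDerivAt_sin t
  have := HasDerivAt.pt ((hc.const_mul (q 0)).sub (hs.const_mul (q 1)))
    ((hs.const_mul (q 0)).add (hc.const_mul (q 1))) (hasDerivAt_const t (q 2))
  refine this.congr_deriv (R3_ext ?_ ?_ ?_)
  · simp [rot, rotGen]; ring
  · simp [rot, rotGen]; ring
  · simp [rotGen]

theorem hasDerivAt_shift (t : ℝ) (q : R3) : HasDerivAt (fun t => shift t q) (pt 0 0 1) t :=
  (HasDerivAt.pt (hasDerivAt_const t 0) (hasDerivAt_const t 0) (hasDerivAt_id t)).const_add q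

theorem fderiv_rot_apply (t : ℝ) (q v : R3) : fderiv ℝ (rot t) q v = rot t v := by
  have h : ∀ i, HasFDerivAt (fun q : R3 => q i) (EuclideanSpace.proj (𝕜 := ℝ) i) q :=
    fun i => (EuclideanSpace.proj (𝕜 := ℝ) i).hasFDerivAt
  refine (HasFDerivAt.pt_apply (((h 0).mul_const (Real.cos t)).sub ((h 1).mul_const (Real.sin t)))
    (((h 0).mul_const (Real.sin t)).add ((h 1).mul_const (Real.cos t))) (h 2) v).trans ?_
  refine R3_ext ?_ ?_ ?_
  · simp [rot]; ring
  · simp [rot]; ring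
  · simp [rot]

theorem fderiv_shift_apply (t : ℝ) (q v : R3) : fderiv ℝ (shift t) q v = v := by
  have : HasFDerivAt (shift t) (ContinuousLinearMap.id ℝ R3) q :=
    (hasFDerivAt_id q).add_const (pt 0 0 t)
  rw [this.fderiv]; rfl

theorem rot_rotGen (t : ℝ) (q : R3) : rot t (rotGen q) = rotGen (rot t q) := by
  refine R3_ext ?_ ?_ ?_ <;> simp [rot, rotGen] <;> ring

theorem rot_pt_axis (t s : ℝ) : rot t (pt 0 0 s) = pt 0 0 s := by
  refine R3_ext ?_ ?_ ?_ <;> simp [rot]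

theorem rotGen_shift (t : ℝ) (q : R3) : rotGen (shift t q) = rotGen q := by
  refine R3_ext ?_ ?_ ?_ <;> simp [shift, rotGen]

theorem rot_shift (t s : ℝ) (q : R3) : rot t (shift s q) = shift s (rot t q) := by
  refine R3_ext ?_ ?_ ?_ <;> simp [shift, rot]

@[simp] theorem rot_zero (q : R3) : rot 0 q = q := by
  refine R3_ext ?_ ?_ ?_ <;> simp [rot]

@[simp] theorem rot_two_pi (q : R3) : rot (2 * Real.pi) q = q := by
  refine R3_ext ?_ ?_ ?_ <;> simp [rot]

@[simp] theorem shift_zero (q : R3) : shift 0 q = q := by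
  refine R3_ext ?_ ?_ ?_ <;> simp [shift]

end Coordinates

section Averaging

/-- The average of `c` along a flow `S` over a period, with weight `κ`. -/
def avg (S : ℝ → R3 → R3) (κ : ℝ → ℝ) (c : R3 → ℝ) (q : R3) : ℝ :=
  (2 * Real.pi)⁻¹ * ∫ t in (0 : ℝ)..(2 * Real.pi), κ t * c (S t q)

variable {S : ℝ → R3 → R3} {κ : ℝ → ℝ} {c : R3 → ℝ} {V W : R3 → R3}

theorem contDiff_avg (hS : ContDiff ℝ ∞ fun z : R3 × ℝ => S z.2 z.1) (hκ : ContDiff ℝ ∞ κ)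
    (hc : ContDiff ℝ ∞ c) : ContDiff ℝ ∞ (avg S κ c) :=
  contDiff_const.mul (contDiff_integral_param (F := fun z : R3 × ℝ => κ z.2 * c (S z.2 z.1))
    ((hκ.comp contDiff_snd).mul (hc.comp hS)) _ _)

theorem fderiv_avg (hS : ContDiff ℝ ∞ fun z : R3 × ℝ => S z.2 z.1) (hκ : ContDiff ℝ ∞ κ)
    (hc : ContDiff ℝ ∞ c) (hW : ∀ t q, fderiv ℝ (S t) q (W q) = W (S t q)) (q : R3) :
    fderiv ℝ (avg S κ c) q (W q) = avg S κ (fun q => fderiv ℝ c q (W q)) q := by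
  have hF : ContDiff ℝ ∞ (fun z : R3 × ℝ => κ z.2 * c (S z.2 z.1)) :=
    (hκ.comp contDiff_snd).mul (hc.comp hS)
  have h1 : DifferentiableAt ℝ (fun q => ∫ t in (0 : ℝ)..(2 * Real.pi), κ t * c (S t q)) q :=
    ((contDiff_integral_param hF 0 (2 * Real.pi)).differentiable (by simp)) q
  have h2 : fderiv ℝ (avg S κ c) q = (2 * Real.pi)⁻¹ •
      fderiv ℝ (fun q => ∫ t in (0 : ℝ)..(2 * Real.pi), κ t * c (S t q)) q :=
    fderiv_const_mul h1 _
  rw [h2]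
  have h3 := fderiv_integral_param_apply hF 0 (2 * Real.pi) q (W q)
  simp only at h3
  simp only [smul_apply, h3, smul_eq_mul, avg]
  congr 1
  refine intervalIntegral.integral_congr fun t _ => ?_
  have hSt : DifferentiableAt ℝ (S t) q :=
    ((hS.comp (contDiff_prodMk_left t)).differentiable (by simp)) q
  have hct : DifferentiableAt ℝ c (S t q) := hc.differentiable (by simp) _
  have h4 : HasFDerivAt (fun q => κ t * c (S t q))
      (κ t • (fderiv ℝ c (S t q)).comp (fderiv ℝ (S t) q)) q :=
    (hct.hasFDerivAt.comp q hSt.hasFDerivAt).const_mul (κ t)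
  simp [h4.fderiv, hW]

theorem contDiff_fderiv_apply (hc : ContDiff ℝ ∞ c) (hV : ContDiff ℝ ∞ V) :
    ContDiff ℝ ∞ fun q => fderiv ℝ c q (V q) :=
  (hc.fderiv_right (by simp)).clm_apply hV

theorem hasDerivAt_comp_flow (hc : ContDiff ℝ ∞ c)
    (hSV : ∀ t q, HasDerivAt (fun t => S t q) (V (S t q)) t) (q : R3) (t : ℝ) :
    HasDerivAt (fun t => c (S t q)) (fderiv ℝ c (S t q) (V (S t q))) t :=
  (hc.differentiable (by simp) (S t q)).hasFDerivAt.comp_hasDerivAt t (hSV t q)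

theorem avg_one_fderiv (hS : ContDiff ℝ ∞ fun z : R3 × ℝ => S z.2 z.1)
    (hc : ContDiff ℝ ∞ c) (hV : ContDiff ℝ ∞ V)
    (hSV : ∀ t q, HasDerivAt (fun t => S t q) (V (S t q)) t) (q : R3)
    (hper : c (S (2 * Real.pi) q) = c (S 0 q)) :
    avg S (fun _ => 1) (fun q => fderiv ℝ c q (V q)) q = 0 := by
  have hcont : Continuous fun t => fderiv ℝ c (S t q) (V (S t q)) :=
    (contDiff_fderiv_apply hc hV).continuous.comp
      (hS.continuous.comp (by fun_prop : Continuous fun t : ℝ => (q, t)))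
  simp only [avg, one_mul]
  rw [intervalIntegral.integral_eq_sub_of_hasDerivAt
    (fun t _ => hasDerivAt_comp_flow hc hSV q t) (hcont.intervalIntegrable _ _), hper]
  simp

theorem avg_id_fderiv (hS : ContDiff ℝ ∞ fun z : R3 × ℝ => S z.2 z.1)
    (hc : ContDiff ℝ ∞ c) (hV : ContDiff ℝ ∞ V)
    (hSV : ∀ t q, HasDerivAt (fun t => S t q) (V (S t q)) t) (q : R3)
    (hper : c (S (2 * Real.pi) q) = c q) :
    avg S (fun t => t) (fun q => fderiv ℝ c q (V q)) q = c q - avg S (fun _ => 1) c q := by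
  have hcont : Continuous fun t => fderiv ℝ c (S t q) (V (S t q)) :=
    (contDiff_fderiv_apply hc hV).continuous.comp
      (hS.continuous.comp (by fun_prop : Continuous fun t : ℝ => (q, t)))
  have h := intervalIntegral.integral_mul_deriv_eq_deriv_mul (a := 0) (b := 2 * Real.pi)
    (fun t _ => hasDerivAt_id t) (fun t _ => hasDerivAt_comp_flow hc hSV q t)
    intervalIntegrable_const (hcont.intervalIntegrable _ _)
  simp only [id] at h
  simp only [avg, one_mul] at h ⊢
  rw [h, hper]
  have : Real.pi ≠ 0 := Real.pi_ne_zero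
  field_simp
  ring

end Averaging

section AngleFunctions

theorem eq_of_fderiv_flow_eq_zero {S : ℝ → R3 → R3} {V : R3 → R3} {c : R3 → ℝ}
    (hc : ContDiff ℝ ∞ c) (hSV : ∀ t q, HasDerivAt (fun t => S t q) (V (S t q)) t)
    (h : ∀ q, fderiv ℝ c q (V q) = 0) (q : R3) (t : ℝ) : c (S t q) = c (S 0 q) := by
  have h1 := hasDerivAt_comp_flow hc hSV q
  exact is_const_of_deriv_eq_zero (fun t => (h1 t).differentiableAt)
    (fun t => by rw [(h1 t).deriv, h]) t 0

/-- A smooth function invariant under rotations about an axis and translations along it is a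
smooth function of the squared distance to the axis. -/
theorem exists_contDiff_comp_psi {F : R3 → ℝ} (hF : ContDiff ℝ ∞ F)
    (h1 : ∀ q, fderiv ℝ F q (rotGen q) = 0) (h2 : ∀ q, fderiv ℝ F q (pt 0 0 1) = 0) :
    ∃ A : ℝ → ℝ, ContDiff ℝ ∞ A ∧ ∀ q, F q = A (psi q) := by
  have hrot := eq_of_fderiv_flow_eq_zero hF hasDerivAt_rot h1
  have hsh := eq_of_fderiv_flow_eq_zero hF (V := fun _ => pt 0 0 1) hasDerivAt_shift h2
  simp only [rot_zero, shift_zero] at hrot hsh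
  have he : ContDiff ℝ ∞ fun t => F (pt t 0 0) := hF.comp (by fun_prop)
  obtain ⟨A, hA, hFA⟩ := exists_contDiff_comp_sq he fun t => by
    rw [← hrot (pt t 0 0) Real.pi]
    congr 1
    refine R3_ext ?_ ?_ ?_ <;> simp [rot]
  refine ⟨A, hA, fun q => ?_⟩
  set z : ℂ := ⟨q 0, q 1⟩ with hz
  have hre : ‖z‖ * Real.cos z.arg = q 0 := Complex.norm_mul_cos_arg z
  have him : ‖z‖ * Real.sin z.arg = q 1 := Complex.norm_mul_sin_arg z
  have hq : q = shift (q 2) (rot z.arg (pt ‖z‖ 0 0)) := by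
    refine R3_ext ?_ ?_ ?_ <;> simp [shift, rot, hre, him]
  have hpsi : ‖z‖ ^ 2 / 2 = psi q := by
    rw [psi, ← hre, ← him]
    linear_combination - (‖z‖ ^ 2 / 2) * Real.sin_sq_add_cos_sq z.arg
  conv_lhs => rw [hq]
  rw [hsh, hrot, hFA, hpsi]

/-- A closed form `c dθ - a ds` on the tori `psi = const` is, up to an exact form, a combination
of `dθ` and `ds` with coefficients depending only on `psi`. -/
theorem exists_angle_primitive {a c : R3 → ℝ} (ha : ContDiff ℝ ∞ a) (hc : ContDiff ℝ ∞ c)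
    (hpa : ∀ q, a (shift (2 * Real.pi) q) = a q) (hpc : ∀ q, c (shift (2 * Real.pi) q) = c q)
    (hac : ∀ q, fderiv ℝ a q (rotGen q) + fderiv ℝ c q (pt 0 0 1) = 0) :
    ∃ (u : R3 → ℝ) (A C : ℝ → ℝ), ContDiff ℝ ∞ u ∧ ContDiff ℝ ∞ A ∧ ContDiff ℝ ∞ C ∧
      (∀ q, u (shift (2 * Real.pi) q) = u q) ∧
      (∀ q, fderiv ℝ u q (rotGen q) = c q - C (psi q)) ∧
      (∀ q, fderiv ℝ u q (pt 0 0 1) = A (psi q) - a q) := by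
  have hone : ContDiff ℝ ∞ fun _ : ℝ => (1 : ℝ) := contDiff_const
  have hid : ContDiff ℝ ∞ fun t : ℝ => t := contDiff_id
  have hds : ContDiff ℝ ∞ fun _ : R3 => pt 0 0 1 := contDiff_const
  have hSs : ∀ t q, HasDerivAt (fun t => shift t q) ((fun _ : R3 => pt 0 0 1) (shift t q)) t :=
    hasDerivAt_shift
  have hrr : ∀ t q, fderiv ℝ (rot t) q (rotGen q) = rotGen (rot t q) := fun t q => by
    rw [fderiv_rot_apply, rot_rotGen]
  have hrs : ∀ t q, fderiv ℝ (rot t) q ((fun _ => pt 0 0 1) q) = (fun _ => pt 0 0 1) (rot t q) :=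
    fun t q => by rw [fderiv_rot_apply, rot_pt_axis]
  have hsr : ∀ t q, fderiv ℝ (shift t) q (rotGen q) = rotGen (shift t q) := fun t q => by
    rw [fderiv_shift_apply, rotGen_shift]
  have hss : ∀ t q, fderiv ℝ (shift t) q ((fun _ => pt 0 0 1) q) =
      (fun _ => pt 0 0 1) (shift t q) := fun t q => by rw [fderiv_shift_apply]
  have hcs : (fun q => fderiv ℝ c q (pt 0 0 1)) = fun q => -fderiv ℝ a q (rotGen q) :=
    funext fun q => by linarith [hac q]
  have havgneg : ∀ κ (f : R3 → ℝ) q, avg rot κ (fun q => - f q) q = - avg rot κ f q := by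
    intro κ f q
    simp [avg]
  have havg0 : ∀ κ q, avg shift κ (fun _ => 0) q = 0 := by
    intro κ q
    simp [avg]
  set ma := avg rot (fun _ => 1) a with hma
  have hmaC : ContDiff ℝ ∞ ma := contDiff_avg contDiff_rot hone ha
  have hmaθ : ∀ q, fderiv ℝ ma q (rotGen q) = 0 := fun q => by
    rw [hma, fderiv_avg contDiff_rot hone ha hrr,
      avg_one_fderiv contDiff_rot ha contDiff_rotGen hasDerivAt_rot q (by simp)]
  have hmap : ∀ q, ma (shift (2 * Real.pi) q) = ma q := fun q => by
    simp only [hma, avg, rot_shift, hpa]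
  set mc := avg rot (fun _ => 1) c with hmc
  have hmcC : ContDiff ℝ ∞ mc := contDiff_avg contDiff_rot hone hc
  have hmcθ : ∀ q, fderiv ℝ mc q (rotGen q) = 0 := fun q => by
    rw [hmc, fderiv_avg contDiff_rot hone hc hrr,
      avg_one_fderiv contDiff_rot hc contDiff_rotGen hasDerivAt_rot q (by simp)]
  have hmcs : ∀ q, fderiv ℝ mc q (pt 0 0 1) = 0 := fun q => by
    have : fderiv ℝ mc q (pt 0 0 1) = _ := fderiv_avg contDiff_rot hone hc hrs q
    rw [this, hcs, havgneg,
      avg_one_fderiv contDiff_rot ha contDiff_rotGen hasDerivAt_rot q (by simp), neg_zero]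
  set mma := avg shift (fun _ => 1) ma with hmma
  have hmmaC : ContDiff ℝ ∞ mma := contDiff_avg contDiff_shift hone hmaC
  have hmmaθ : ∀ q, fderiv ℝ mma q (rotGen q) = 0 := fun q => by
    rw [hmma, fderiv_avg contDiff_shift hone hmaC hsr]
    simp only [hmaθ, havg0]
  have hmmas : ∀ q, fderiv ℝ mma q (pt 0 0 1) = 0 := fun q => by
    have : fderiv ℝ mma q (pt 0 0 1) = _ := fderiv_avg contDiff_shift hone hmaC hss q
    rw [this, avg_one_fderiv contDiff_shift hmaC hds hSs q (by simp [hmap])]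
  obtain ⟨A, hA, hmA⟩ := exists_contDiff_comp_psi hmmaC hmmaθ hmmas
  obtain ⟨C, hC, hmC⟩ := exists_contDiff_comp_psi hmcC hmcθ hmcs
  have hu1 := contDiff_avg contDiff_rot hid hc
  have hu2 := contDiff_avg contDiff_shift hid hmaC
  have hfd : ∀ q v, fderiv ℝ (fun q => avg rot (fun t => t) c q - avg shift (fun t => t) ma q) q v =
      fderiv ℝ (avg rot (fun t => t) c) q v - fderiv ℝ (avg shift (fun t => t) ma) q v := by
    intro q v
    rw [fderiv_fun_sub (hu1.differentiable (by simp) q) (hu2.differentiable (by simp) q)]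
    rfl
  refine ⟨fun q => avg rot (fun t => t) c q - avg shift (fun t => t) ma q, A, C, hu1.sub hu2,
    hA, hC, fun q => ?_, fun q => ?_, fun q => ?_⟩
  · have hcomm : ∀ s q, ma (shift s (shift (2 * Real.pi) q)) = ma (shift s q) := fun s q => by
      rw [← hmap (shift s q)]
      congr 1
      simp only [shift]; abel
    simp only [avg, rot_shift, hpc, hcomm]
  · rw [hfd, fderiv_avg contDiff_rot hid hc hrr, fderiv_avg contDiff_shift hid hmaC hsr,
      avg_id_fderiv contDiff_rot hc contDiff_rotGen hasDerivAt_rot q (by simp), ← hmC]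
    simp only [hmaθ, havg0, sub_zero, hmc]
  · have e1 : fderiv ℝ (avg rot (fun t => t) c) q (pt 0 0 1) = _ :=
      fderiv_avg contDiff_rot hid hc hrs q
    have e2 : fderiv ℝ (avg shift (fun t => t) ma) q (pt 0 0 1) = _ :=
      fderiv_avg contDiff_shift hid hmaC hss q
    rw [hfd, e1, e2, hcs, havgneg,
      avg_id_fderiv contDiff_rot ha contDiff_rotGen hasDerivAt_rot q (by simp),
      avg_id_fderiv contDiff_shift hmaC hds hSs q (by simp [hmap]), ← hmA]
    simp only [hma, hmma]
    ring

end AngleFunctions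

section Tubes

open Topology Filter

theorem shift_add (s t : ℝ) (q : R3) : shift (s + t) q = shift s (shift t q) := by
  refine R3_ext ?_ ?_ ?_ <;> simp [shift]; ring

@[simp] theorem shift_apply_zero (t : ℝ) (q : R3) : shift t q 0 = q 0 := by simp [shift]
@[simp] theorem shift_apply_one (t : ℝ) (q : R3) : shift t q 1 = q 1 := by simp [shift]
@[simp] theorem shift_apply_two (t : ℝ) (q : R3) : shift t q 2 = q 2 + t := by simp [shift]

theorem shift_pt (t x y z : ℝ) : shift t (pt x y z) = pt x y (z + t) := by
  refine R3_ext ?_ ?_ ?_ <;> simp [shift]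

theorem mem_Dset {r : ℝ} {q : R3} : q ∈ Dset r ↔ (q 0) ^ 2 + (q 1) ^ 2 < r ^ 2 := Iff.rfl

theorem shift_mem_Dset {r t : ℝ} {q : R3} : shift t q ∈ Dset r ↔ q ∈ Dset r := by
  simp [Dset]

theorem axis_mem_Dset {r : ℝ} (hr : 0 < r) (s : ℝ) : pt 0 0 s ∈ Dset r := by
  simpa [Dset] using pow_pos hr 2

theorem Dset_subset {r r' : ℝ} (hr : 0 ≤ r) (h : r ≤ r') : Dset r ⊆ Dset r' := fun q hq => by
  rw [mem_Dset] at hq ⊢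
  nlinarith

theorem isOpen_Dset (r : ℝ) : IsOpen (Dset r) :=
  isOpen_lt (by fun_prop) continuous_const

theorem shift_int_invariant {α : Type*} {F : R3 → α}
    (h : ∀ q, F (shift (2 * Real.pi) q) = F q) (n : ℤ) (q : R3) :
    F (shift (2 * Real.pi * n) q) = F q := by
  induction n with
  | zero => simp
  | succ k ih =>
    rw [← ih, ← h (shift (2 * Real.pi * ((k : ℤ) : ℝ)) q), ← shift_add]; congr 2; push_cast; ring
  | pred k ih =>
    rw [← ih, ← h (shift _ q), ← shift_add]; congr 2; push_cast; ring

theorem shift_int_equivariant {Λ : R3 → R3}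
    (h : ∀ q, Λ (shift (2 * Real.pi) q) = shift (2 * Real.pi) (Λ q)) (n : ℤ) (q : R3) :
    Λ (shift (2 * Real.pi * n) q) = shift (2 * Real.pi * n) (Λ q) := by
  have := shift_int_invariant (F := fun q => Λ q - q) (fun q => by rw [h]; simp [shift]) n q
  simp only [shift] at this ⊢
  rw [sub_eq_iff_eq_add] at this
  rw [this]; abel

theorem exists_shift_mem_Icc (q : R3) :
    ∃ n : ℤ, shift (2 * Real.pi * n) q 2 ∈ Set.Icc 0 (2 * Real.pi) := by
  have hpi : 0 < 2 * Real.pi := Real.two_pi_pos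
  refine ⟨-⌊q 2 / (2 * Real.pi)⌋, ?_⟩
  have h1 := Int.floor_le (q 2 / (2 * Real.pi))
  have h2 := (Int.lt_floor_add_one (q 2 / (2 * Real.pi))).le
  rw [le_div_iff₀ hpi] at h1
  rw [div_le_iff₀ hpi] at h2
  simp only [shift_apply_two, Set.mem_Icc]
  push_cast
  constructor <;> linarith

/-- Compactness of the axis modulo translation by the period, for a property of two points. -/
theorem exists_Dset_of_eventually_pair {P : R3 → R3 → Prop}
    (h1 : ∀ q q', P (shift (2 * Real.pi) q) q' ↔ P q q')
    (h2 : ∀ q q', P q (shift (2 * Real.pi) q') ↔ P q q')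
    (h : ∀ s s', ∀ᶠ z in 𝓝 (pt 0 0 s, pt 0 0 s'), P z.1 z.2) {r₀ : ℝ} (hr₀ : 0 < r₀) :
    ∃ r, 0 < r ∧ r ≤ r₀ ∧ ∀ q ∈ Dset r, ∀ q' ∈ Dset r, P q q' := by
  let m : ((ℝ × ℝ) × (ℝ × ℝ)) × (ℝ × ℝ) → R3 × R3 := fun w =>
    (pt w.1.1.1 w.1.1.2 w.2.1, pt w.1.2.1 w.1.2.2 w.2.2)
  have hm : Continuous m := by
    have : ContDiff ℝ 0 m := by fun_prop
    exact this.continuous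
  let n := m ⁻¹' interior {z : R3 × R3 | P z.1 z.2}
  have hn : IsOpen n := isOpen_interior.preimage hm
  obtain ⟨u, v, hu, -, hu0, hv, huv⟩ := generalized_tube_lemma
    (isCompact_singleton (x := ((0, 0), (0, 0))))
    ((isCompact_Icc (a := (0 : ℝ)) (b := 2 * Real.pi)).prod
      (isCompact_Icc (a := (0 : ℝ)) (b := 2 * Real.pi))) hn (by
      rintro ⟨a, s, s'⟩ ⟨ha, -⟩
      obtain rfl : a = _ := ha
      exact mem_interior_iff_mem_nhds.2 (h s s'))
  obtain ⟨ε, hε, hball⟩ := Metric.isOpen_iff.1 hu _ (hu0 rfl)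
  refine ⟨min ε r₀, lt_min hε hr₀, min_le_right _ _, fun q hq q' hq' => ?_⟩
  obtain ⟨k, hk⟩ := exists_shift_mem_Icc q
  obtain ⟨k', hk'⟩ := exists_shift_mem_Icc q'
  have e1 := shift_int_invariant (F := fun q => P q q') (fun q => propext (h1 q q')) k q
  have e2 := shift_int_invariant (F := fun q' => P (shift (2 * Real.pi * k) q) q')
    (fun q' => propext (h2 _ q')) k' q'
  rw [← e1, ← e2]
  have habs : ∀ q ∈ Dset (min ε r₀), |q 0| < ε ∧ |q 1| < ε := fun q hq => by
    have hq' := Dset_subset (lt_min hε hr₀).le (min_le_left _ _) hq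
    rw [mem_Dset] at hq'
    constructor <;> refine abs_lt_of_sq_lt_sq ?_ hε.le <;>
      nlinarith [sq_nonneg (q 0), sq_nonneg (q 1)]
  have hmem : (((q 0, q 1), (q' 0, q' 1)),
      (shift (2 * Real.pi * k) q 2, shift (2 * Real.pi * k') q' 2)) ∈ n := by
    refine huv ⟨hball ?_, hv ⟨hk, hk'⟩⟩
    simp [Prod.dist_eq, habs q hq, habs q' hq']
  have := interior_subset hmem
  simpa [m, ← shift_pt] using this

theorem exists_Dset_of_eventually {P : R3 → Prop}
    (h1 : ∀ q, P (shift (2 * Real.pi) q) ↔ P q)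
    (h : ∀ s, ∀ᶠ q in 𝓝 (pt 0 0 s), P q) {r₀ : ℝ} (hr₀ : 0 < r₀) :
    ∃ r, 0 < r ∧ r ≤ r₀ ∧ ∀ q ∈ Dset r, P q := by
  obtain ⟨r, hr, hr', H⟩ := exists_Dset_of_eventually_pair (P := fun q _ => P q)
    (fun q _ => h1 q) (fun _ _ => Iff.rfl)
    (fun s s' => (continuous_fst.tendsto (pt 0 0 s, pt 0 0 s')).eventually (h s)) hr₀
  exact ⟨r, hr, hr', fun q hq => H q hq q hq⟩

/-- A map that is invariant under the period, locally injective at the axis and injective on the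
axis modulo the period is injective modulo the period on a tube. -/
theorem exists_Dset_injOn_mod {X : Type*} [TopologicalSpace X] [T2Space X] {F : R3 → X}
    {r₀ : ℝ} (hr₀ : 0 < r₀) (hF : ContinuousOn F (Dset r₀))
    (hper : ∀ q, F (shift (2 * Real.pi) q) = F q)
    (hloc : ∀ s, ∃ V ∈ 𝓝 (pt 0 0 s), Set.InjOn F V)
    (hax : ∀ s s', F (pt 0 0 s) = F (pt 0 0 s') → ∃ n : ℤ, s = s' + 2 * Real.pi * n) :
    ∃ r, 0 < r ∧ r ≤ r₀ ∧ ∀ q ∈ Dset r, ∀ q' ∈ Dset r, F q = F q' →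
      ∃ n : ℤ, q = shift (2 * Real.pi * n) q' := by
  refine exists_Dset_of_eventually_pair
    (P := fun q q' => F q = F q' → ∃ n : ℤ, q = shift (2 * Real.pi * n) q') ?_ ?_ ?_ hr₀
  · intro q q'
    rw [hper]
    refine imp_congr_right fun _ => ⟨fun ⟨n, hn⟩ => ⟨n - 1, ?_⟩, fun ⟨n, hn⟩ => ⟨n + 1, ?_⟩⟩
    · have := congrArg (shift (-(2 * Real.pi))) hn
      rw [← shift_add, ← shift_add, neg_add_cancel, shift_zero] at this
      rw [this]; congr 1; push_cast; ring
    · rw [hn, ← shift_add]; congr 1; push_cast; ring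
  · intro q q'
    rw [hper]
    refine imp_congr_right fun _ => ⟨fun ⟨n, hn⟩ => ⟨n + 1, ?_⟩, fun ⟨n, hn⟩ => ⟨n - 1, ?_⟩⟩
    · rw [hn, ← shift_add]; congr 1; push_cast; ring
    · rw [hn, ← shift_add]; congr 1; push_cast; ring
  · intro s s'
    have hcont : ∀ s, ContinuousAt F (pt 0 0 s) := fun s =>
      hF.continuousAt ((isOpen_Dset r₀).mem_nhds (axis_mem_Dset hr₀ s))
    by_cases he : F (pt 0 0 s) = F (pt 0 0 s')
    · obtain ⟨n, rfl⟩ := hax s s' he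
      obtain ⟨V, hV, hinj⟩ := hloc s'
      have hs : Continuous fun q => shift (-(2 * Real.pi * n)) q := by unfold shift; fun_prop
      have e : shift (-(2 * Real.pi * n)) (pt 0 0 (s' + 2 * Real.pi * n)) = pt 0 0 s' := by
        rw [shift_pt]; congr 1; ring
      have hV' := hs.continuousAt.preimage_mem_nhds (x := pt 0 0 (s' + 2 * Real.pi * n))
        (e.symm ▸ hV)
      rw [nhds_prod_eq]
      filter_upwards [prod_mem_prod hV' hV] with z hz heq
      refine ⟨n, ?_⟩
      have e3 : F (shift (-(2 * Real.pi * n)) z.1) = F z.1 := by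
        have := shift_int_invariant hper (-n) z.1
        rwa [Int.cast_neg, mul_neg] at this
      have := hinj hz.1 hz.2 (e3.trans heq)
      rw [← this, ← shift_add, add_neg_cancel, shift_zero]
    · obtain ⟨A, A', hA, hA', hsA, hsA', hd⟩ := t2_separation he
      rw [nhds_prod_eq]
      filter_upwards [prod_mem_prod ((hcont s).preimage_mem_nhds (hA.mem_nhds hsA))
        ((hcont s').preimage_mem_nhds (hA'.mem_nhds hsA'))] with z hz heq
      exact absurd (show F z.1 ∈ A' from heq ▸ hz.2) (Set.disjoint_left.1 hd hz.1)

end Tubes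

section Inverse

open Topology Filter

/-- The Jacobian determinant. -/
def jac (Φ : R3 → R3) (q : R3) : ℝ := LinearMap.det (fderiv ℝ Φ q).toLinearMap

variable {Φ Λ : R3 → R3} {q : R3} {r₀ : ℝ}

theorem exists_openPartialHomeomorph (h : ContDiffAt ℝ ∞ Φ q) (hd : jac Φ q ≠ 0) :
    ∃ e : OpenPartialHomeomorph R3 R3, (e : R3 → R3) = Φ ∧ q ∈ e.source ∧
      ContDiffAt ℝ ∞ e.symm (Φ q) := by
  let f' := (fderiv ℝ Φ q).toContinuousLinearEquivOfDetNeZero hd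
  have hf' : HasFDerivAt Φ (f' : R3 →L[ℝ] R3) q := by
    rw [show (f' : R3 →L[ℝ] R3) = fderiv ℝ Φ q from
      ContinuousLinearMap.coe_toContinuousLinearEquivOfDetNeZero _ _]
    exact (h.differentiableAt (by simp)).hasFDerivAt
  exact ⟨h.toOpenPartialHomeomorph Φ hf' (by simp), rfl,
    h.mem_toOpenPartialHomeomorph_source hf' (by simp), h.to_localInverse hf' (by simp)⟩

theorem exists_injOn_nhds (h : ContDiffAt ℝ ∞ Φ q) (hd : jac Φ q ≠ 0) :
    ∃ V ∈ 𝓝 q, Set.InjOn Φ V := by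
  obtain ⟨e, rfl, hq, -⟩ := exists_openPartialHomeomorph h hd
  exact ⟨e.source, e.open_source.mem_nhds hq, e.injOn⟩

theorem isOpen_image_of_jac_ne_zero {s : Set R3} (hs : IsOpen s) (h : ContDiffOn ℝ ∞ Φ s)
    (hd : ∀ q ∈ s, jac Φ q ≠ 0) : IsOpen (Φ '' s) := by
  rw [isOpen_iff_mem_nhds]
  rintro _ ⟨q, hq, rfl⟩
  obtain ⟨e, he, hqe, -⟩ :=
    exists_openPartialHomeomorph (h.contDiffAt (hs.mem_nhds hq)) (hd q hq)
  rw [← he, ← e.map_nhds_eq hqe]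
  exact image_mem_map (hs.mem_nhds hq)

theorem continuousAt_jac (h : ContDiffAt ℝ ∞ Φ q) : ContinuousAt (jac Φ) q :=
  (ContinuousLinearMap.continuous_det (𝕜 := ℝ) (E := R3)).continuousAt.comp
    ((h.fderiv_right (m := 0) (by simp)).continuousAt)

theorem contDiff_shift_right (t : ℝ) : ContDiff ℝ ∞ (shift t) := by
  unfold shift; fun_prop

theorem fderiv_comp_shift {F : Type*} [NormedAddCommGroup F] [NormedSpace ℝ F] (f : R3 → F)
    (t : ℝ) (q : R3) : fderiv ℝ (fun q => f (shift t q)) q = fderiv ℝ f (shift t q) :=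
  fderiv_comp_add_right _

theorem fderiv_periodic {F : Type*} [NormedAddCommGroup F] [NormedSpace ℝ F] {f : R3 → F}
    {t : ℝ} (h : ∀ q, f (shift t q) = f q) (q : R3) : fderiv ℝ f (shift t q) = fderiv ℝ f q := by
  rw [← fderiv_comp_shift]; simp_rw [h]

theorem fderiv_equivariant {t : ℝ} (h : ∀ q, Λ (shift t q) = shift t (Λ q)) (q : R3) :
    fderiv ℝ Λ (shift t q) = fderiv ℝ Λ q := by
  rw [← fderiv_comp_shift]
  simp_rw [h]
  exact fderiv_add_const (f := Λ) _

theorem jac_mul_of_comp_eq {N : R3 → R3} (hN : DifferentiableAt ℝ N q)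
    (hΛ : DifferentiableAt ℝ Λ (N q)) :
    jac (fun q => Λ (N q)) q = jac Λ (N q) * jac N q := by
  have : fderiv ℝ (fun q => Λ (N q)) q = (fderiv ℝ Λ (N q)).comp (fderiv ℝ N q) :=
    fderiv_comp q hΛ hN
  rw [jac, this, jac, jac, ← LinearMap.det_comp]
  rfl

theorem jac_congr {Φ' : R3 → R3} (h : Φ =ᶠ[𝓝 q] Φ') : jac Φ q = jac Φ' q := by
  rw [jac, h.fderiv_eq, jac]

theorem jac_id : jac (fun q => q) q = 1 := by
  rw [jac, fderiv_fun_id]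
  exact LinearMap.det_id

theorem continuous_surjective_of_equivariant {σ : ℝ → ℝ} (hσ : Continuous σ)
    (h : ∀ n : ℤ, σ (2 * Real.pi * n) = σ 0 + 2 * Real.pi * n) : Function.Surjective σ := by
  intro y
  have hpi : 0 < 2 * Real.pi := Real.two_pi_pos
  refine mem_range_of_exists_le_of_exists_ge hσ ?_ ?_
  · refine ⟨2 * Real.pi * ⌊(y - σ 0) / (2 * Real.pi)⌋, ?_⟩
    have h1 := Int.floor_le ((y - σ 0) / (2 * Real.pi))
    rw [le_div_iff₀ hpi] at h1
    rw [h]; linarith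
  · refine ⟨2 * Real.pi * ⌈(y - σ 0) / (2 * Real.pi)⌉, ?_⟩
    have h1 := Int.le_ceil ((y - σ 0) / (2 * Real.pi))
    rw [div_le_iff₀ hpi] at h1
    rw [h]; linarith

/-- An equivariant map preserving the axis, with invertible differential along the axis, has a
smooth equivariant inverse on a tube. -/
theorem exists_equivariant_inverse (hr₀ : 0 < r₀) (hΛ : ContDiffOn ℝ ∞ Λ (Dset r₀))
    (heq : ∀ q, Λ (shift (2 * Real.pi) q) = shift (2 * Real.pi) (Λ q))
    (hax : ∀ s, Λ (pt 0 0 s) 0 = 0 ∧ Λ (pt 0 0 s) 1 = 0)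
    (hdet : ∀ s, jac Λ (pt 0 0 s) ≠ 0) :
    ∃ (r : ℝ) (N : R3 → R3), 0 < r ∧ ContDiffOn ℝ ∞ N (Dset r) ∧
      (∀ q, N (shift (2 * Real.pi) q) = shift (2 * Real.pi) (N q)) ∧
      (∀ q ∈ Dset r, N q ∈ Dset r₀) ∧ (∀ q ∈ Dset r, Λ (N q) = q) ∧
      (∀ q ∈ Dset r, jac N q ≠ 0) ∧
      (∀ s, ∃ s', N (pt 0 0 s) = pt 0 0 s') ∧ (∀ s, ∃ s', N (pt 0 0 s') = pt 0 0 s) := by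
  classical
  have hat : ∀ {q}, q ∈ Dset r₀ → ContDiffAt ℝ ∞ Λ q := fun hq =>
    hΛ.contDiffAt ((isOpen_Dset r₀).mem_nhds hq)
  set σ : ℝ → ℝ := fun s => Λ (pt 0 0 s) 2 with hσdef
  have hσ : ∀ s, Λ (pt 0 0 s) = pt 0 0 (σ s) := fun s => by
    rw [← pt_eta (Λ (pt 0 0 s)), (hax s).1, (hax s).2]
  have haxis : ∀ s, HasDerivAt (fun s => pt 0 0 s) (pt 0 0 1) s := fun s =>
    HasDerivAt.pt (hasDerivAt_const s 0) (hasDerivAt_const s 0) (hasDerivAt_id s)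
  have hσ' : ∀ s, HasDerivAt (fun s => Λ (pt 0 0 s)) (fderiv ℝ Λ (pt 0 0 s) (pt 0 0 1)) s :=
    fun s => ((hat (axis_mem_Dset hr₀ s)).differentiableAt
      (by simp)).hasFDerivAt.comp_hasDerivAt s (haxis s)
  have hσi : ∀ i s, HasDerivAt (fun s => Λ (pt 0 0 s) i)
      (fderiv ℝ Λ (pt 0 0 s) (pt 0 0 1) i) s := fun i s =>
    (EuclideanSpace.proj (𝕜 := ℝ) i).hasFDerivAt.comp_hasDerivAt s (hσ' s)
  have hσcont : Continuous σ :=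
    continuous_iff_continuousAt.2 fun s => (hσi 2 s).continuousAt
  have hσinj : Function.Injective σ := by
    have key : ∀ a b, a < b → σ a ≠ σ b := by
      intro a b hab hE
      obtain ⟨c, -, hc⟩ := exists_hasDerivAt_eq_zero hab hσcont.continuousOn hE
        fun x _ => hσi 2 x
      have h0 : fderiv ℝ Λ (pt 0 0 c) (pt 0 0 1) = 0 := by
        refine R3_ext ?_ ?_ hc
        · have h := hσi 0 c
          simp only [(hax _).1] at h
          exact h.unique (hasDerivAt_const c 0)
        · have h := hσi 1 c
          simp only [(hax _).2] at h
          exact h.unique (hasDerivAt_const c 0)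
      have hinj := (LinearMap.equivOfDetNeZero _ (hdet c)).injective
      have := @hinj (pt 0 0 1) 0 (h0.trans (map_zero _).symm)
      simpa using congrArg (fun v : R3 => v 2) this
    intro a b hE
    rcases lt_trichotomy a b with h | h | h
    exacts [(key a b h hE).elim, h, (key b a h hE.symm).elim]
  have hσshift : ∀ (n : ℤ) s, σ (s + 2 * Real.pi * n) = σ s + 2 * Real.pi * n := fun n s => by
    have := shift_int_equivariant heq n (pt 0 0 s)
    rw [shift_pt] at this
    simp [hσdef, this]
  have hσsurj : Function.Surjective σ := continuous_surjective_of_equivariant hσcont fun n => by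
    simpa using hσshift n 0
  -- the determinant does not vanish on a tube
  obtain ⟨r₁, hr₁, hr₁₀, hjac⟩ := exists_Dset_of_eventually (P := fun q => jac Λ q ≠ 0)
    (fun q => by rw [jac, fderiv_equivariant heq, jac])
    (fun s => (continuousAt_jac (hat (axis_mem_Dset hr₀ s))).eventually_ne (hdet s)) hr₀
  have hsub₁ := Dset_subset hr₁.le hr₁₀
  -- injectivity modulo the period
  let F : R3 → ℝ × ℝ × Real.Angle := fun q => (Λ q 0, Λ q 1, (Λ q 2 : Real.Angle))
  have hFeq : ∀ q q', F q = F q' → ∃ n : ℤ, Λ q = shift (2 * Real.pi * n) (Λ q') := by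
    intro q q' h
    simp only [F, Prod.mk.injEq] at h
    obtain ⟨n, hn⟩ := Real.Angle.angle_eq_iff_two_pi_dvd_sub.1 h.2.2
    refine ⟨n, R3_ext ?_ ?_ ?_⟩
    · simpa using h.1
    · simpa using h.2.1
    · simp; linarith
  obtain ⟨r₂, hr₂, hr₂₁, hinj⟩ := exists_Dset_injOn_mod (F := F) hr₁ (by
      have hc := (hΛ.continuousOn.mono hsub₁)
      have hi : ∀ i : Fin 3, ContinuousOn (fun q => Λ q i) (Dset r₁) := fun i =>
        (EuclideanSpace.proj (𝕜 := ℝ) i).continuous.comp_continuousOn hc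
      exact (hi 0).prodMk ((hi 1).prodMk (Real.Angle.continuous_coe.comp_continuousOn (hi 2))))
    (fun q => by simp [F, heq]) (fun s => by
      have hmem := axis_mem_Dset hr₀ s
      obtain ⟨V, hV, hVi⟩ := exists_injOn_nhds (hat hmem) (hdet s)
      have h2 : ContinuousAt (fun q => Λ q 2) (pt 0 0 s) :=
        (EuclideanSpace.proj (𝕜 := ℝ) 2).continuous.continuousAt.comp (hat hmem).continuousAt
      have hB := h2.preimage_mem_nhds (Metric.ball_mem_nhds _ one_pos)
      refine ⟨_, inter_mem hV hB, fun q hq q' hq' hE => hVi hq.1 hq'.1 ?_⟩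
      obtain ⟨n, hn⟩ := hFeq _ _ hE
      have h3 : |2 * Real.pi * (n : ℝ)| < 2 := by
        have e : 2 * Real.pi * (n : ℝ) = Λ q 2 - Λ q' 2 := by rw [hn]; simp
        rw [e, ← Real.dist_eq]
        have := dist_triangle_right (Λ q 2) (Λ q' 2) (Λ (pt 0 0 s) 2)
        have a1 := hq.2
        have a2 := hq'.2
        simp only [Set.mem_preimage, Metric.mem_ball] at a1 a2
        linarith
      have h4 : n = 0 := by
        by_contra hne
        have : (1 : ℝ) ≤ |(n : ℝ)| := by exact_mod_cast Int.one_le_abs hne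
        rw [abs_mul, abs_of_pos Real.two_pi_pos] at h3
        nlinarith [Real.pi_gt_three]
      rw [hn, h4]; simp)
    (fun s s' hE => by
      obtain ⟨n, hn⟩ := hFeq _ _ hE
      refine ⟨n, hσinj ?_⟩
      rw [hσshift]
      simpa using congrArg (fun v : R3 => v 2) hn)
  have hsub₂ := Dset_subset hr₂.le hr₂₁
  have hΛinj : Set.InjOn Λ (Dset r₂) := by
    intro q hq q' hq' hE
    obtain ⟨n, rfl⟩ := hinj q hq q' hq' (by simp [F, hE])
    rw [shift_int_equivariant heq] at hE
    have h2 : 2 * Real.pi * (n : ℝ) = 0 := by simpa using congrArg (fun v : R3 => v 2) hE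
    rw [h2, shift_zero]
  have hWopen : IsOpen (Λ '' Dset r₂) := isOpen_image_of_jac_ne_zero (isOpen_Dset r₂)
    (hΛ.mono (hsub₂.trans hsub₁)) fun q hq => hjac q (hsub₂ hq)
  obtain ⟨r, hr, -, hW⟩ := exists_Dset_of_eventually (P := fun q => q ∈ Λ '' Dset r₂)
    (fun q => ⟨fun ⟨w, hw, hwq⟩ => ⟨shift (2 * Real.pi * (-1 : ℤ)) w, shift_mem_Dset.2 hw, by
        rw [shift_int_equivariant heq, hwq, ← shift_add]; simp⟩,
      fun ⟨w, hw, hwq⟩ => ⟨shift (2 * Real.pi) w, shift_mem_Dset.2 hw, by rw [heq, hwq]⟩⟩)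
    (fun s => by
      obtain ⟨t, rfl⟩ := hσsurj s
      exact hWopen.mem_nhds ⟨pt 0 0 t, axis_mem_Dset hr₂ t, hσ t⟩) hr₂
  choose! G hG hΛG using hW
  let N : R3 → R3 := fun q => if q ∈ Dset r then G q else q
  have hNG : ∀ q ∈ Dset r, N q = G q := fun q hq => if_pos hq
  have hN₂ : ∀ q ∈ Dset r, N q ∈ Dset r₂ := fun q hq => by rw [hNG q hq]; exact hG q hq
  have hN₀ : ∀ q ∈ Dset r, N q ∈ Dset r₀ := fun q hq => hsub₁ (hsub₂ (hN₂ q hq))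
  have hΛN : ∀ q ∈ Dset r, Λ (N q) = q := fun q hq => by rw [hNG q hq]; exact hΛG q hq
  have huniq : ∀ q ∈ Dset r, ∀ w ∈ Dset r₂, Λ w = q → N q = w := fun q hq w hw h =>
    hΛinj (hN₂ q hq) hw ((hΛN q hq).trans h.symm)
  have hNsm : ContDiffOn ℝ ∞ N (Dset r) := by
    intro q hq
    obtain ⟨e, he, hqe, hsymm⟩ := exists_openPartialHomeomorph (hat (hN₀ q hq))
      (hjac _ (hsub₂ (hN₂ q hq)))
    rw [hΛN q hq] at hsymm
    refine (hsymm.congr_of_eventuallyEq ?_).contDiffWithinAt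
    have hqt : q ∈ e.target := by
      have := e.map_source hqe
      rwa [he, hΛN q hq] at this
    have hes : e.symm q = N q := by
      have := e.left_inv hqe
      rwa [he, hΛN q hq] at this
    have hc : ∀ᶠ q' in 𝓝 q, e.symm q' ∈ Dset r₂ :=
      (e.continuousAt_symm hqt).eventually_mem ((isOpen_Dset r₂).mem_nhds (by
        rw [hes]; exact hN₂ q hq))
    filter_upwards [hc, e.open_target.mem_nhds hqt, (isOpen_Dset r).mem_nhds hq] with q' h1 h2 h3
    refine huniq q' h3 _ h1 ?_
    rw [← he]; exact e.right_inv h2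
  refine ⟨r, N, hr, hNsm, fun q => ?_, hN₀, hΛN, fun q hq => ?_, fun s => ?_, fun s => ?_⟩
  · by_cases hq : q ∈ Dset r
    · refine huniq _ (shift_mem_Dset.2 hq) _ (shift_mem_Dset.2 (hN₂ q hq)) ?_
      rw [heq, hΛN q hq]
    · have : shift (2 * Real.pi) q ∉ Dset r := fun h => hq (shift_mem_Dset.1 h)
      simp only [N, if_neg hq, if_neg this]
  · have h1 := jac_mul_of_comp_eq
      ((hNsm.contDiffAt ((isOpen_Dset r).mem_nhds hq)).differentiableAt (by simp))
      ((hat (hN₀ q hq)).differentiableAt (by simp))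
    rw [jac_congr (Φ' := fun q => q) (by
      filter_upwards [(isOpen_Dset r).mem_nhds hq] with q hq using hΛN q hq), jac_id] at h1
    exact right_ne_zero_of_mul (h1 ▸ one_ne_zero)
  · obtain ⟨t, rfl⟩ := hσsurj s
    exact ⟨t, huniq _ (axis_mem_Dset hr _) _ (axis_mem_Dset hr₂ t) (hσ t)⟩
  · exact ⟨σ s, huniq _ (axis_mem_Dset hr _) _ (axis_mem_Dset hr₂ s) (hσ s)⟩

end Inverse

section VectorAlgebra

/-- The triple product. -/
def det3 (u v w : R3) : ℝ :=
  u 0 * (v 1 * w 2 - v 2 * w 1) - u 1 * (v 0 * w 2 - v 2 * w 0) + u 2 * (v 0 * w 1 - v 1 * w 0)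

/-- The scalar product, in coordinates. -/
def dot3 (u v : R3) : ℝ := u 0 * v 0 + u 1 * v 1 + u 2 * v 2

theorem inner_eq_dot3 (u v : R3) : ⟪u, v⟫ = dot3 u v := by
  simp [PiLp.inner_apply, Fin.sum_univ_three, dot3, mul_comm]

theorem pt_eq_smul (x y z : ℝ) : pt x y z = x • pt 1 0 0 + y • pt 0 1 0 + z • pt 0 0 1 := by
  refine R3_ext ?_ ?_ ?_ <;> simp

theorem map_pt {F : Type*} [NormedAddCommGroup F] [NormedSpace ℝ F] (A : R3 →L[ℝ] F) (x y z : ℝ) :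
    A (pt x y z) = x • A (pt 1 0 0) + y • A (pt 0 1 0) + z • A (pt 0 0 1) := by
  rw [pt_eq_smul]; simp

theorem map_eq_sum {F : Type*} [NormedAddCommGroup F] [NormedSpace ℝ F] (A : R3 →L[ℝ] F) (v : R3) :
    A v = v 0 • A (pt 1 0 0) + v 1 • A (pt 0 1 0) + v 2 • A (pt 0 0 1) := by
  rw [← map_pt, pt_eta]

theorem e3_zero : e3 0 = pt 1 0 0 := by refine R3_ext ?_ ?_ ?_ <;> simp [e3]
theorem e3_one : e3 1 = pt 0 1 0 := by refine R3_ext ?_ ?_ ?_ <;> simp [e3]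
theorem e3_two : e3 2 = pt 0 0 1 := by refine R3_ext ?_ ?_ ?_ <;> simp [e3]

theorem det_eq_det3 (A : R3 →L[ℝ] R3) :
    LinearMap.det A.toLinearMap = det3 (A (pt 1 0 0)) (A (pt 0 1 0)) (A (pt 0 0 1)) := by
  rw [← LinearMap.det_toMatrix (EuclideanSpace.basisFun (Fin 3) ℝ).toBasis, Matrix.det_fin_three]
  have h : ∀ i j, (LinearMap.toMatrix (EuclideanSpace.basisFun (Fin 3) ℝ).toBasis
      (EuclideanSpace.basisFun (Fin 3) ℝ).toBasis A.toLinearMap) i j = A (e3 j) i := fun i j => by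
    simp [LinearMap.toMatrix_apply, e3]
  simp only [h, e3_zero, e3_one, e3_two, det3]
  ring

theorem divg_eq (v : R3 → R3) (z : R3) :
    divg v z = fderiv ℝ v z (pt 1 0 0) 0 + fderiv ℝ v z (pt 0 1 0) 1 +
      fderiv ℝ v z (pt 0 0 1) 2 := by
  rw [divg, LinearMap.trace_eq_matrix_trace ℝ (EuclideanSpace.basisFun (Fin 3) ℝ).toBasis,
    Matrix.trace, Fin.sum_univ_three]
  simp only [Matrix.diag, LinearMap.toMatrix_apply, OrthonormalBasis.coe_toBasis_repr_apply,
    OrthonormalBasis.coe_toBasis, EuclideanSpace.basisFun_apply, EuclideanSpace.basisFun_repr,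
    ← e3_zero, ← e3_one, ← e3_two]
  rfl

theorem fderiv_eq_dot3 (p : R3 → ℝ) (z v : R3) : fderiv ℝ p z v = dot3 (gradient p z) v := by
  rw [← inner_eq_dot3, gradient, InnerProductSpace.toDual_symm_apply]

theorem hasFDerivAt_coord {E : Type*} [NormedAddCommGroup E] [NormedSpace ℝ E] {u : E → R3}
    {q : E} (hu : DifferentiableAt ℝ u q) (i : Fin 3) :
    HasFDerivAt (fun q => u q i) ((EuclideanSpace.proj (𝕜 := ℝ) i).comp (fderiv ℝ u q)) q :=
  (EuclideanSpace.proj (𝕜 := ℝ) i).hasFDerivAt.comp q hu.hasFDerivAt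

theorem fderiv_det3 {u v w : R3 → R3} {q : R3} (hu : DifferentiableAt ℝ u q)
    (hv : DifferentiableAt ℝ v q) (hw : DifferentiableAt ℝ w q) (e : R3) :
    fderiv ℝ (fun q => det3 (u q) (v q) (w q)) q e =
      det3 (fderiv ℝ u q e) (v q) (w q) + det3 (u q) (fderiv ℝ v q e) (w q) +
        det3 (u q) (v q) (fderiv ℝ w q e) := by
  have U := hasFDerivAt_coord hu
  have V := hasFDerivAt_coord hv
  have W := hasFDerivAt_coord hw
  have h := (((U 0).mul (((V 1).mul (W 2)).sub ((V 2).mul (W 1)))).sub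
    ((U 1).mul (((V 0).mul (W 2)).sub ((V 2).mul (W 0))))).add
    ((U 2).mul (((V 0).mul (W 1)).sub ((V 1).mul (W 0))))
  refine (congrArg (fun A : R3 →L[ℝ] ℝ => A e) h.fderiv).trans ?_
  simp [det3]
  ring

theorem fderiv_dot3 {u v : R3 → R3} {q : R3} (hu : DifferentiableAt ℝ u q)
    (hv : DifferentiableAt ℝ v q) (e : R3) :
    fderiv ℝ (fun q => dot3 (u q) (v q)) q e =
      dot3 (fderiv ℝ u q e) (v q) + dot3 (u q) (fderiv ℝ v q e) := by
  have U := hasFDerivAt_coord hu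
  have V := hasFDerivAt_coord hv
  have h := (((U 0).mul (V 0)).add ((U 1).mul (V 1))).add ((U 2).mul (V 2))
  refine (congrArg (fun A : R3 →L[ℝ] ℝ => A e) h.fderiv).trans ?_
  simp [dot3]
  ring

theorem contDiff_coord_comp {E : Type*} [NormedAddCommGroup E] [NormedSpace ℝ E] {u : E → R3}
    {s : Set E} (hu : ContDiffOn ℝ ∞ u s) (i : Fin 3) : ContDiffOn ℝ ∞ (fun q => u q i) s :=
  (contDiff_coord i).comp_contDiffOn hu

theorem ContDiffOn.det3 {u v w : R3 → R3} {s : Set R3} (hu : ContDiffOn ℝ ∞ u s)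
    (hv : ContDiffOn ℝ ∞ v s) (hw : ContDiffOn ℝ ∞ w s) :
    ContDiffOn ℝ ∞ (fun q => det3 (u q) (v q) (w q)) s := by
  have U := contDiff_coord_comp hu
  have V := contDiff_coord_comp hv
  have W := contDiff_coord_comp hw
  exact (((U 0).mul (((V 1).mul (W 2)).sub ((V 2).mul (W 1)))).sub
    ((U 1).mul (((V 0).mul (W 2)).sub ((V 2).mul (W 0))))).add
    ((U 2).mul (((V 0).mul (W 1)).sub ((V 1).mul (W 0))))

theorem ContDiffOn.dot3 {u v : R3 → R3} {s : Set R3} (hu : ContDiffOn ℝ ∞ u s)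
    (hv : ContDiffOn ℝ ∞ v s) : ContDiffOn ℝ ∞ (fun q => dot3 (u q) (v q)) s := by
  have U := contDiff_coord_comp hu
  have V := contDiff_coord_comp hv
  exact (((U 0).mul (V 0)).add ((U 1).mul (V 1))).add ((U 2).mul (V 2))

theorem fderiv_fderiv_apply {Ψ : R3 → R3} {q : R3} (h : ContDiffAt ℝ ∞ Ψ q) (a b : R3) :
    fderiv ℝ (fun q => fderiv ℝ Ψ q a) q b = fderiv ℝ (fderiv ℝ Ψ) q b a := by
  have hd : DifferentiableAt ℝ (fderiv ℝ Ψ) q :=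
    (h.fderiv_right (m := ∞) (by simp)).differentiableAt (by simp)
  have := (hd.hasFDerivAt.clm_apply (hasFDerivAt_const a q)).fderiv
  rw [this]; simp

theorem fderiv_fderiv_comm {Ψ : R3 → R3} {q : R3} (h : ContDiffAt ℝ ∞ Ψ q) (a b : R3) :
    fderiv ℝ (fun q => fderiv ℝ Ψ q a) q b = fderiv ℝ (fun q => fderiv ℝ Ψ q b) q a := by
  rw [fderiv_fderiv_apply h, fderiv_fderiv_apply h]
  exact (h.isSymmSndFDerivAt (by
    rw [minSmoothness_of_isRCLikeNormedField]
    exact WithTop.coe_le_coe.2 (le_top : (2 : ℕ∞) ≤ ⊤))) b a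

theorem differentiableAt_fderiv_apply {Ψ : R3 → R3} {q : R3} (h : ContDiffAt ℝ ∞ Ψ q) (a : R3) :
    DifferentiableAt ℝ (fun q => fderiv ℝ Ψ q a) q :=
  ((h.fderiv_right (m := ∞) (by simp)).differentiableAt (by simp)).clm_apply
    (differentiableAt_const a)

/-- The Piola identity. -/
theorem piola {Ψ B : R3 → R3} {q : R3} (h : ContDiffAt ℝ ∞ Ψ q)
    (hB : DifferentiableAt ℝ B (Ψ q)) :
    fderiv ℝ (fun q => det3 (B (Ψ q)) (fderiv ℝ Ψ q (pt 0 1 0)) (fderiv ℝ Ψ q (pt 0 0 1))) q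
        (pt 1 0 0) +
      fderiv ℝ (fun q => det3 (fderiv ℝ Ψ q (pt 1 0 0)) (B (Ψ q)) (fderiv ℝ Ψ q (pt 0 0 1))) q
        (pt 0 1 0) +
      fderiv ℝ (fun q => det3 (fderiv ℝ Ψ q (pt 1 0 0)) (fderiv ℝ Ψ q (pt 0 1 0)) (B (Ψ q))) q
        (pt 0 0 1) = divg B (Ψ q) * jac Ψ q := by
  have h1 := differentiableAt_fderiv_apply h
  have hΨ : DifferentiableAt ℝ Ψ q := h.differentiableAt (by simp)
  have h2 : DifferentiableAt ℝ (fun q => B (Ψ q)) q := hB.comp q hΨ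
  have h3 : ∀ e, fderiv ℝ (fun q => B (Ψ q)) q e = fderiv ℝ B (Ψ q) (fderiv ℝ Ψ q e) := fun e => by
    rw [show (fun q => B (Ψ q)) = B ∘ Ψ from rfl, fderiv_comp q hB hΨ]; rfl
  rw [fderiv_det3 h2 (h1 _) (h1 _), fderiv_det3 (h1 _) h2 (h1 _), fderiv_det3 (h1 _) (h1 _) h2,
    fderiv_fderiv_comm h (pt 0 1 0) (pt 1 0 0), fderiv_fderiv_comm h (pt 0 0 1) (pt 1 0 0),
    fderiv_fderiv_comm h (pt 0 0 1) (pt 0 1 0), h3, h3, h3, jac, det_eq_det3, divg_eq,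
    map_eq_sum (fderiv ℝ B (Ψ q)) (fderiv ℝ Ψ q (pt 1 0 0)),
    map_eq_sum (fderiv ℝ B (Ψ q)) (fderiv ℝ Ψ q (pt 0 1 0)),
    map_eq_sum (fderiv ℝ B (Ψ q)) (fderiv ℝ Ψ q (pt 0 0 1))]
  simp only [det3, PiLp.add_apply, PiLp.smul_apply, smul_eq_mul]
  ring

theorem dot3_fderiv_sub (B : R3 → R3) (z a b : R3) :
    dot3 (fderiv ℝ B z a) b - dot3 (fderiv ℝ B z b) a = det3 (curl B z) a b := by
  rw [map_eq_sum (fderiv ℝ B z) a, map_eq_sum (fderiv ℝ B z) b]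
  simp only [det3, dot3, curl, e3_zero, e3_one, e3_two, PiLp.add_apply, PiLp.smul_apply,
    smul_eq_mul, pt_zero, pt_one, pt_two]
  ring

theorem fderiv_dot3_sub {Ψ B : R3 → R3} {q : R3} (h : ContDiffAt ℝ ∞ Ψ q)
    (hB : DifferentiableAt ℝ B (Ψ q)) (a b : R3) :
    fderiv ℝ (fun q => dot3 (B (Ψ q)) (fderiv ℝ Ψ q b)) q a -
      fderiv ℝ (fun q => dot3 (B (Ψ q)) (fderiv ℝ Ψ q a)) q b =
      det3 (curl B (Ψ q)) (fderiv ℝ Ψ q a) (fderiv ℝ Ψ q b) := by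
  have h1 := differentiableAt_fderiv_apply h
  have hΨ : DifferentiableAt ℝ Ψ q := h.differentiableAt (by simp)
  have h2 : DifferentiableAt ℝ (fun q => B (Ψ q)) q := hB.comp q hΨ
  have h3 : ∀ e, fderiv ℝ (fun q => B (Ψ q)) q e = fderiv ℝ B (Ψ q) (fderiv ℝ Ψ q e) := fun e => by
    rw [show (fun q => B (Ψ q)) = B ∘ Ψ from rfl, fderiv_comp q hB hΨ]; rfl
  rw [fderiv_dot3 h2 (h1 _), fderiv_dot3 h2 (h1 _), fderiv_fderiv_comm h b a, h3, h3,
    ← dot3_fderiv_sub]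
  ring

theorem sum_dot3_mul_det3 (P X u v w : R3) :
    dot3 P u * det3 X v w + dot3 P v * det3 u X w + dot3 P w * det3 u v X =
      det3 u v w * dot3 P X := by
  simp only [det3, dot3]; ring

theorem cramer_det3 (X u v w : R3) :
    det3 X v w • u + det3 u X w • v + det3 u v X • w = det3 u v w • X := by
  refine R3_ext ?_ ?_ ?_ <;>
  · simp only [det3, PiLp.add_apply, PiLp.smul_apply, smul_eq_mul]; ring

theorem cramer_cross3 (X P u v w : R3) :
    (dot3 X v * dot3 P w - dot3 X w * dot3 P v) • u + (dot3 X w * dot3 P u - dot3 X u * dot3 P w) • v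
      + (dot3 X u * dot3 P v - dot3 X v * dot3 P u) • w = det3 u v w • cross3 X P := by
  refine R3_ext ?_ ?_ ?_ <;>
  · simp only [det3, dot3, cross3, PiLp.add_apply, PiLp.smul_apply, smul_eq_mul, pt_zero, pt_one,
      pt_two]
    ring

theorem dot3_cross3_left (u v : R3) : dot3 (cross3 u v) u = 0 := by
  simp only [dot3, cross3, pt_zero, pt_one, pt_two]; ring

theorem dot3_cross3_right (u v : R3) : dot3 (cross3 u v) v = 0 := by
  simp only [dot3, cross3, pt_zero, pt_one, pt_two]; ring

end VectorAlgebra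

section Cutoff

open Topology Filter

/-- A smooth function equal to `1` on `Dset (r / 2)` and supported in `Dset r`. -/
def cutoff (r : ℝ) (q : R3) : ℝ := Real.smoothTransition (2 - 8 / r ^ 2 * psi q)

variable {r : ℝ} {f : R3 → ℝ} {q : R3}

theorem contDiff_cutoff (r : ℝ) : ContDiff ℝ ∞ (cutoff r) :=
  Real.smoothTransition.contDiff.comp (contDiff_const.sub (contDiff_const.mul contDiff_psi))

theorem psi_shift (t : ℝ) (q : R3) : psi (shift t q) = psi q := by simp [psi]

theorem psi_axis (s : ℝ) : psi (pt 0 0 s) = 0 := by simp [psi]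

theorem cutoff_shift (r t : ℝ) (q : R3) : cutoff r (shift t q) = cutoff r q := by
  simp [cutoff, psi_shift]

theorem hasFDerivAt_psi (q : R3) : HasFDerivAt psi (fderiv ℝ psi q) q :=
  (contDiff_psi.differentiable (by simp) q).hasFDerivAt

theorem fderiv_psi_apply (q v : R3) : fderiv ℝ psi q v = q 0 * v 0 + q 1 * v 1 := by
  have h : ∀ i, HasFDerivAt (fun q : R3 => q i) (EuclideanSpace.proj (𝕜 := ℝ) i) q :=
    fun i => (EuclideanSpace.proj (𝕜 := ℝ) i).hasFDerivAt
  have := ((((h 0).pow 2).add ((h 1).pow 2)).mul_const (2⁻¹ : ℝ))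
  have e : psi = fun q : R3 => (q 0 ^ 2 + q 1 ^ 2) * 2⁻¹ := rfl
  rw [e]
  refine (congrArg (fun A : R3 →L[ℝ] ℝ => A v) this.fderiv).trans ?_
  simp; ring

theorem fderiv_comp_psi_apply {A : ℝ → ℝ} (hA : DifferentiableAt ℝ A (psi q)) (v : R3) :
    fderiv ℝ (fun q => A (psi q)) q v = deriv A (psi q) * (q 0 * v 0 + q 1 * v 1) := by
  have := (hA.hasDerivAt.comp_hasFDerivAt q (hasFDerivAt_psi q)).fderiv
  refine (congrArg (fun L : R3 →L[ℝ] ℝ => L v) this).trans ?_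
  simp [fderiv_psi_apply]

theorem fderiv_cutoff_apply (r : ℝ) (q : R3) :
    ∃ k : ℝ, ∀ v, fderiv ℝ (cutoff r) q v = k * (q 0 * v 0 + q 1 * v 1) :=
  ⟨_, fun v => fderiv_comp_psi_apply (A := fun t => Real.smoothTransition (2 - 8 / r ^ 2 * t))
    ((Real.smoothTransition.contDiff (n := 1)).comp
      (contDiff_const.sub (contDiff_const.mul contDiff_id)) |>.differentiable (by simp) _) v⟩

theorem cutoff_eq_one (hr : 0 < r) (hq : q ∈ Dset (r / 2)) : cutoff r q = 1 := by
  refine Real.smoothTransition.one_of_one_le ?_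
  rw [mem_Dset] at hq
  have : 8 / r ^ 2 * psi q = (q 0 ^ 2 + q 1 ^ 2) / (r / 2) ^ 2 := by
    rw [psi]; field_simp; ring
  rw [this]
  have := (div_le_one (by positivity : 0 < (r / 2) ^ 2)).2 hq.le
  linarith

theorem eventually_cutoff_eq_zero (hr : 0 < r) (hq : q ∉ Dset r) : ∀ᶠ q in 𝓝 q, cutoff r q = 0 := by
  have h : 2 - 8 / r ^ 2 * psi q < 0 := by
    rw [mem_Dset, not_lt] at hq
    have : 8 / r ^ 2 * psi q = 4 * ((q 0 ^ 2 + q 1 ^ 2) / r ^ 2) := by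
      rw [psi]; field_simp; ring
    rw [this]
    have := (one_le_div (by positivity : 0 < r ^ 2)).2 hq
    linarith
  have hc : Continuous fun q => 2 - 8 / r ^ 2 * psi q :=
    continuous_const.sub (continuous_const.mul contDiff_psi.continuous)
  filter_upwards [hc.continuousAt.eventually_lt continuousAt_const h] with q hq
  exact Real.smoothTransition.zero_of_nonpos hq.le

theorem cutoff_eq_zero (hr : 0 < r) (hq : q ∉ Dset r) : cutoff r q = 0 :=
  (eventually_cutoff_eq_zero hr hq).self_of_nhds

theorem contDiff_cutoff_mul (hr : 0 < r) (hf : ContDiffOn ℝ ∞ f (Dset r)) :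
    ContDiff ℝ ∞ fun q => cutoff r q * f q := by
  rw [contDiff_iff_contDiffAt]
  intro q
  by_cases hq : q ∈ Dset r
  · exact (contDiff_cutoff r).contDiffAt.mul (hf.contDiffAt ((isOpen_Dset r).mem_nhds hq))
  · refine (contDiffAt_const (c := (0 : ℝ))).congr_of_eventuallyEq ?_
    filter_upwards [eventually_cutoff_eq_zero hr hq] with q hq
    rw [hq, zero_mul]

theorem fderiv_cutoff_mul (hf : DifferentiableAt ℝ f q) (v : R3) :
    fderiv ℝ (fun q => cutoff r q * f q) q v =
      cutoff r q * fderiv ℝ f q v + fderiv ℝ (cutoff r) q v * f q := by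
  have := ((contDiff_cutoff r).differentiable (by simp) q).hasFDerivAt.mul hf.hasFDerivAt
  refine (congrArg (fun A : R3 →L[ℝ] ℝ => A v) this.fderiv).trans ?_
  simp; ring

/-- A pair satisfying the conservation law on a tube agrees near the axis with a globally defined
one. -/
theorem exists_global_conservation {a c : R3 → ℝ} (hr : 0 < r) (ha : ContDiffOn ℝ ∞ a (Dset r))
    (hc : ContDiffOn ℝ ∞ c (Dset r))
    (hpa : ∀ q, a (shift (2 * Real.pi) q) = a q) (hpc : ∀ q, c (shift (2 * Real.pi) q) = c q)
    (hac : ∀ q ∈ Dset r, fderiv ℝ a q (rotGen q) + fderiv ℝ c q (pt 0 0 1) = 0) :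
    ∃ a' c' : R3 → ℝ, ContDiff ℝ ∞ a' ∧ ContDiff ℝ ∞ c' ∧
      (∀ q, a' (shift (2 * Real.pi) q) = a' q) ∧ (∀ q, c' (shift (2 * Real.pi) q) = c' q) ∧
      (∀ q, fderiv ℝ a' q (rotGen q) + fderiv ℝ c' q (pt 0 0 1) = 0) ∧
      (∀ q ∈ Dset (r / 2), a' q = a q ∧ c' q = c q) := by
  refine ⟨fun q => cutoff r q * a q, fun q => cutoff r q * c q, contDiff_cutoff_mul hr ha,
    contDiff_cutoff_mul hr hc, fun q => by simp only [cutoff_shift, hpa],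
    fun q => by simp only [cutoff_shift, hpc], fun q => ?_, fun q hq => by
      simp [cutoff_eq_one hr hq]⟩
  by_cases hq : q ∈ Dset r
  · have hq' := (isOpen_Dset r).mem_nhds hq
    rw [fderiv_cutoff_mul ((ha.contDiffAt hq').differentiableAt (by simp)),
      fderiv_cutoff_mul ((hc.contDiffAt hq').differentiableAt (by simp))]
    obtain ⟨k, hk⟩ := fderiv_cutoff_apply r q
    rw [hk, hk]
    have := hac q hq
    simp only [rotGen, pt_zero, pt_one] at this ⊢
    linear_combination cutoff r q * this
  · have h0 : ∀ f : R3 → ℝ, fderiv ℝ (fun q => cutoff r q * f q) q = 0 := fun f => by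
      have : (fun q => cutoff r q * f q) =ᶠ[𝓝 q] fun _ => 0 := by
        filter_upwards [eventually_cutoff_eq_zero hr hq] with q hq
        rw [hq, zero_mul]
      rw [this.fderiv_eq]; simp
    simp [h0]

end Cutoff

section Hadamard

theorem eq_zero_of_mul_coord {f : R3 → ℝ} (hf : Continuous f) (i : Fin 3)
    (h : ∀ q, q i * f q = 0) (q : R3) : f q = 0 := by
  have hc : Continuous fun t : ℝ => f (q + t • e3 i) := hf.comp (by fun_prop)
  have : (fun t : ℝ => f (q + t • e3 i)) = fun _ => 0 := by
    refine hc.ext_on (dense_compl_singleton (-q i)) continuous_const fun t ht => ?_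
    have h1 := h (q + t • e3 i)
    refine (mul_eq_zero.1 h1).resolve_left fun h2 => ht ?_
    simp [e3] at h2
    exact Set.mem_singleton_iff.2 (by linarith)
  simpa using congrFun this 0

theorem exists_rotational {a b : R3 → ℝ} (ha : ContDiff ℝ ∞ a) (hb : ContDiff ℝ ∞ b)
    (hab : ∀ q, q 0 * a q + q 1 * b q = 0)
    (hpa : ∀ q, a (shift (2 * Real.pi) q) = a q) :
    ∃ h : R3 → ℝ, ContDiff ℝ ∞ h ∧ (∀ q, h (shift (2 * Real.pi) q) = h q) ∧
      ∀ q, a q = -(q 1 * h q) ∧ b q = q 0 * h q := by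
  have ha0 : ∀ q : R3, a (pt (q 0) 0 (q 2)) = 0 := by
    refine eq_zero_of_mul_coord (ha.continuous.comp ?_) 0 fun q => ?_
    · have : ContDiff ℝ 0 fun q : R3 => pt (q 0) 0 (q 2) :=
        ContDiff.pt (contDiff_coord 0) contDiff_const (contDiff_coord 2)
      exact this.continuous
    · simpa using hab (pt (q 0) 0 (q 2))
  let D : R3 × ℝ → ℝ := fun z => fderiv ℝ a (pt (z.1 0) (z.2 * z.1 1) (z.1 2)) (pt 0 1 0)
  have hD : ContDiff ℝ ∞ D := by
    have c : ∀ i, ContDiff ℝ ∞ fun z : R3 × ℝ => z.1 i := fun i =>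
      (contDiff_coord i).comp contDiff_fst
    exact ((ha.fderiv_right (m := ∞) (by simp)).comp
      (ContDiff.pt (c 0) (contDiff_snd.mul (c 1)) (c 2))).clm_apply contDiff_const
  let h : R3 → ℝ := fun q => -∫ t in (0 : ℝ)..1, D (q, t)
  have hh : ContDiff ℝ ∞ h := (contDiff_integral_param hD 0 1).neg
  have h1 : ∀ q, a q = -(q 1 * h q) := by
    intro q
    have hd : ∀ t : ℝ, HasDerivAt (fun t => a (pt (q 0) (t * q 1) (q 2))) (q 1 * D (q, t)) t := by
      intro t
      have e := HasDerivAt.pt (hasDerivAt_const t (q 0)) ((hasDerivAt_id t).mul_const (q 1))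
        (hasDerivAt_const t (q 2))
      refine ((ha.differentiable (by simp) _).hasFDerivAt.comp_hasDerivAt t e).congr_deriv ?_
      rw [map_pt]; simp [D]
    have := intervalIntegral.integral_eq_sub_of_hasDerivAt (a := 0) (b := 1)
      (fun t _ => hd t) ((continuous_const.mul
        (hD.continuous.comp (by fun_prop : Continuous fun t : ℝ => (q, t)))).intervalIntegrable _ _)
    rw [intervalIntegral.integral_const_mul, one_mul, zero_mul, ha0, sub_zero, pt_eta] at this
    simp only [h, ← this]; ring
  refine ⟨h, hh, fun q => ?_, fun q => ⟨h1 q, ?_⟩⟩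
  · have := eq_zero_of_mul_coord (f := fun q => h (shift (2 * Real.pi) q) - h q)
      ((hh.continuous.comp (contDiff_shift_right _).continuous).sub hh.continuous) 1 (fun q => by
        have e1 := h1 q
        have e2 := h1 (shift (2 * Real.pi) q)
        rw [hpa, shift_apply_one] at e2
        linear_combination e2 - e1) q
    exact sub_eq_zero.1 this
  · have := eq_zero_of_mul_coord (f := fun q => b q - q 0 * h q)
      (hb.continuous.sub ((contDiff_coord 0 (n := ∞)).continuous.mul hh.continuous)) 1 (fun q => by
        linear_combination hab q - q 0 * h1 q) q
    exact sub_eq_zero.1 this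

end Hadamard

section Flux

open Topology Filter

theorem rotGen_axis (s : ℝ) : rotGen (pt 0 0 s) = 0 := by
  refine R3_ext ?_ ?_ ?_ <;> simp [rotGen]

theorem rotGen_smul_add (q : R3) (x y : ℝ) :
    x • rotGen q + y • pt 0 0 1 = pt (-(x * q 1)) (x * q 0) y := by
  refine R3_ext ?_ ?_ ?_ <;> simp [rotGen]

theorem fderiv_mul_apply {f g : R3 → ℝ} {q : R3} (hf : DifferentiableAt ℝ f q)
    (hg : DifferentiableAt ℝ g q) (v : R3) :
    fderiv ℝ (fun q => f q * g q) q v = f q * fderiv ℝ g q v + fderiv ℝ f q v * g q := by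
  refine (congrArg (fun A : R3 →L[ℝ] ℝ => A v)
    (hf.hasFDerivAt.mul hg.hasFDerivAt).fderiv).trans ?_
  simp; ring

theorem fderiv_coord_apply (i : Fin 3) (q v : R3) : fderiv ℝ (fun q : R3 => q i) q v = v i :=
  congrArg (fun A : R3 →L[ℝ] ℝ => A v)
    ((EuclideanSpace.proj (𝕜 := ℝ) i).hasFDerivAt (x := q)).fderiv

theorem differentiableAt_coord (i : Fin 3) (q : R3) : DifferentiableAt ℝ (fun q : R3 => q i) q :=
  (EuclideanSpace.proj (𝕜 := ℝ) i).hasFDerivAt.differentiableAt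

/-- The pulled-back flux fields of `B` and `B × ∇p` in coordinates in which `p` is an affine
function of `psi`. -/
theorem exists_flux_functions {U : Set R3} {B Ψ : R3 → R3} {p : R3 → ℝ} {r₀ σ p₀ : ℝ}
    (hU : IsOpen U) (hB : ContDiffOn ℝ ∞ B U) (hp : ContDiffOn ℝ ∞ p U)
    (hBne : ∀ z ∈ U, B z ≠ 0) (hdiv : ∀ z ∈ U, divg B z = 0)
    (hMHS : ∀ z ∈ U, cross3 (curl B z) (B z) = gradient p z)
    (hr₀ : 0 < r₀) (hΨ : ContDiffOn ℝ ∞ Ψ (Dset r₀))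
    (hper : ∀ q, Ψ (shift (2 * Real.pi) q) = Ψ q) (hΨU : ∀ q ∈ Dset r₀, Ψ q ∈ U)
    (hpΨ : ∀ q ∈ Dset r₀, p (Ψ q) = p₀ + σ * psi q) (hσ : σ ≠ 0)
    (hjac : ∀ q ∈ Dset r₀, jac Ψ q ≠ 0) :
    ∃ (r : ℝ) (h b m n : R3 → ℝ), 0 < r ∧ r ≤ r₀ ∧ ContDiff ℝ ∞ h ∧ ContDiff ℝ ∞ b ∧
      ContDiff ℝ ∞ m ∧ ContDiff ℝ ∞ n ∧
      (∀ q, h (shift (2 * Real.pi) q) = h q) ∧ (∀ q, b (shift (2 * Real.pi) q) = b q) ∧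
      (∀ q, m (shift (2 * Real.pi) q) = m q) ∧ (∀ q, n (shift (2 * Real.pi) q) = n q) ∧
      (∀ q, fderiv ℝ h q (rotGen q) + fderiv ℝ b q (pt 0 0 1) = 0) ∧
      (∀ q, fderiv ℝ m q (rotGen q) + fderiv ℝ n q (pt 0 0 1) = 0) ∧
      (∀ q ∈ Dset r, fderiv ℝ Ψ q (h q • rotGen q + b q • pt 0 0 1) = jac Ψ q • B (Ψ q)) ∧
      (∀ q ∈ Dset r, fderiv ℝ Ψ q (m q • rotGen q + n q • pt 0 0 1) =
        jac Ψ q • cross3 (B (Ψ q)) (gradient p (Ψ q))) ∧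
      ∀ s, b (pt 0 0 s) ≠ 0 ∧ n (pt 0 0 s) = 0 ∧ m (pt 0 0 s) ≠ 0 := by
  have hO := isOpen_Dset r₀
  have hat : ∀ {q}, q ∈ Dset r₀ → ContDiffAt ℝ ∞ Ψ q := fun hq =>
    hΨ.contDiffAt (hO.mem_nhds hq)
  have hBat : ∀ {q}, q ∈ Dset r₀ → DifferentiableAt ℝ B (Ψ q) := fun hq =>
    (hB.contDiffAt (hU.mem_nhds (hΨU _ hq))).differentiableAt (by simp)
  have hBΨ : ContDiffOn ℝ ∞ (fun q => B (Ψ q)) (Dset r₀) := hB.comp hΨ hΨU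
  have hD : ∀ e, ContDiffOn ℝ ∞ (fun q => fderiv ℝ Ψ q e) (Dset r₀) := fun e =>
    (hΨ.fderiv_of_isOpen hO (by simp)).clm_apply contDiffOn_const
  have hDp : ∀ e q, fderiv ℝ Ψ (shift (2 * Real.pi) q) e = fderiv ℝ Ψ q e := fun e q => by
    rw [fderiv_periodic hper]
  -- components of `∇p` in these coordinates
  have hgrad : ∀ q ∈ Dset r₀, ∀ e, dot3 (gradient p (Ψ q)) (fderiv ℝ Ψ q e) =
      σ * (q 0 * e 0 + q 1 * e 1) := by
    intro q hq e
    have h1 : fderiv ℝ (fun q => p (Ψ q)) q = (fderiv ℝ p (Ψ q)).comp (fderiv ℝ Ψ q) :=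
      fderiv_comp q ((hp.contDiffAt (hU.mem_nhds (hΨU _ hq))).differentiableAt (by simp))
        ((hat hq).differentiableAt (by simp))
    have h2 : (fun q => p (Ψ q)) =ᶠ[𝓝 q] fun q => p₀ + σ * psi q := by
      filter_upwards [hO.mem_nhds hq] with q hq using hpΨ q hq
    rw [← fderiv_eq_dot3, ← fderiv_psi_apply]
    have h3 := congrArg (fun A : R3 →L[ℝ] ℝ => A e) (h1.symm.trans h2.fderiv_eq)
    refine h3.trans ?_
    have h4 := (((hasFDerivAt_psi q).const_mul σ).const_add p₀).fderiv
    exact congrArg (fun A : R3 →L[ℝ] ℝ => A e) h4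
  have hg0 : ∀ q ∈ Dset r₀, dot3 (gradient p (Ψ q)) (fderiv ℝ Ψ q (pt 1 0 0)) = σ * q 0 :=
    fun q hq => by rw [hgrad q hq]; simp
  have hg1 : ∀ q ∈ Dset r₀, dot3 (gradient p (Ψ q)) (fderiv ℝ Ψ q (pt 0 1 0)) = σ * q 1 :=
    fun q hq => by rw [hgrad q hq]; simp
  have hg2 : ∀ q ∈ Dset r₀, dot3 (gradient p (Ψ q)) (fderiv ℝ Ψ q (pt 0 0 1)) = 0 :=
    fun q hq => by rw [hgrad q hq]; simp
  have hgB : ∀ q ∈ Dset r₀, dot3 (gradient p (Ψ q)) (B (Ψ q)) = 0 := fun q hq => by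
    rw [← hMHS _ (hΨU q hq), dot3_cross3_right]
  have hgJ : ∀ q ∈ Dset r₀, dot3 (gradient p (Ψ q)) (curl B (Ψ q)) = 0 := fun q hq => by
    rw [← hMHS _ (hΨU q hq), dot3_cross3_left]
  have hX : ∀ q ∈ Dset r₀, ∀ X, dot3 (gradient p (Ψ q)) X = 0 →
      q 0 * det3 X (fderiv ℝ Ψ q (pt 0 1 0)) (fderiv ℝ Ψ q (pt 0 0 1)) +
      q 1 * det3 (fderiv ℝ Ψ q (pt 1 0 0)) X (fderiv ℝ Ψ q (pt 0 0 1)) = 0 := by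
    intro q hq X hX
    have := sum_dot3_mul_det3 (gradient p (Ψ q)) X (fderiv ℝ Ψ q (pt 1 0 0))
      (fderiv ℝ Ψ q (pt 0 1 0)) (fderiv ℝ Ψ q (pt 0 0 1))
    rw [hg0 q hq, hg1 q hq, hg2 q hq, hX] at this
    refine (mul_eq_zero.1 (?_ : σ * _ = 0)).resolve_left hσ
    linear_combination this
  -- the flux components of `B`
  let b0 : R3 → ℝ := fun q =>
    det3 (B (Ψ q)) (fderiv ℝ Ψ q (pt 0 1 0)) (fderiv ℝ Ψ q (pt 0 0 1))
  let b1 : R3 → ℝ := fun q =>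
    det3 (fderiv ℝ Ψ q (pt 1 0 0)) (B (Ψ q)) (fderiv ℝ Ψ q (pt 0 0 1))
  let b2 : R3 → ℝ := fun q =>
    det3 (fderiv ℝ Ψ q (pt 1 0 0)) (fderiv ℝ Ψ q (pt 0 1 0)) (B (Ψ q))
  have hb0 : ContDiffOn ℝ ∞ b0 (Dset r₀) := ContDiffOn.det3 hBΨ (hD _) (hD _)
  have hb1 : ContDiffOn ℝ ∞ b1 (Dset r₀) := ContDiffOn.det3 (hD _) hBΨ (hD _)
  have hb2 : ContDiffOn ℝ ∞ b2 (Dset r₀) := ContDiffOn.det3 (hD _) (hD _) hBΨ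
  obtain ⟨h, hh, hhp, hhb⟩ := exists_rotational (a := fun q => cutoff r₀ q * b0 q)
    (b := fun q => cutoff r₀ q * b1 q) (contDiff_cutoff_mul hr₀ hb0) (contDiff_cutoff_mul hr₀ hb1)
    (fun q => by
      by_cases hq : q ∈ Dset r₀
      · linear_combination cutoff r₀ q * hX q hq _ (hgB q hq)
      · simp [cutoff_eq_zero hr₀ hq])
    (fun q => by simp only [cutoff_shift, b0, hper, hDp])
  have hr' : 0 < r₀ / 2 := by positivity
  have hsub := Dset_subset hr'.le (half_le_self hr₀.le)
  have hb0h : ∀ q ∈ Dset (r₀ / 2), b0 q = -(q 1 * h q) := fun q hq => by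
    simpa [cutoff_eq_one hr₀ hq] using (hhb q).1
  have hb1h : ∀ q ∈ Dset (r₀ / 2), b1 q = q 0 * h q := fun q hq => by
    simpa [cutoff_eq_one hr₀ hq] using (hhb q).2
  have hE1 : ∀ q ∈ Dset (r₀ / 2), fderiv ℝ h q (rotGen q) + fderiv ℝ b2 q (pt 0 0 1) = 0 := by
    intro q hq
    have hp := piola (hat (hsub hq)) (hBat (hsub hq))
    rw [hdiv _ (hΨU q (hsub hq)), zero_mul] at hp
    have hn := (isOpen_Dset (r₀ / 2)).mem_nhds hq
    have e0 : b0 =ᶠ[𝓝 q] fun q => -1 * (q 1 * h q) := by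
      filter_upwards [hn] with q hq
      rw [hb0h q hq]; ring
    have e1 : b1 =ᶠ[𝓝 q] fun q => q 0 * h q := by
      filter_upwards [hn] with q hq using hb1h q hq
    have hhd : DifferentiableAt ℝ h q := hh.differentiable (by simp) q
    have f0 : fderiv ℝ b0 q (pt 1 0 0) = -(q 1 * fderiv ℝ h q (pt 1 0 0)) := by
      have hd : DifferentiableAt ℝ (fun q : R3 => q 1 * h q) q :=
        (differentiableAt_coord 1 q).fun_mul hhd
      rw [e0.fderiv_eq, fderiv_mul_apply (differentiableAt_const _) hd,
        fderiv_mul_apply (differentiableAt_coord 1 q) hhd, fderiv_coord_apply]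
      simp
    have f1 : fderiv ℝ b1 q (pt 0 1 0) = q 0 * fderiv ℝ h q (pt 0 1 0) := by
      rw [e1.fderiv_eq, fderiv_mul_apply (differentiableAt_coord 0 q) hhd, fderiv_coord_apply]
      simp
    change fderiv ℝ b0 q _ + fderiv ℝ b1 q _ + fderiv ℝ b2 q _ = 0 at hp
    rw [f0, f1] at hp
    rw [rotGen, map_pt]
    simp only [smul_eq_mul]
    linear_combination hp
  -- the flux components of `B × ∇p`
  let β : R3 → R3 → ℝ := fun e q => dot3 (B (Ψ q)) (fderiv ℝ Ψ q e)
  have hβ : ∀ e, ContDiffOn ℝ ∞ (β e) (Dset r₀) := fun e => hBΨ.dot3 (hD e)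
  have hβp : ∀ e q, β e (shift (2 * Real.pi) q) = β e q := fun e q => by
    simp only [β, hper, hDp]
  have hβd : ∀ e, ∀ q ∈ Dset r₀, DifferentiableAt ℝ (β e) q := fun e q hq =>
    ((hβ e).contDiffAt (hO.mem_nhds hq)).differentiableAt (by simp)
  let m : R3 → ℝ := fun q => σ * β (pt 0 0 1) q
  let n : R3 → ℝ := fun q => σ * (q 1 * β (pt 1 0 0) q + -1 * (q 0 * β (pt 0 1 0) q))
  have hm : ContDiffOn ℝ ∞ m (Dset r₀) := contDiffOn_const.mul (hβ _)
  have hn : ContDiffOn ℝ ∞ n (Dset r₀) := contDiffOn_const.mul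
    (((contDiff_coord 1).contDiffOn.mul (hβ _)).add
      (contDiffOn_const.mul ((contDiff_coord 0).contDiffOn.mul (hβ _))))
  have hE2 : ∀ q ∈ Dset r₀, fderiv ℝ m q (rotGen q) + fderiv ℝ n q (pt 0 0 1) = 0 := by
    intro q hq
    have d := fun e => hβd e q hq
    have c := fun i => differentiableAt_coord i q
    have k : ∀ x : ℝ, DifferentiableAt ℝ (fun _ : R3 => x) q := fun x => differentiableAt_const x
    have kz : ∀ (x : ℝ) (v : R3), fderiv ℝ (fun _ : R3 => x) q v = 0 := fun x v => by
      rw [fderiv_const_apply]; rfl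
    have e1 := fderiv_dot3_sub (hat hq) (hBat hq) (pt 0 1 0) (pt 0 0 1)
    have e0 := fderiv_dot3_sub (hat hq) (hBat hq) (pt 1 0 0) (pt 0 0 1)
    have e2 := hX q hq _ (hgJ q hq)
    have hmd : ∀ v, fderiv ℝ m q v = σ * fderiv ℝ (β (pt 0 0 1)) q v := fun v => by
      rw [fderiv_mul_apply (k σ) (d _)]; simp
    have hnd : fderiv ℝ n q (pt 0 0 1) = σ * (q 1 * fderiv ℝ (β (pt 1 0 0)) q (pt 0 0 1) -
        q 0 * fderiv ℝ (β (pt 0 1 0)) q (pt 0 0 1)) := by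
      have s1 := (c 1).fun_mul (d (pt 1 0 0))
      have s2 := (c 0).fun_mul (d (pt 0 1 0))
      have s3 := (k (-1)).fun_mul s2
      rw [fderiv_mul_apply (k σ) (s1.fun_add s3), fderiv_fun_add s1 s3,
        add_apply,
        fderiv_mul_apply (c 1) (d _), fderiv_mul_apply (k (-1)) s2, fderiv_mul_apply (c 0) (d _),
        fderiv_coord_apply, fderiv_coord_apply]
      simp only [kz, pt_zero, pt_one]
      ring
    change fderiv ℝ (β _) q _ - fderiv ℝ (β _) q _ = _ at e1
    change fderiv ℝ (β _) q _ - fderiv ℝ (β _) q _ = _ at e0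
    have hsw : det3 (fderiv ℝ Ψ q (pt 1 0 0)) (curl B (Ψ q)) (fderiv ℝ Ψ q (pt 0 0 1)) =
        -det3 (curl B (Ψ q)) (fderiv ℝ Ψ q (pt 1 0 0)) (fderiv ℝ Ψ q (pt 0 0 1)) := by
      simp only [det3]; ring
    rw [hsw] at e2
    rw [hmd, hnd, rotGen, map_pt]
    simp only [smul_eq_mul]
    linear_combination σ * e2 + σ * q 0 * e1 - σ * q 1 * e0
  obtain ⟨h', b', hh', hb', hhp', hbp', hE1', heq1⟩ := exists_global_conservation hr' hh.contDiffOn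
    (hb2.mono hsub) hhp (fun q => by simp only [b2, hper, hDp]) hE1
  obtain ⟨m', n', hm', hn', hmp', hnp', hE2', heq2⟩ := exists_global_conservation hr'
    (hm.mono hsub) (hn.mono hsub) (fun q => by simp only [m, hβp])
    (fun q => by simp only [n, hβp, shift_apply_zero, shift_apply_one])
    (fun q hq => hE2 q (hsub hq))
  have hr'' : 0 < r₀ / 2 / 2 := by positivity
  have hsub' := Dset_subset hr''.le (half_le_self hr'.le)
  have hfl1 : ∀ q ∈ Dset (r₀ / 2 / 2),
      fderiv ℝ Ψ q (h' q • rotGen q + b' q • pt 0 0 1) = jac Ψ q • B (Ψ q) := by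
    intro q hq
    rw [(heq1 q hq).1, (heq1 q hq).2, rotGen_smul_add, mul_comm, ← hb0h q (hsub' hq), mul_comm,
      ← hb1h q (hsub' hq), map_pt, cramer_det3, jac, det_eq_det3]
  have hfl2 : ∀ q ∈ Dset (r₀ / 2 / 2), fderiv ℝ Ψ q (m' q • rotGen q + n' q • pt 0 0 1) =
      jac Ψ q • cross3 (B (Ψ q)) (gradient p (Ψ q)) := by
    intro q hq
    have hq₀ := hsub (hsub' hq)
    rw [jac, det_eq_det3, ← cramer_cross3, hg0 q hq₀, hg1 q hq₀, hg2 q hq₀, (heq2 q hq).1,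
      (heq2 q hq).2, rotGen_smul_add, map_pt]
    congr 1
    · congr 1
      · congr 1; simp only [m, β]; ring
      · congr 1; simp only [m, β]; ring
    · congr 1; simp only [n, β]; ring
  have hax := axis_mem_Dset hr''
  have hb'ne : ∀ s, b' (pt 0 0 s) ≠ 0 := by
    intro s h0
    have := hfl1 _ (hax s)
    rw [rotGen_axis, h0, smul_zero, zero_smul, add_zero, map_zero] at this
    have hs := hsub (hsub' (hax s))
    exact (smul_ne_zero (hjac _ hs) (hBne _ (hΨU _ hs))) this.symm
  refine ⟨r₀ / 2 / 2, h', b', m', n', hr'', by linarith, hh', hb', hm', hn', hhp', hbp', hmp',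
    hnp', hE1', hE2', hfl1, hfl2, fun s => ⟨hb'ne s, ?_, fun h0 => ?_⟩⟩
  · rw [(heq2 _ (hax s)).2]; simp [n]
  · have hs := hsub (hsub' (hax s))
    rw [(heq2 _ (hax s)).1] at h0
    have h1 := hfl1 _ (hax s)
    rw [rotGen_axis, smul_zero, zero_add, map_smul] at h1
    have h2 : dot3 (B (Ψ (pt 0 0 s))) (fderiv ℝ Ψ (pt 0 0 s) (pt 0 0 1)) = 0 :=
      (mul_eq_zero.1 h0).resolve_left hσ
    have h3 : jac Ψ (pt 0 0 s) * dot3 (B (Ψ (pt 0 0 s))) (B (Ψ (pt 0 0 s))) = 0 := by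
      have h4 := congrArg (fun v => dot3 (B (Ψ (pt 0 0 s))) v) h1
      simp only [dot3, PiLp.smul_apply, smul_eq_mul] at h4 h2 ⊢
      linear_combination b' (pt 0 0 s) * h2 - h4
    rw [← inner_eq_dot3] at h3
    exact (mul_ne_zero (hjac _ hs) (inner_self_ne_zero.2 (hBne _ (hΨU _ hs)))) h3

end Flux

section Straighten

open Topology Filter

theorem psi_rot (t : ℝ) (q : R3) : psi (rot t q) = psi q := by
  simp only [psi, rot, pt_zero, pt_one]
  linear_combination ((q 0) ^ 2 + (q 1) ^ 2) / 2 * Real.sin_sq_add_cos_sq t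

theorem fderiv_psi_rotGen (q : R3) : q 0 * rotGen q 0 + q 1 * rotGen q 1 = 0 := by
  simp [rotGen]; ring

/-- The differential of a map which rotates and translates by variable amounts. -/
theorem fderiv_shift_rot_apply {α β : R3 → ℝ} {q : R3} (hα : DifferentiableAt ℝ α q)
    (hβ : DifferentiableAt ℝ β q) (v : R3) :
    fderiv ℝ (fun q => shift (β q) (rot (α q) q)) q v =
      rot (α q) v + fderiv ℝ α q v • rotGen (shift (β q) (rot (α q) q)) +
        fderiv ℝ β q v • pt 0 0 1 := by
  have hx := fun i => (differentiableAt_coord i q).hasFDerivAt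
  have hc := hα.hasFDerivAt.cos
  have hs := hα.hasFDerivAt.sin
  have h := HasFDerivAt.pt_apply (((hx 0).mul hc).sub ((hx 1).mul hs))
    (((hx 0).mul hs).add ((hx 1).mul hc)) ((hx 2).add hβ.hasFDerivAt) v
  have he : (fun q => shift (β q) (rot (α q) q)) = fun q => pt
      (((fun q : R3 => q 0) * (fun q => Real.cos (α q)) -
        (fun q : R3 => q 1) * fun q => Real.sin (α q)) q)
      (((fun q : R3 => q 0) * (fun q => Real.sin (α q)) +
        (fun q : R3 => q 1) * fun q => Real.cos (α q)) q) (((fun q : R3 => q 2) + β) q) := by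
    funext q
    refine R3_ext ?_ ?_ ?_ <;> simp [rot]
  rw [he]
  refine h.trans ?_
  refine R3_ext ?_ ?_ ?_ <;> simp [rot, rotGen, fderiv_coord_apply] <;> ring

/-- The determinant of the differential of a map which rotates and translates by variable
amounts. -/
theorem jac_shift_rot {α β : R3 → ℝ} {q : R3} (hα : DifferentiableAt ℝ α q)
    (hβ : DifferentiableAt ℝ β q) :
    jac (fun q => shift (β q) (rot (α q) q)) q =
      (1 + fderiv ℝ α q (rotGen q)) * (1 + fderiv ℝ β q (pt 0 0 1)) -
        fderiv ℝ α q (pt 0 0 1) * fderiv ℝ β q (rotGen q) := by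
  have hr : ∀ A : R3 →L[ℝ] ℝ, A (rotGen q) = -q 1 * A (pt 1 0 0) + q 0 * A (pt 0 1 0) :=
    fun A => by rw [rotGen, map_pt]; simp
  rw [jac, det_eq_det3, fderiv_shift_rot_apply hα hβ, fderiv_shift_rot_apply hα hβ,
    fderiv_shift_rot_apply hα hβ, hr, hr]
  generalize fderiv ℝ α q = A
  generalize fderiv ℝ β q = C
  simp only [det3, PiLp.add_apply, PiLp.smul_apply, rot, rotGen, smul_eq_mul, pt_zero, pt_one,
    pt_two, shift_apply_zero, shift_apply_one]
  have := Real.sin_sq_add_cos_sq (α q)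
  generalize Real.sin (α q) = s at *
  generalize Real.cos (α q) = c at *
  have hc : c ^ 2 = 1 - s ^ 2 := by linarith
  ring_nf
  simp only [hc]
  ring

/-- The differential of a map which rotates and translates by variable amounts, on the span of
the generators. -/
theorem fderiv_shift_rot_span {α β : R3 → ℝ} {q : R3} (hα : DifferentiableAt ℝ α q)
    (hβ : DifferentiableAt ℝ β q) {h b F G : ℝ}
    (h1 : h = G * (1 + fderiv ℝ β q (pt 0 0 1)) - F * fderiv ℝ α q (pt 0 0 1))
    (h2 : b = F * (1 + fderiv ℝ α q (rotGen q)) - G * fderiv ℝ β q (rotGen q)) :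
    fderiv ℝ (fun q => shift (β q) (rot (α q) q)) q (h • rotGen q + b • pt 0 0 1) =
      jac (fun q => shift (β q) (rot (α q) q)) q •
        (G • rotGen (shift (β q) (rot (α q) q)) + F • pt 0 0 1) := by
  rw [jac_shift_rot hα hβ, map_add, map_smul, map_smul, fderiv_shift_rot_apply hα hβ,
    fderiv_shift_rot_apply hα hβ, rot_rotGen, rot_pt_axis, rotGen_shift, h1, h2]
  module

theorem exists_straightening {h b m n : R3 → ℝ} {r₀ : ℝ} (hr₀ : 0 < r₀) (hh : ContDiff ℝ ∞ h)
    (hb : ContDiff ℝ ∞ b) (hm : ContDiff ℝ ∞ m) (hn : ContDiff ℝ ∞ n)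
    (hhp : ∀ q, h (shift (2 * Real.pi) q) = h q) (hbp : ∀ q, b (shift (2 * Real.pi) q) = b q)
    (hmp : ∀ q, m (shift (2 * Real.pi) q) = m q) (hnp : ∀ q, n (shift (2 * Real.pi) q) = n q)
    (hE1 : ∀ q, fderiv ℝ h q (rotGen q) + fderiv ℝ b q (pt 0 0 1) = 0)
    (hE2 : ∀ q, fderiv ℝ m q (rotGen q) + fderiv ℝ n q (pt 0 0 1) = 0)
    (hax : ∀ s, b (pt 0 0 s) ≠ 0 ∧ n (pt 0 0 s) = 0 ∧ m (pt 0 0 s) ≠ 0) :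
    ∃ (r : ℝ) (N χ : R3 → R3) (F G K L : ℝ → ℝ), 0 < r ∧ ContDiffOn ℝ ∞ N (Dset r) ∧
      ContDiff ℝ ∞ F ∧ ContDiff ℝ ∞ G ∧ ContDiff ℝ ∞ K ∧ ContDiff ℝ ∞ L ∧
      (∀ q, N (shift (2 * Real.pi) q) = shift (2 * Real.pi) (N q)) ∧
      (∀ q, χ (shift (2 * Real.pi) q) = shift (2 * Real.pi) (χ q)) ∧
      (∀ q ∈ Dset r, N q ∈ Dset r₀) ∧ (∀ q ∈ Dset r, χ (N q) = q) ∧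
      (∀ q ∈ Dset r, psi (N q) = psi q) ∧ (∀ q ∈ Dset r, jac N q ≠ 0) ∧
      (∀ s, ∃ s', N (pt 0 0 s) = pt 0 0 s') ∧ (∀ s, ∃ s', N (pt 0 0 s') = pt 0 0 s) ∧
      (∀ q ∈ Dset r, fderiv ℝ N q (G (psi q) • rotGen q + F (psi q) • pt 0 0 1) =
        jac N q • (h (N q) • rotGen (N q) + b (N q) • pt 0 0 1)) ∧
      (∀ q ∈ Dset r, fderiv ℝ N q (L (psi q) • rotGen q + K (psi q) • pt 0 0 1) =
        jac N q • (m (N q) • rotGen (N q) + n (N q) • pt 0 0 1)) := by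
  obtain ⟨u, G, F, hu, hG, hF, hup, huθ, hus⟩ := exists_angle_primitive hh hb hhp hbp hE1
  obtain ⟨v, L, K, hv, hL, hK, hvp, hvθ, hvs⟩ := exists_angle_primitive hm hn hmp hnp hE2
  have hF0 : F 0 ≠ 0 := by
    have := huθ (pt 0 0 0)
    rw [rotGen_axis, map_zero, psi_axis] at this
    intro h0
    exact (hax 0).1 (by linarith)
  have hK0 : K 0 = 0 := by
    have := hvθ (pt 0 0 0)
    rw [rotGen_axis, map_zero, psi_axis, (hax 0).2.1] at this
    linarith
  have hL0 : L 0 ≠ 0 := by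
    have hd : ∀ s, HasDerivAt (fun s => v (pt 0 0 s)) (L 0 - m (pt 0 0 s)) s := fun s => by
      have h1 : HasDerivAt (fun s => pt 0 0 s) (pt 0 0 1) s :=
        HasDerivAt.pt (hasDerivAt_const s 0) (hasDerivAt_const s 0) (hasDerivAt_id s)
      have h2 := (hv.differentiable (by simp) (pt 0 0 s)).hasFDerivAt.comp_hasDerivAt s h1
      rwa [hvs, psi_axis] at h2
    obtain ⟨s, -, hs⟩ := exists_hasDerivAt_eq_zero (f := fun s => v (pt 0 0 s)) Real.two_pi_pos
      (fun s _ => (hd s).continuousAt.continuousWithinAt)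
      (by have := hvp (pt 0 0 0); rw [shift_pt, zero_add] at this; exact this.symm)
      (fun s _ => hd s)
    intro h0
    exact (hax s).2.2 (by linarith)
  set Δ : R3 → ℝ := fun q => G (psi q) * K (psi q) - F (psi q) * L (psi q) with hΔdef
  have hψ : ∀ {A : ℝ → ℝ}, ContDiff ℝ ∞ A → ContDiff ℝ ∞ fun q => A (psi q) :=
    fun hA => hA.comp contDiff_psi
  have hΔ : ContDiff ℝ ∞ Δ := ((hψ hG).mul (hψ hK)).sub ((hψ hF).mul (hψ hL))
  have hΔp : ∀ t q, Δ (shift t q) = Δ q := fun t q => by simp only [hΔdef, psi_shift]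
  obtain ⟨r₁, hr₁, hr₁₀, hΔ0⟩ := exists_Dset_of_eventually (P := fun q => Δ q ≠ 0)
    (fun q => by rw [hΔp]) (fun s => hΔ.continuous.continuousAt.eventually_ne (by
      simp only [hΔdef, psi_axis, hK0, mul_zero, zero_sub]
      exact neg_ne_zero.2 (mul_ne_zero hF0 hL0))) hr₀
  set α : R3 → ℝ := fun q => (G (psi q) * v q - L (psi q) * u q) / Δ q
    with hαdef
  set β : R3 → ℝ := fun q => (F (psi q) * v q - K (psi q) * u q) / Δ q with hβdef
  have hα : ContDiffOn ℝ ∞ α (Dset r₁) := by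
    refine ContDiffOn.div (ContDiff.contDiffOn ?_) hΔ.contDiffOn hΔ0
    exact ((hψ hG).mul hv).sub ((hψ hL).mul hu)
  have hβ : ContDiffOn ℝ ∞ β (Dset r₁) :=
    ContDiffOn.div (((hψ hF).mul hv).sub ((hψ hK).mul hu)).contDiffOn hΔ.contDiffOn hΔ0
  have hO := isOpen_Dset r₁
  have hαd : ∀ {q}, q ∈ Dset r₁ → DifferentiableAt ℝ α q := fun hq =>
    (hα.contDiffAt (hO.mem_nhds hq)).differentiableAt (by simp)
  have hβd : ∀ {q}, q ∈ Dset r₁ → DifferentiableAt ℝ β q := fun hq =>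
    (hβ.contDiffAt (hO.mem_nhds hq)).differentiableAt (by simp)
  have hαp : ∀ q, α (shift (2 * Real.pi) q) = α q := fun q => by
    simp only [hαdef, hΔp, psi_shift, hup, hvp]
  have hβp : ∀ q, β (shift (2 * Real.pi) q) = β q := fun q => by
    simp only [hβdef, hΔp, psi_shift, hup, hvp]
  have hsolu : ∀ q ∈ Dset r₁, u q = F (psi q) * α q - G (psi q) * β q := fun q hq => by
    have := hΔ0 q hq
    simp only [hαdef, hβdef]
    field_simp
    simp only [hΔdef]
    ring
  have hsolv : ∀ q ∈ Dset r₁, v q = K (psi q) * α q - L (psi q) * β q := fun q hq => by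
    have := hΔ0 q hq
    simp only [hαdef, hβdef]
    field_simp
    simp only [hΔdef]
    ring
  have hder : ∀ {A C : ℝ → ℝ} {w : R3 → ℝ}, ContDiff ℝ ∞ A → ContDiff ℝ ∞ C →
      (∀ q ∈ Dset r₁, w q = A (psi q) * α q - C (psi q) * β q) → ∀ q ∈ Dset r₁, ∀ e : R3,
      q 0 * e 0 + q 1 * e 1 = 0 →
      fderiv ℝ w q e = A (psi q) * fderiv ℝ α q e - C (psi q) * fderiv ℝ β q e := by
    intro A C w hA hC hw q hq e he
    have h1 : w =ᶠ[𝓝 q] fun q => A (psi q) * α q - C (psi q) * β q := by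
      filter_upwards [hO.mem_nhds hq] with q hq using hw q hq
    have dA : DifferentiableAt ℝ (fun q => A (psi q)) q := (hψ hA).differentiable (by simp) q
    have dC : DifferentiableAt ℝ (fun q => C (psi q)) q := (hψ hC).differentiable (by simp) q
    rw [h1.fderiv_eq, fderiv_fun_sub (dA.fun_mul (hαd hq)) (dC.fun_mul (hβd hq)), sub_apply,
      fderiv_mul_apply dA (hαd hq), fderiv_mul_apply dC (hβd hq),
      fderiv_comp_psi_apply (hA.differentiable (by simp) _),
      fderiv_comp_psi_apply (hC.differentiable (by simp) _), he]
    ring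
  have hs0 : ∀ q : R3, q 0 * pt 0 0 1 0 + q 1 * pt 0 0 1 1 = 0 := fun q => by simp
  have hsp : ∀ q ∈ Dset r₁,
      h q = G (psi q) * (1 + fderiv ℝ β q (pt 0 0 1)) - F (psi q) * fderiv ℝ α q (pt 0 0 1) ∧
      b q = F (psi q) * (1 + fderiv ℝ α q (rotGen q)) - G (psi q) * fderiv ℝ β q (rotGen q) ∧
      m q = L (psi q) * (1 + fderiv ℝ β q (pt 0 0 1)) - K (psi q) * fderiv ℝ α q (pt 0 0 1) ∧
      n q = K (psi q) * (1 + fderiv ℝ α q (rotGen q)) - L (psi q) * fderiv ℝ β q (rotGen q) := by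
    intro q hq
    have e1 := hder hF hG hsolu q hq _ (hs0 q)
    have e2 := hder hF hG hsolu q hq _ (fderiv_psi_rotGen q)
    have e3 := hder hK hL hsolv q hq _ (hs0 q)
    have e4 := hder hK hL hsolv q hq _ (fderiv_psi_rotGen q)
    rw [hus] at e1
    rw [huθ] at e2
    rw [hvs] at e3
    rw [hvθ] at e4
    refine ⟨?_, ?_, ?_, ?_⟩ <;> linarith
  set χ : R3 → R3 := fun q => shift (β q) (rot (α q) q) with hχdef
  have hχ : ContDiffOn ℝ ∞ χ (Dset r₁) :=
    contDiff_shift.comp_contDiffOn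
      ((contDiff_rot.comp_contDiffOn (contDiffOn_id.prodMk hα)).prodMk hβ)
  have hχp : ∀ q, χ (shift (2 * Real.pi) q) = shift (2 * Real.pi) (χ q) := fun q => by
    simp only [hχdef, hαp, hβp, rot_shift, ← shift_add, add_comm]
  have hψχ : ∀ q, psi (χ q) = psi q := fun q => by simp only [hχdef, psi_shift, psi_rot]
  have hjχ : ∀ s, jac χ (pt 0 0 s) ≠ 0 := by
    intro s
    have hs := axis_mem_Dset hr₁ s
    rw [hχdef, jac_shift_rot (hαd hs) (hβd hs), rotGen_axis, map_zero, map_zero]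
    have := (hsp _ hs).2.2.1
    rw [psi_axis, hK0] at this
    intro h0
    refine (hax s).2.2 ?_
    rw [this]
    linear_combination L 0 * h0
  obtain ⟨r, N, hr, hN, hNp, hNr, hχN, hjN, hNa, hNs⟩ := exists_equivariant_inverse hr₁ hχ hχp
    (fun s => by simp [hχdef, rot_pt_axis]) hjχ
  have hNd : ∀ {q}, q ∈ Dset r → DifferentiableAt ℝ N q := fun hq =>
    (hN.contDiffAt ((isOpen_Dset r).mem_nhds hq)).differentiableAt (by simp)
  have hχd : ∀ {q}, q ∈ Dset r → DifferentiableAt ℝ χ (N q) := fun hq =>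
    (hχ.contDiffAt (hO.mem_nhds (hNr _ hq))).differentiableAt (by simp)
  have hψN : ∀ q ∈ Dset r, psi (N q) = psi q := fun q hq => by rw [← hψχ, hχN q hq]
  have hev : ∀ {q}, q ∈ Dset r → (fun q => χ (N q)) =ᶠ[𝓝 q] fun q => q := fun hq => by
    filter_upwards [(isOpen_Dset r).mem_nhds hq] with q hq using hχN q hq
  have hjj : ∀ q ∈ Dset r, jac χ (N q) * jac N q = 1 := fun q hq => by
    rw [← jac_mul_of_comp_eq (hNd hq) (hχd hq), jac_congr (hev hq), jac_id]
  have hinv : ∀ q ∈ Dset r, ∀ w, fderiv ℝ N q (fderiv ℝ χ (N q) w) = w := by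
    intro q hq w
    have h1 : (fderiv ℝ χ (N q)).comp (fderiv ℝ N q) = ContinuousLinearMap.id ℝ R3 := by
      rw [← fderiv_comp q (hχd hq) (hNd hq)]
      exact (hev hq).fderiv_eq.trans fderiv_fun_id
    have h2 : (fderiv ℝ χ (N q)).toLinearMap * (fderiv ℝ N q).toLinearMap = 1 :=
      LinearMap.ext fun w => congrArg (fun A : R3 →L[ℝ] R3 => A w) h1
    exact LinearMap.congr_fun (mul_eq_one_comm.1 h2) w
  have hfl : ∀ {A C : ℝ → ℝ} {x y : R3 → ℝ}, (∀ q ∈ Dset r₁,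
      x q = A (psi q) * (1 + fderiv ℝ β q (pt 0 0 1)) - C (psi q) * fderiv ℝ α q (pt 0 0 1)) →
      (∀ q ∈ Dset r₁,
      y q = C (psi q) * (1 + fderiv ℝ α q (rotGen q)) - A (psi q) * fderiv ℝ β q (rotGen q)) →
      ∀ q ∈ Dset r, fderiv ℝ N q (A (psi q) • rotGen q + C (psi q) • pt 0 0 1) =
        jac N q • (x (N q) • rotGen (N q) + y (N q) • pt 0 0 1) := by
    intro A C x y hx hy q hq
    have hq₁ := hNr q hq
    have h1 := fderiv_shift_rot_span (hαd hq₁) (hβd hq₁) (hx _ hq₁) (hy _ hq₁)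
    change fderiv ℝ χ (N q) _ = jac χ (N q) • (_ • rotGen (χ (N q)) + _) at h1
    rw [hχN q hq, hψN q hq] at h1
    have h2 := congrArg (fun w => jac N q • fderiv ℝ N q w) h1
    simp only [hinv q hq, map_smul, smul_smul] at h2
    rw [mul_comm, hjj q hq, one_smul] at h2
    exact h2.symm
  exact ⟨r, N, χ, F, G, K, L, hr, hN, hF, hG, hK, hL, hNp, hχp,
    fun q hq => Dset_subset hr₁.le hr₁₀ (hNr q hq), hχN, hψN, hjN, hNa, hNs,
    hfl (fun q hq => (hsp q hq).1) (fun q hq => (hsp q hq).2.1),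
    hfl (fun q hq => (hsp q hq).2.2.1) (fun q hq => (hsp q hq).2.2.2)⟩

end Straighten

section Core

open Topology Filter

theorem exists_contDiff_primitive {F : ℝ → ℝ} (hF : ContDiff ℝ ∞ F) :
    ∃ f : ℝ → ℝ, ContDiff ℝ ∞ f ∧ ∀ t, deriv f t = F t := by
  have h : ∀ t, HasDerivAt (fun t => ∫ x in (0 : ℝ)..t, F x) (F t) t := fun t =>
    (hF.continuous.integral_hasStrictDerivAt 0 t).hasDerivAt
  refine ⟨_, contDiff_infty_iff_deriv.2 ⟨fun t => (h t).differentiableAt, ?_⟩, fun t => (h t).deriv⟩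
  rwa [funext fun t => (h t).deriv]

/-- Near-axis coordinates exist as soon as there are coordinates in which `p` is an affine function
of `psi`. -/
theorem near_axis_of_chart {U : Set R3} {B Ψ : R3 → R3} {p : R3 → ℝ} {γ : Set R3} {r₀ σ p₀ : ℝ}
    (hU : IsOpen U) (hB : ContDiffOn ℝ ∞ B U) (hp : ContDiffOn ℝ ∞ p U)
    (hBne : ∀ z ∈ U, B z ≠ 0) (hdiv : ∀ z ∈ U, divg B z = 0)
    (hMHS : ∀ z ∈ U, cross3 (curl B z) (B z) = gradient p z)
    (hr₀ : 0 < r₀) (hΨ : ContDiffOn ℝ ∞ Ψ (Dset r₀))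
    (hper : ∀ q, Ψ (shift (2 * Real.pi) q) = Ψ q) (hΨU : ∀ q ∈ Dset r₀, Ψ q ∈ U)
    (hpΨ : ∀ q ∈ Dset r₀, p (Ψ q) = p₀ + σ * psi q) (hσ : σ ≠ 0)
    (hjac : ∀ q ∈ Dset r₀, jac Ψ q ≠ 0)
    (hinj : ∀ q ∈ Dset r₀, ∀ q' ∈ Dset r₀, Ψ q = Ψ q' → ∃ n : ℤ, q = shift (2 * Real.pi * n) q')
    (hγ : Set.range (fun s : ℝ => Ψ (pt 0 0 s)) = γ) :
    ∃ (r δ : ℝ) (Φ : R3 → R3) (P f g k l : ℝ → ℝ),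
      0 < r ∧ 0 < δ ∧
      ContDiffOn ℝ (⊤ : ℕ∞) Φ (Dset r) ∧ (∀ q ∈ Dset r, Φ q ∈ U) ∧
      ContDiffOn ℝ (⊤ : ℕ∞) P (Set.Ioo (-δ) (r ^ 2 / 2)) ∧
      ContDiffOn ℝ (⊤ : ℕ∞) f (Set.Ioo (-δ) (r ^ 2 / 2)) ∧
      ContDiffOn ℝ (⊤ : ℕ∞) g (Set.Ioo (-δ) (r ^ 2 / 2)) ∧
      ContDiffOn ℝ (⊤ : ℕ∞) k (Set.Ioo (-δ) (r ^ 2 / 2)) ∧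
      ContDiffOn ℝ (⊤ : ℕ∞) l (Set.Ioo (-δ) (r ^ 2 / 2)) ∧
      (∀ x y φ : ℝ, Φ (pt x y (φ + 2 * Real.pi)) = Φ (pt x y φ)) ∧
      (∀ q ∈ Dset r, LinearMap.det (fderiv ℝ Φ q).toLinearMap ≠ 0) ∧
      IsOpen (Φ '' Dset r) ∧ γ ⊆ Φ '' Dset r ∧
      Set.range (fun φ : ℝ => Φ (pt 0 0 φ)) = γ ∧
      (∀ q ∈ Dset r, ∀ q' ∈ Dset r,
        (Φ q = Φ q' ↔ (q 0 = q' 0 ∧ q 1 = q' 1 ∧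
          ∃ n : ℤ, q 2 - q' 2 = 2 * Real.pi * (n : ℝ)))) ∧
      (∀ q ∈ Dset r,
        p (Φ q) = P (((q 0) ^ 2 + (q 1) ^ 2) / 2) ∧
        (fderiv ℝ Φ q
            (pt (-(deriv g (((q 0) ^ 2 + (q 1) ^ 2) / 2)) * q 1)
                ((deriv g (((q 0) ^ 2 + (q 1) ^ 2) / 2)) * q 0)
                (deriv f (((q 0) ^ 2 + (q 1) ^ 2) / 2)))
          = LinearMap.det (fderiv ℝ Φ q).toLinearMap • B (Φ q)) ∧
        (fderiv ℝ Φ q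
            (pt (-(deriv l (((q 0) ^ 2 + (q 1) ^ 2) / 2)) * q 1)
                ((deriv l (((q 0) ^ 2 + (q 1) ^ 2) / 2)) * q 0)
                (deriv k (((q 0) ^ 2 + (q 1) ^ 2) / 2)))
          = LinearMap.det (fderiv ℝ Φ q).toLinearMap •
              cross3 (B (Φ q)) (gradient p (Φ q)))) := by
  obtain ⟨r₁, h, b, m, n, hr₁, hr₁₀, hh, hb, hm, hn, hhp, hbp, hmp, hnp, hE1, hE2, hfB, hfJ, hax⟩ :=
    exists_flux_functions hU hB hp hBne hdiv hMHS hr₀ hΨ hper hΨU hpΨ hσ hjac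
  obtain ⟨r, N, χ, F, G, K, L, hr, hN, hF, hG, hK, hL, hNp, hχp, hNr, hχN, hψN, hjN, hNa, hNs,
    hN1, hN2⟩ := exists_straightening hr₁ hh hb hm hn hhp hbp hmp hnp hE1 hE2 hax
  obtain ⟨f, hf, hf'⟩ := exists_contDiff_primitive hF
  obtain ⟨g, hg, hg'⟩ := exists_contDiff_primitive hG
  obtain ⟨k, hk, hk'⟩ := exists_contDiff_primitive hK
  obtain ⟨l, hl, hl'⟩ := exists_contDiff_primitive hL
  have hsub := Dset_subset hr₁.le hr₁₀
  have hN₀ : ∀ q ∈ Dset r, N q ∈ Dset r₀ := fun q hq => hsub (hNr q hq)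
  have hNd : ∀ {q}, q ∈ Dset r → DifferentiableAt ℝ N q := fun hq =>
    (hN.contDiffAt ((isOpen_Dset r).mem_nhds hq)).differentiableAt (by simp)
  have hΨd : ∀ {q}, q ∈ Dset r → DifferentiableAt ℝ Ψ (N q) := fun hq =>
    (hΨ.contDiffAt ((isOpen_Dset r₀).mem_nhds (hN₀ _ hq))).differentiableAt (by simp)
  set Φ : R3 → R3 := fun q => Ψ (N q) with hΦdef
  have hΦ : ContDiffOn ℝ ∞ Φ (Dset r) := hΨ.comp hN hN₀
  have hΦp : ∀ q, Φ (shift (2 * Real.pi) q) = Φ q := fun q => by simp only [hΦdef, hNp, hper]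
  have hjΦ : ∀ q ∈ Dset r, jac Φ q = jac Ψ (N q) * jac N q := fun q hq =>
    jac_mul_of_comp_eq (hNd hq) (hΨd hq)
  have hΦd : ∀ q ∈ Dset r, ∀ w, fderiv ℝ Φ q w = fderiv ℝ Ψ (N q) (fderiv ℝ N q w) :=
    fun q hq w => congrArg (fun A : R3 →L[ℝ] R3 => A w) (fderiv_comp q (hΨd hq) (hNd hq))
  have hj : ∀ q ∈ Dset r, jac Φ q ≠ 0 := fun q hq => by
    rw [hjΦ q hq]
    exact mul_ne_zero (hjac _ (hN₀ q hq)) (hjN q hq)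
  have hflux : ∀ {X : R3 → R3} {A C : ℝ → ℝ} {x y : R3 → ℝ},
      (∀ q ∈ Dset r₁, fderiv ℝ Ψ q (x q • rotGen q + y q • pt 0 0 1) = jac Ψ q • X (Ψ q)) →
      (∀ q ∈ Dset r, fderiv ℝ N q (A (psi q) • rotGen q + C (psi q) • pt 0 0 1) =
        jac N q • (x (N q) • rotGen (N q) + y (N q) • pt 0 0 1)) → ∀ q ∈ Dset r,
      fderiv ℝ Φ q (pt (-(A (psi q)) * q 1) (A (psi q) * q 0) (C (psi q))) =
        jac Φ q • X (Φ q) := by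
    intro X A C x y h1 h2 q hq
    rw [neg_mul, ← rotGen_smul_add, hΦd q hq, h2 q hq, map_smul, h1 _ (hNr q hq), hjΦ q hq,
      smul_smul, mul_comm]
  have hrange : Set.range (fun φ : ℝ => Φ (pt 0 0 φ)) = γ := by
    rw [← hγ]
    ext z
    constructor
    · rintro ⟨s, rfl⟩
      obtain ⟨s', hs'⟩ := hNa s
      exact ⟨s', by simp only [hΦdef, hs']⟩
    · rintro ⟨s, rfl⟩
      obtain ⟨s', hs'⟩ := hNs s
      exact ⟨s', by simp only [hΦdef, hs']⟩
  refine ⟨r, 1, Φ, fun t => p₀ + σ * t, f, g, k, l, hr, one_pos, hΦ, fun q hq => hΨU _ (hN₀ q hq),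
    (contDiff_const.add (contDiff_const.mul contDiff_id)).contDiffOn, hf.contDiffOn, hg.contDiffOn,
    hk.contDiffOn, hl.contDiffOn, fun x y φ => by rw [← shift_pt, hΦp], hj,
    isOpen_image_of_jac_ne_zero (isOpen_Dset r) hΦ hj, ?_, hrange, ?_, fun q hq => ⟨?_, ?_, ?_⟩⟩
  · rw [← hrange]
    rintro _ ⟨s, rfl⟩
    exact ⟨_, axis_mem_Dset hr s, rfl⟩
  · intro q hq q' hq'
    constructor
    · intro heq
      obtain ⟨j, hj⟩ := hinj _ (hN₀ q hq) _ (hN₀ q' hq') heq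
      have h1 : q = shift (2 * Real.pi * j) q' := by
        rw [← hχN q hq, hj, shift_int_equivariant hχp, hχN q' hq']
      rw [h1]
      exact ⟨by simp, by simp, j, by simp⟩
    · rintro ⟨h0, h1, j, h2⟩
      have : q = shift (2 * Real.pi * j) q' := by
        refine R3_ext ?_ ?_ ?_ <;> simp [h0, h1]
        linarith
      rw [this, shift_int_invariant hΦp]
  · change p (Ψ (N q)) = p₀ + σ * psi q
    rw [hpΨ _ (hN₀ q hq), hψN q hq]
  · have := hflux hfB hN1 q hq
    rw [← hf', ← hg'] at this
    exact this
  · have := hflux (X := fun z => cross3 (B z) (gradient p z)) hfJ hN2 q hq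
    rw [← hk', ← hl'] at this
    exact this

end Core

section Morse

open Topology Filter

theorem hasDerivAt_radial (q : R3) (t : ℝ) :
    HasDerivAt (fun t => pt (t * q 0) (t * q 1) (q 2)) (pt (q 0) (q 1) 0) t := by
  have h := fun i => (hasDerivAt_id t).mul_const (q i)
  have := HasDerivAt.pt (h 0) (h 1) (hasDerivAt_const t (q 2))
  simpa using this

theorem exists_hadamard_axis {f : R3 → ℝ} (hf : ContDiff ℝ ∞ f) (h0 : ∀ s, f (pt 0 0 s) = 0)
    (hper : ∀ q, f (shift (2 * Real.pi) q) = f q) :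
    ∃ f₀ f₁ : R3 → ℝ, ContDiff ℝ ∞ f₀ ∧ ContDiff ℝ ∞ f₁ ∧
      (∀ q, f₀ (shift (2 * Real.pi) q) = f₀ q) ∧ (∀ q, f₁ (shift (2 * Real.pi) q) = f₁ q) ∧
      ∀ q, f q = q 0 * f₀ q + q 1 * f₁ q := by
  have hS : ContDiff ℝ ∞ fun z : R3 × ℝ => pt (z.2 * z.1 0) (z.2 * z.1 1) (z.1 2) := by
    have h := fun i => (contDiff_coord i (n := ∞)).comp (contDiff_fst (F := ℝ))
    exact (contDiff_snd.mul (h 0)).pt (contDiff_snd.mul (h 1)) (h 2)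
  have hF : ∀ e, ContDiff ℝ ∞ fun z : R3 × ℝ =>
      fderiv ℝ f (pt (z.2 * z.1 0) (z.2 * z.1 1) (z.1 2)) e := fun e =>
    ((hf.fderiv_right (by simp)).comp hS).clm_apply contDiff_const
  have hp : ∀ e q, (∫ t in (0 : ℝ)..1, fderiv ℝ f
      (pt (t * shift (2 * Real.pi) q 0) (t * shift (2 * Real.pi) q 1) (shift (2 * Real.pi) q 2)) e) =
      ∫ t in (0 : ℝ)..1, fderiv ℝ f (pt (t * q 0) (t * q 1) (q 2)) e := fun e q => by
    simp only [shift_apply_zero, shift_apply_one, shift_apply_two, ← shift_pt, fderiv_periodic hper]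
  have hc : ∀ e (q : R3), Continuous fun t : ℝ =>
      fderiv ℝ f (pt (t * q 0) (t * q 1) (q 2)) e := fun e q =>
    (hF e).continuous.comp (Continuous.prodMk_right q)
  refine ⟨_, _, contDiff_integral_param (hF (pt 1 0 0)) 0 1,
    contDiff_integral_param (hF (pt 0 1 0)) 0 1, hp _, hp _, fun q => ?_⟩
  have hd : ∀ t, HasDerivAt (fun t => f (pt (t * q 0) (t * q 1) (q 2)))
      (q 0 * fderiv ℝ f (pt (t * q 0) (t * q 1) (q 2)) (pt 1 0 0) +
        q 1 * fderiv ℝ f (pt (t * q 0) (t * q 1) (q 2)) (pt 0 1 0)) t := fun t => by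
    have := (hf.differentiable (by simp) _).hasFDerivAt.comp_hasDerivAt t (hasDerivAt_radial q t)
    refine this.congr_deriv ?_
    rw [map_pt]
    simp
  have hi : ∀ i e, IntervalIntegrable (fun t : ℝ =>
      q i * fderiv ℝ f (pt (t * q 0) (t * q 1) (q 2)) e) MeasureTheory.volume 0 1 := fun i e =>
    (continuous_const.mul (hc e q)).intervalIntegrable _ _
  have h1 := intervalIntegral.integral_eq_sub_of_hasDerivAt (a := 0) (b := 1) (fun t _ => hd t)
    ((hi 0 _).add (hi 1 _))
  rw [intervalIntegral.integral_add (hi 0 _) (hi 1 _),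
    intervalIntegral.integral_const_mul, intervalIntegral.integral_const_mul] at h1
  simp only [one_mul, zero_mul, h0, sub_zero, pt_eta] at h1
  exact h1.symm

theorem fderiv_axis_of_eq {f f₀ f₁ : R3 → ℝ} (h₀ : ContDiff ℝ ∞ f₀) (h₁ : ContDiff ℝ ∞ f₁)
    (h : ∀ q, f q = q 0 * f₀ q + q 1 * f₁ q) (s : ℝ) (v : R3) :
    fderiv ℝ f (pt 0 0 s) v = v 0 * f₀ (pt 0 0 s) + v 1 * f₁ (pt 0 0 s) := by
  have d₀ : DifferentiableAt ℝ f₀ (pt 0 0 s) := h₀.differentiable (by simp) _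
  have d₁ : DifferentiableAt ℝ f₁ (pt 0 0 s) := h₁.differentiable (by simp) _
  have c := fun i => differentiableAt_coord i (pt 0 0 s)
  rw [funext h, fderiv_fun_add ((c 0).fun_mul d₀) ((c 1).fun_mul d₁), add_apply,
    fderiv_mul_apply (c 0) d₀, fderiv_mul_apply (c 1) d₁, fderiv_coord_apply, fderiv_coord_apply]
  simp

/-- A function vanishing to second order along the axis is a quadratic form with variable
coefficients, which are given on the axis by the second derivative. -/
theorem exists_quadratic_form {W : R3 → ℝ} (hW : ContDiff ℝ ∞ W) (h0 : ∀ s, W (pt 0 0 s) = 0)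
    (h1 : ∀ s, fderiv ℝ W (pt 0 0 s) = 0) (hper : ∀ q, W (shift (2 * Real.pi) q) = W q) :
    ∃ a b c : R3 → ℝ, ContDiff ℝ ∞ a ∧ ContDiff ℝ ∞ b ∧ ContDiff ℝ ∞ c ∧
      (∀ q, a (shift (2 * Real.pi) q) = a q) ∧ (∀ q, b (shift (2 * Real.pi) q) = b q) ∧
      (∀ q, c (shift (2 * Real.pi) q) = c q) ∧
      (∀ q, W q = (a q * q 0 ^ 2 + 2 * b q * q 0 * q 1 + c q * q 1 ^ 2) / 2) ∧
      ∀ s x y, fderiv ℝ (fderiv ℝ W) (pt 0 0 s) (pt x y 0) (pt x y 0) =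
        a (pt 0 0 s) * x ^ 2 + 2 * b (pt 0 0 s) * x * y + c (pt 0 0 s) * y ^ 2 := by
  obtain ⟨A, C, hA, hC, hAp, hCp, hAC⟩ := exists_hadamard_axis hW h0 hper
  have hA0 : ∀ s, A (pt 0 0 s) = 0 := fun s => by
    have := fderiv_axis_of_eq hA hC hAC s (pt 1 0 0)
    rw [h1] at this
    simpa using this.symm
  have hC0 : ∀ s, C (pt 0 0 s) = 0 := fun s => by
    have := fderiv_axis_of_eq hA hC hAC s (pt 0 1 0)
    rw [h1] at this
    simpa using this.symm
  obtain ⟨A₀, A₁, hA₀, hA₁, hA₀p, hA₁p, hA₀₁⟩ := exists_hadamard_axis hA hA0 hAp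
  obtain ⟨C₀, C₁, hC₀, hC₁, hC₀p, hC₁p, hC₀₁⟩ := exists_hadamard_axis hC hC0 hCp
  have hform : ∀ q, W q =
      ((2 * A₀ q) * q 0 ^ 2 + 2 * (A₁ q + C₀ q) * q 0 * q 1 + (2 * C₁ q) * q 1 ^ 2) / 2 :=
    fun q => by rw [hAC, hA₀₁, hC₀₁]; ring
  refine ⟨fun q => 2 * A₀ q, fun q => A₁ q + C₀ q, fun q => 2 * C₁ q, contDiff_const.mul hA₀,
    hA₁.add hC₀, contDiff_const.mul hC₁, fun q => by simp only [hA₀p],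
    fun q => by simp only [hA₁p, hC₀p], fun q => by simp only [hC₁p], hform, fun s x y => ?_⟩
  set w := pt x y 0
  have hW' : ContDiff ℝ ∞ fun q => fderiv ℝ W q w := (hW.fderiv_right (by simp)).clm_apply
    contDiff_const
  have e1 : fderiv ℝ (fderiv ℝ W) (pt 0 0 s) w w = fderiv ℝ (fun q => fderiv ℝ W q w) (pt 0 0 s) w := by
    have := ((hW.fderiv_right (m := ∞) (by simp)).differentiable (by simp) (pt 0 0 s)).hasFDerivAt
    have h2 := (this.clm_apply (hasFDerivAt_const w (pt 0 0 s))).fderiv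
    rw [h2]; simp
  -- `q ↦ DW(q) w` in terms of `A` and `C`
  have e2 : ∀ q, fderiv ℝ W q w =
      q 0 * (fderiv ℝ A q w + 0) + q 1 * fderiv ℝ C q w + (x * A q + y * C q) := fun q => by
    have dA : DifferentiableAt ℝ A q := hA.differentiable (by simp) _
    have dC : DifferentiableAt ℝ C q := hC.differentiable (by simp) _
    have c := fun i => differentiableAt_coord i q
    rw [funext hAC, fderiv_fun_add ((c 0).fun_mul dA) ((c 1).fun_mul dC), add_apply,
      fderiv_mul_apply (c 0) dA, fderiv_mul_apply (c 1) dC, fderiv_coord_apply, fderiv_coord_apply]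
    simp [w]; ring
  have e3 : ∀ q, fderiv ℝ W q w = q 0 * (fderiv ℝ A q w + (x * A₀ q + y * C₀ q)) +
      q 1 * (fderiv ℝ C q w + (x * A₁ q + y * C₁ q)) := fun q => by
    rw [e2, hA₀₁, hC₀₁]
    have : q 0 * A₀ q + q 1 * A₁ q = A q := (hA₀₁ q).symm
    ring_nf
  have kA : ContDiff ℝ ∞ fun q => fderiv ℝ A q w :=
    (hA.fderiv_right (by simp)).clm_apply contDiff_const
  have kC : ContDiff ℝ ∞ fun q => fderiv ℝ C q w :=
    (hC.fderiv_right (by simp)).clm_apply contDiff_const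
  have e4 := fderiv_axis_of_eq
    (kA.add ((contDiff_const (c := x)).mul hA₀ |>.add ((contDiff_const (c := y)).mul hC₀)))
    (kC.add ((contDiff_const (c := x)).mul hA₁ |>.add ((contDiff_const (c := y)).mul hC₁))) e3 s w
  rw [e1, e4, fderiv_axis_of_eq hA₀ hA₁ hA₀₁, fderiv_axis_of_eq hC₀ hC₁ hC₀₁]
  simp [w]; ring

theorem exists_morse_chart {P : R3 → ℝ} {r₀ p₀ : ℝ} (hr₀ : 0 < r₀)
    (hP : ContDiffOn ℝ ∞ P (Dset r₀)) (hper : ∀ q, P (shift (2 * Real.pi) q) = P q)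
    (h0 : ∀ s, P (pt 0 0 s) = p₀) (h1 : ∀ s, fderiv ℝ P (pt 0 0 s) = 0)
    (h2 : ∀ s x y, (x ≠ 0 ∨ y ≠ 0) →
      0 < fderiv ℝ (fderiv ℝ P) (pt 0 0 s) (pt x y 0) (pt x y 0)) :
    ∃ (r : ℝ) (N : R3 → R3), 0 < r ∧ ContDiffOn ℝ ∞ N (Dset r) ∧
      (∀ q, N (shift (2 * Real.pi) q) = shift (2 * Real.pi) (N q)) ∧
      (∀ q ∈ Dset r, N q ∈ Dset r₀) ∧
      (∀ q ∈ Dset r, ∀ q' ∈ Dset r, ∀ n : ℤ, N q = shift (2 * Real.pi * n) (N q') →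
        q = shift (2 * Real.pi * n) q') ∧
      (∀ q ∈ Dset r, jac N q ≠ 0) ∧
      (∀ s, ∃ s', N (pt 0 0 s) = pt 0 0 s') ∧ (∀ s, ∃ s', N (pt 0 0 s') = pt 0 0 s) ∧
      ∀ q ∈ Dset r, P (N q) = p₀ + psi q := by
  set W : R3 → ℝ := fun q => cutoff r₀ q * (P q - p₀) with hWdef
  have hW : ContDiff ℝ ∞ W := contDiff_cutoff_mul hr₀ (hP.sub contDiffOn_const)
  have hr' : 0 < r₀ / 2 := by positivity
  have hWP : ∀ q ∈ Dset (r₀ / 2), W q = P q - p₀ := fun q hq => by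
    simp only [hWdef, cutoff_eq_one hr₀ hq, one_mul]
  have hev : ∀ q ∈ Dset (r₀ / 2), fderiv ℝ W =ᶠ[𝓝 q] fderiv ℝ P := fun q hq => by
    filter_upwards [(isOpen_Dset (r₀ / 2)).mem_nhds hq] with q hq
    have : W =ᶠ[𝓝 q] fun q => P q - p₀ := by
      filter_upwards [(isOpen_Dset (r₀ / 2)).mem_nhds hq] with q hq using hWP q hq
    rw [this.fderiv_eq, fderiv_sub_const]
  obtain ⟨a, b, c, ha, hb, hc, hap, hbp, hcp, hWf, hW2⟩ := exists_quadratic_form hW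
    (fun s => by rw [hWP _ (axis_mem_Dset hr' s), h0, sub_self])
    (fun s => by rw [(hev _ (axis_mem_Dset hr' s)).eq_of_nhds, h1])
    (fun q => by simp only [hWdef, cutoff_shift, hper])
  have hpos : ∀ s x y, (x ≠ 0 ∨ y ≠ 0) →
      0 < a (pt 0 0 s) * x ^ 2 + 2 * b (pt 0 0 s) * x * y + c (pt 0 0 s) * y ^ 2 :=
    fun s x y h => by
      rw [← hW2, (hev _ (axis_mem_Dset hr' s)).fderiv_eq]
      exact h2 s x y h
  have ha0 : ∀ s, 0 < a (pt 0 0 s) := fun s => by simpa using hpos s 1 0 (by simp)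
  have hd0 : ∀ s, 0 < a (pt 0 0 s) * c (pt 0 0 s) - b (pt 0 0 s) ^ 2 := fun s => by
    have := hpos s (-b (pt 0 0 s)) (a (pt 0 0 s)) (Or.inr (ha0 s).ne')
    refine pos_of_mul_pos_right (a := a (pt 0 0 s)) ?_ (ha0 s).le
    linarith
  set d : R3 → ℝ := fun q => a q * c q - b q ^ 2 with hddef
  have hd : ContDiff ℝ ∞ d := (ha.mul hc).sub (hb.pow 2)
  obtain ⟨r₁, hr₁, hr₁₀, hab⟩ := exists_Dset_of_eventually (P := fun q => 0 < a q ∧ 0 < d q)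
    (fun q => by simp only [hddef, hap, hbp, hcp])
    (fun s => (ha.continuous.continuousAt.eventually_const_lt (ha0 s)).and
      (hd.continuous.continuousAt.eventually_const_lt (hd0 s))) hr'
  set X : R3 → ℝ := fun q => q 0 * Real.sqrt (a q) + q 1 * (b q / Real.sqrt (a q)) with hXdef
  set Y : R3 → ℝ := fun q => q 1 * Real.sqrt (d q / a q) with hYdef
  set Λ : R3 → R3 := fun q => pt (X q) (Y q) (q 2) with hΛdef
  have hsa : ContDiffOn ℝ ∞ (fun q => Real.sqrt (a q)) (Dset r₁) :=
    ha.contDiffOn.sqrt fun q hq => (hab q hq).1.ne'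
  have hsb : ContDiffOn ℝ ∞ (fun q => b q / Real.sqrt (a q)) (Dset r₁) :=
    hb.contDiffOn.div hsa fun q hq => (Real.sqrt_pos.2 (hab q hq).1).ne'
  have hsd : ContDiffOn ℝ ∞ (fun q => Real.sqrt (d q / a q)) (Dset r₁) :=
    (hd.contDiffOn.div ha.contDiffOn fun q hq => (hab q hq).1.ne').sqrt
      fun q hq => (div_pos (hab q hq).2 (hab q hq).1).ne'
  have hΛ : ContDiffOn ℝ ∞ Λ (Dset r₁) :=
    (((contDiff_coord 0).contDiffOn.mul hsa).add ((contDiff_coord 1).contDiffOn.mul hsb)).pt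
      ((contDiff_coord 1).contDiffOn.mul hsd) (contDiff_coord 2).contDiffOn
  have hΛp : ∀ q, Λ (shift (2 * Real.pi) q) = shift (2 * Real.pi) (Λ q) := fun q => by
    simp only [hΛdef, hXdef, hYdef, hddef, hap, hbp, hcp, shift_pt, shift_apply_zero,
      shift_apply_one, shift_apply_two]
  have hψΛ : ∀ q ∈ Dset r₁, psi (Λ q) = W q := fun q hq => by
    obtain ⟨h3, h4⟩ := hab q hq
    have h5 : Real.sqrt (a q) ≠ 0 := (Real.sqrt_pos.2 h3).ne'
    have h6 : Real.sqrt (a q) ^ 2 = a q := Real.sq_sqrt h3.le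
    have h7 : Real.sqrt (d q / a q) ^ 2 = d q / a q := Real.sq_sqrt (div_pos h4 h3).le
    have h8 : X q ^ 2 = (q 0 * a q + q 1 * b q) ^ 2 / a q := by
      have : X q = (q 0 * a q + q 1 * b q) / Real.sqrt (a q) := by
        rw [hXdef, eq_div_iff h5, add_mul, mul_assoc, ← pow_two, h6, mul_assoc,
          div_mul_cancel₀ _ h5]
      rw [this, div_pow, h6]
    rw [hWf, psi]
    simp only [hΛdef, pt_zero, pt_one, h8]
    simp only [hYdef, mul_pow, h7]
    simp only [hddef]
    field_simp
    ring
  have hjΛ : ∀ s, jac Λ (pt 0 0 s) ≠ 0 := by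
    intro s
    have hs := (isOpen_Dset r₁).mem_nhds (axis_mem_Dset hr₁ s)
    have dd : ∀ {f : R3 → ℝ}, ContDiffOn ℝ ∞ f (Dset r₁) → DifferentiableAt ℝ f (pt 0 0 s) :=
      fun hf => (hf.contDiffAt hs).differentiableAt (by simp)
    have c := fun i => differentiableAt_coord i (pt 0 0 s)
    have dX := (c 0).fun_mul (dd hsa)
    have dX' := (c 1).fun_mul (dd hsb)
    have dY := (c 1).fun_mul (dd hsd)
    have hv : ∀ v, fderiv ℝ Λ (pt 0 0 s) v = _ := fun v =>
      HasFDerivAt.pt_apply (dX.fun_add dX').hasFDerivAt dY.hasFDerivAt (c 2).hasFDerivAt v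
    have hX : ∀ v, fderiv ℝ X (pt 0 0 s) v = v 0 * Real.sqrt (a (pt 0 0 s)) +
        v 1 * (b (pt 0 0 s) / Real.sqrt (a (pt 0 0 s))) := fun v => by
      rw [hXdef, fderiv_fun_add dX dX', add_apply, fderiv_mul_apply (c 0) (dd hsa),
        fderiv_mul_apply (c 1) (dd hsb), fderiv_coord_apply, fderiv_coord_apply]
      simp
    have hY : ∀ v, fderiv ℝ Y (pt 0 0 s) v =
        v 1 * Real.sqrt (d (pt 0 0 s) / a (pt 0 0 s)) := fun v => by
      rw [hYdef, fderiv_mul_apply (c 1) (dd hsd), fderiv_coord_apply]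
      simp
    have hv' : ∀ v, fderiv ℝ Λ (pt 0 0 s) v =
        pt (fderiv ℝ X (pt 0 0 s) v) (fderiv ℝ Y (pt 0 0 s) v) (v 2) := fun v => by
      rw [hv, fderiv_coord_apply]
    have hj : jac Λ (pt 0 0 s) =
        Real.sqrt (a (pt 0 0 s)) * Real.sqrt (d (pt 0 0 s) / a (pt 0 0 s)) := by
      rw [jac, det_eq_det3]
      simp only [hv', hX, hY, det3, pt_zero, pt_one, pt_two]
      ring
    rw [hj]
    exact mul_ne_zero (Real.sqrt_pos.2 (ha0 s)).ne'
      (Real.sqrt_pos.2 (div_pos (hd0 s) (ha0 s))).ne'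
  obtain ⟨r, N, hr, hN, hNp, hNr, hΛN, hjN, hNa, hNs⟩ := exists_equivariant_inverse hr₁ hΛ hΛp
    (fun s => by simp [hΛdef, hXdef, hYdef]) hjΛ
  have hsub := Dset_subset hr₁.le hr₁₀
  refine ⟨r, N, hr, hN, hNp, fun q hq => Dset_subset hr'.le (half_le_self hr₀.le) (hsub (hNr q hq)),
    fun q hq q' hq' n hn => ?_, hjN, hNa, hNs, fun q hq => ?_⟩
  · rw [← hΛN q hq, hn, shift_int_equivariant hΛp, hΛN q' hq']
  · have h3 := hψΛ _ (hNr q hq)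
    rw [hΛN q hq, hWP _ (hsub (hNr q hq))] at h3
    linarith

end Morse

section Orbit

open Topology Filter

variable {E : Type*} [NormedAddCommGroup E] [NormedSpace ℝ E] {U : Set E} {B : E → E} {c : ℝ → E}

theorem contDiff_of_integral_curve (hU : IsOpen U) (hB : ContDiffOn ℝ ∞ B U) (hcU : ∀ t, c t ∈ U)
    (hc : ∀ t, HasDerivAt c (B (c t)) t) : ContDiff ℝ ∞ c := by
  refine contDiff_infty.2 fun n => ?_
  have hd : deriv c = fun t => B (c t) := funext fun t => (hc t).deriv
  induction n with
  | zero => exact contDiff_zero.2 (continuous_iff_continuousAt.2 fun t => (hc t).continuousAt)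
  | succ n ih =>
    refine (contDiff_succ_iff_deriv (n := (n : WithTop ℕ∞))).2
      ⟨fun t => (hc t).differentiableAt, by simp, ?_⟩
    rw [hd]
    exact contDiff_iff_contDiffAt.2 fun t =>
      ((hB.contDiffAt (hU.mem_nhds (hcU t))).of_le (by exact_mod_cast le_top)).comp t ih.contDiffAt

theorem integral_curve_unique (hU : IsOpen U) (hB : ContDiffOn ℝ ∞ B U) {d : ℝ → E}
    (hcU : ∀ t, c t ∈ U) (hc : ∀ t, HasDerivAt c (B (c t)) t)
    (hd : ∀ t, HasDerivAt d (B (d t)) t) {t₀ : ℝ} (h : c t₀ = d t₀) (t : ℝ) : c t = d t := by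
  have hcc : Continuous c := continuous_iff_continuousAt.2 fun t => (hc t).continuousAt
  have hdc : Continuous d := continuous_iff_continuousAt.2 fun t => (hd t).continuousAt
  have hcl : IsClopen {t | c t = d t} := by
    refine ⟨isClosed_eq hcc hdc, isOpen_iff_mem_nhds.2 fun t (ht : c t = d t) => ?_⟩
    obtain ⟨K, s, hs, hK⟩ := ((hB.contDiffAt (hU.mem_nhds (hcU t))).of_le
      (by exact_mod_cast le_top : (1 : WithTop ℕ∞) ≤ ∞)).exists_lipschitzOnWith
    exact ODE_solution_unique_of_eventually (v := fun _ => B) (s := fun _ => s)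
      (Eventually.of_forall fun _ => hK)
      ((hcc.continuousAt.eventually hs).mono fun t ht => ⟨hc t, ht⟩)
      ((hdc.continuousAt.eventually (ht ▸ hs)).mono fun t ht => ⟨hd t, ht⟩) ht
  exact Set.eq_univ_iff_forall.1 (hcl.eq_univ ⟨t₀, h⟩) t

theorem exists_minimal_period (hU : IsOpen U) (hB : ContDiffOn ℝ ∞ B U) (hBne : ∀ z ∈ U, B z ≠ 0)
    (hcU : ∀ t, c t ∈ U) (hc : ∀ t, HasDerivAt c (B (c t)) t) {T : ℝ} (hT : 0 < T)
    (hcT : ∀ t, c (t + T) = c t) :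
    ∃ a, 0 < a ∧ (∀ t, c (t + a) = c t) ∧ ∀ s t, c s = c t → ∃ n : ℤ, s = t + n * a := by
  have hcc : Continuous c := continuous_iff_continuousAt.2 fun t => (hc t).continuousAt
  let G : AddSubgroup ℝ :=
    { carrier := {t | ∀ x, c (x + t) = c x}
      add_mem' := fun {a b} ha hb x => by rw [← add_assoc, hb, ha]
      zero_mem' := fun x => by rw [add_zero]
      neg_mem' := fun {a} ha x => by rw [← ha (x + -a), neg_add_cancel_right] }
  have hG : ∀ t, t ∈ G ↔ ∀ x, c (x + t) = c x := fun t => Iff.rfl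
  have key : ∀ s t, c s = c t → s - t ∈ G := fun s t h x => by
    have hsh : ∀ u, HasDerivAt (fun u => c (u + (s - t))) (B (c (u + (s - t)))) u := fun u =>
      (hc (u + (s - t))).comp_add_const u (s - t)
    exact (integral_curve_unique hU hB hcU hc hsh (t₀ := t) (by simp [h]) x).symm
  obtain ⟨a, ha⟩ : ∃ a, G = AddSubgroup.closure {a} := by
    refine G.dense_or_cyclic.resolve_left fun hD => ?_
    have hcl : IsClosed (G : Set ℝ) := by
      have : (G : Set ℝ) = ⋂ x, {t | c (x + t) = c x} := by ext; simp [hG]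
      rw [this]
      exact isClosed_iInter fun x => isClosed_eq (by fun_prop) continuous_const
    have hall : ∀ t, t ∈ G := fun t => by
      have := hD t
      rwa [hcl.closure_eq] at this
    have hconst : c = fun _ => c 0 := funext fun t => by simpa using (hG t).1 (hall t) 0
    have h0 := hc 0
    rw [hconst] at h0
    exact hBne _ (hcU 0) (h0.unique (hasDerivAt_const 0 (c 0)))
  have hmem : ∀ t, t ∈ G ↔ ∃ n : ℤ, n * a = t := fun t => by
    rw [ha, AddSubgroup.mem_closure_singleton]; simp
  have ha0 : a ≠ 0 := by
    rintro rfl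
    obtain ⟨n, hn⟩ := (hmem T).1 hcT
    simp at hn
    exact hT.ne hn
  have haG : a ∈ G := (hmem a).2 ⟨1, by simp⟩
  refine ⟨|a|, abs_pos.2 ha0, ?_, fun s t h => ?_⟩
  · rcases abs_choice a with h | h <;> rw [h]
    · exact haG
    · exact G.neg_mem haG
  · obtain ⟨n, hn⟩ := (hmem _).1 (key s t h)
    rcases abs_choice a with h | h <;> rw [h]
    · exact ⟨n, by linarith⟩
    · exact ⟨-n, by push_cast; linarith⟩

end Orbit

section

theorem IsPeriodicOrbit.exists_param {U : Set R3} {B : R3 → R3} {γ : Set R3} (hU : IsOpen U)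
    (hB : ContDiffOn ℝ ∞ B U) (hBne : ∀ z ∈ U, B z ≠ 0) (hγ : IsPeriodicOrbit U B γ) :
    ∃ (c : ℝ → R3) (κ : ℝ), 0 < κ ∧ ContDiff ℝ ∞ c ∧ (∀ s, c s ∈ U) ∧
      (∀ s, c (s + 2 * Real.pi) = c s) ∧ (∀ s, HasDerivAt c (κ • B (c s)) s) ∧
      (∀ s s', c s = c s' → ∃ n : ℤ, s = s' + 2 * Real.pi * n) ∧ Set.range c = γ := by
  obtain ⟨c, T, hT, hcU, hcT, hc, rfl⟩ := hγ
  obtain ⟨a, ha, hca, hinj⟩ := exists_minimal_period hU hB hBne hcU hc hT hcT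
  have hpi := Real.pi_pos
  have hκ : 0 < a / (2 * Real.pi) := by positivity
  refine ⟨fun s => c (s * (a / (2 * Real.pi))), a / (2 * Real.pi), hκ,
    (contDiff_of_integral_curve hU hB hcU hc).comp (contDiff_id.mul contDiff_const),
    fun s => hcU _, fun s => ?_, fun s => ?_, fun s s' h => ?_, ?_⟩
  · refine (congrArg c ?_).trans (hca (s * (a / (2 * Real.pi))))
    field_simp
  · have h1 : HasDerivAt (fun s => s * (a / (2 * Real.pi))) (a / (2 * Real.pi)) s := by
      simpa using (hasDerivAt_id s).mul_const (a / (2 * Real.pi))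
    exact (hc (s * (a / (2 * Real.pi)))).scomp s h1
  · obtain ⟨n, hn⟩ := hinj _ _ h
    refine ⟨n, ?_⟩
    field_simp at hn
    linarith
  · refine (Function.Surjective.range_comp (f := fun s => s * (a / (2 * Real.pi)))
      (fun t => ⟨t / (a / (2 * Real.pi)), div_mul_cancel₀ _ hκ.ne'⟩) c)

end

section Frame

open Topology Filter

theorem cross3_cross3_eq (v b : R3) : cross3 b (cross3 v b) = dot3 b b • v - dot3 v b • b := by
  refine R3_ext ?_ ?_ ?_ <;> simp [cross3, dot3] <;> ring

theorem det3_cross3_frame (n b : R3) (h : dot3 n b = 0) :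
    det3 n (cross3 b n) b = dot3 b b * dot3 n n := by
  have : det3 n (cross3 b n) b = dot3 b b * dot3 n n - dot3 n b * dot3 n b := by
    simp only [cross3, dot3, det3, pt_zero, pt_one, pt_two]; ring
  rw [this, h]; ring

theorem dot3_self_ne_zero {v : R3} (h : v ≠ 0) : dot3 v v ≠ 0 := by
  rw [← inner_eq_dot3]; simpa using h

theorem ContDiff.cross3 {u v : ℝ → R3} (hu : ContDiff ℝ ∞ u) (hv : ContDiff ℝ ∞ v) :
    ContDiff ℝ ∞ fun s => cross3 (u s) (v s) := by
  have U := fun i => (contDiff_coord i (n := ∞)).comp hu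
  have V := fun i => (contDiff_coord i (n := ∞)).comp hv
  exact (((U 1).mul (V 2)).sub ((U 2).mul (V 1))).pt (((U 2).mul (V 0)).sub ((U 0).mul (V 2)))
    (((U 0).mul (V 1)).sub ((U 1).mul (V 0)))

theorem exists_normal_frame {b : ℝ → R3} (hb : ContDiff ℝ ∞ b) (hb0 : ∀ s, b s ≠ 0) {T : ℝ}
    (hT : ∀ s, b (s + T) = b s) :
    ∃ n₁ n₂ : ℝ → R3, ContDiff ℝ ∞ n₁ ∧ ContDiff ℝ ∞ n₂ ∧ (∀ s, n₁ (s + T) = n₁ s) ∧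
      (∀ s, n₂ (s + T) = n₂ s) ∧ (∀ s, dot3 (n₁ s) (b s) = 0) ∧ (∀ s, dot3 (n₂ s) (b s) = 0) ∧
      ∀ s, det3 (n₁ s) (n₂ s) (b s) ≠ 0 := by
  have hf : ContDiff ℝ 1 fun z : ℝ × ℝ => z.1 • b z.2 :=
    contDiff_fst.smul ((hb.of_le (by exact_mod_cast le_top)).comp contDiff_snd)
  obtain ⟨v, hv⟩ := (hf.dense_compl_range_of_finrank_lt_finrank (by simp)).nonempty
  have hv' : ∀ s t, t • b s ≠ v := fun s t h => hv ⟨(t, s), h⟩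
  have h1 : ContDiff ℝ ∞ fun s => cross3 v (b s) := ContDiff.cross3 contDiff_const hb
  have hn : ∀ s, cross3 v (b s) ≠ 0 := fun s h => by
    have h2 := cross3_cross3_eq v (b s)
    have h0 := dot3_self_ne_zero (hb0 s)
    rw [h, show cross3 (b s) 0 = 0 by refine R3_ext ?_ ?_ ?_ <;> simp [cross3], eq_comm,
      sub_eq_zero] at h2
    refine hv' s ((dot3 (b s) (b s))⁻¹ * dot3 v (b s)) ?_
    rw [mul_smul, ← h2, inv_smul_smul₀ h0]
  refine ⟨fun s => cross3 v (b s), fun s => cross3 (b s) (cross3 v (b s)), h1,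
    ContDiff.cross3 hb h1, fun s => by simp only [hT], fun s => by simp only [hT],
    fun s => dot3_cross3_right _ _, fun s => dot3_cross3_left _ _, fun s => ?_⟩
  rw [det3_cross3_frame _ _ (dot3_cross3_right _ _)]
  exact mul_ne_zero (dot3_self_ne_zero (hb0 s)) (dot3_self_ne_zero (hn s))

/-- The tube around the curve `c` spanned by the fields `n₁` and `n₂`. -/
def tube (c n₁ n₂ : ℝ → R3) (q : R3) : R3 := c (q 2) + (q 0 • n₁ (q 2) + q 1 • n₂ (q 2))

variable {c n₁ n₂ : ℝ → R3}

theorem tube_axis (s : ℝ) : tube c n₁ n₂ (pt 0 0 s) = c s := by simp [tube]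

theorem contDiff_tube (hc : ContDiff ℝ ∞ c) (h1 : ContDiff ℝ ∞ n₁) (h2 : ContDiff ℝ ∞ n₂) :
    ContDiff ℝ ∞ (tube c n₁ n₂) :=
  (hc.comp (contDiff_coord 2)).add (((contDiff_coord 0).smul (h1.comp (contDiff_coord 2))).add
    ((contDiff_coord 1).smul (h2.comp (contDiff_coord 2))))

theorem fderiv_tube_axis (hc : ContDiff ℝ ∞ c) (h1 : ContDiff ℝ ∞ n₁) (h2 : ContDiff ℝ ∞ n₂)
    (s : ℝ) (v : R3) : fderiv ℝ (tube c n₁ n₂) (pt 0 0 s) v =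
      v 0 • n₁ s + v 1 • n₂ s + v 2 • deriv c s := by
  have hD : HasFDerivAt (tube c n₁ n₂) (fderiv ℝ (tube c n₁ n₂) (pt 0 0 s)) (pt 0 0 s) :=
    ((contDiff_tube hc h1 h2).differentiable (by simp) _).hasFDerivAt
  have hpt : ∀ a b d : ℝ, HasDerivAt (fun t : ℝ => pt (t * a) (t * b) (s + t * d)) (pt a b d) 0 :=
    fun a b d => by
      have h := fun a => (hasDerivAt_id (0 : ℝ)).mul_const a
      simpa using HasDerivAt.pt (h a) (h b) ((h d).const_add s)
  have key : ∀ a b d : ℝ, HasDerivAt (fun t => tube c n₁ n₂ (pt (t * a) (t * b) (s + t * d)))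
      (fderiv ℝ (tube c n₁ n₂) (pt 0 0 s) (pt a b d)) 0 := fun a b d => by
    have h0 : pt ((0 : ℝ) * a) (0 * b) (s + 0 * d) = pt 0 0 s := by simp
    exact HasFDerivAt.comp_hasDerivAt (x := (0 : ℝ)) (by rw [h0]; exact hD) (hpt a b d)
  have hs : ∀ n : R3, HasDerivAt (fun t : ℝ => t • n) n 0 := fun n => by
    simpa using (hasDerivAt_id (0 : ℝ)).smul_const n
  have e1 : fderiv ℝ (tube c n₁ n₂) (pt 0 0 s) (pt 1 0 0) = n₁ s := by
    refine (key 1 0 0).unique ?_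
    simpa [tube] using (hs (n₁ s)).const_add (c s)
  have e2 : fderiv ℝ (tube c n₁ n₂) (pt 0 0 s) (pt 0 1 0) = n₂ s := by
    refine (key 0 1 0).unique ?_
    simpa [tube] using (hs (n₂ s)).const_add (c s)
  have e3 : fderiv ℝ (tube c n₁ n₂) (pt 0 0 s) (pt 0 0 1) = deriv c s := by
    refine (key 0 0 1).unique ?_
    have h := ((hc.differentiable (by simp)) (s + 0)).hasDerivAt.comp_const_add s 0
    simpa [tube] using h
  rw [map_eq_sum, e1, e2, e3]

theorem fderiv_fderiv_comp_of_critical {p : R3 → ℝ} {T : R3 → R3} {q : R3}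
    (hp : ContDiffAt ℝ ∞ p (T q)) (hT : ContDiffAt ℝ ∞ T q) (h0 : fderiv ℝ p (T q) = 0)
    (u w : R3) : fderiv ℝ (fderiv ℝ fun q => p (T q)) q u w =
      fderiv ℝ (fderiv ℝ p) (T q) (fderiv ℝ T q u) (fderiv ℝ T q w) := by
  have hev : (fderiv ℝ fun q => p (T q)) =ᶠ[𝓝 q] fun q => (fderiv ℝ p (T q)).comp (fderiv ℝ T q) := by
    have hle : (1 : WithTop ℕ∞) ≤ ∞ := by exact_mod_cast le_top
    have h1 := hT.continuousAt.eventually ((hp.of_le hle).eventually (by simp))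
    filter_upwards [h1, (hT.of_le hle).eventually (by simp)] with x hx hx'
    exact fderiv_comp x (hx.differentiableAt (by simp)) (hx'.differentiableAt (by simp))
  have hp' : DifferentiableAt ℝ (fderiv ℝ p) (T q) :=
    (hp.fderiv_right (m := ∞) (by simp)).differentiableAt (by simp)
  have hT' : DifferentiableAt ℝ (fderiv ℝ T) q :=
    (hT.fderiv_right (m := ∞) (by simp)).differentiableAt (by simp)
  have h := (hp'.hasFDerivAt.comp q (hT.differentiableAt (by simp)).hasFDerivAt).clm_comp
    hT'.hasFDerivAt
  rw [hev.fderiv_eq]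
  refine (congrArg (fun A : R3 →L[ℝ] R3 →L[ℝ] ℝ => A u w) h.fderiv).trans ?_
  simp [h0]

end Frame

section AdaptedChart

open Topology Filter

theorem contDiff_axis : ContDiff ℝ ∞ fun s : ℝ => pt 0 0 s :=
  ContDiff.pt contDiff_const contDiff_const contDiff_id

theorem IsPeriodicOrbit.exists_tube {U : Set R3} {B : R3 → R3} {γ : Set R3} (hU : IsOpen U)
    (hB : ContDiffOn ℝ ∞ B U) (hBne : ∀ z ∈ U, B z ≠ 0) (hγ : IsPeriodicOrbit U B γ) :
    ∃ (r : ℝ) (T : R3 → R3), 0 < r ∧ ContDiff ℝ ∞ T ∧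
      (∀ q, T (shift (2 * Real.pi) q) = T q) ∧ (∀ q ∈ Dset r, T q ∈ U) ∧
      (∀ q ∈ Dset r, jac T q ≠ 0) ∧
      (∀ q ∈ Dset r, ∀ q' ∈ Dset r, T q = T q' → ∃ n : ℤ, q = shift (2 * Real.pi * n) q') ∧
      Set.range (fun s : ℝ => T (pt 0 0 s)) = γ ∧
      ∀ s x y, (x ≠ 0 ∨ y ≠ 0) → fderiv ℝ T (pt 0 0 s) (pt x y 0) ≠ 0 ∧
        dot3 (fderiv ℝ T (pt 0 0 s) (pt x y 0)) (B (T (pt 0 0 s))) = 0 := by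
  obtain ⟨c, κ, hκ, hc, hcU, hcT, hcd, hci, hcγ⟩ := hγ.exists_param hU hB hBne
  have hb : ContDiff ℝ ∞ fun s => B (c s) := contDiff_iff_contDiffAt.2 fun s =>
    (hB.contDiffAt (hU.mem_nhds (hcU s))).comp s hc.contDiffAt
  obtain ⟨n₁, n₂, h1, h2, hp1, hp2, ho1, ho2, hdet⟩ :=
    exists_normal_frame hb (fun s => hBne _ (hcU s)) (T := 2 * Real.pi) fun s => by rw [hcT]
  have hT := contDiff_tube hc h1 h2
  have hper : ∀ q, tube c n₁ n₂ (shift (2 * Real.pi) q) = tube c n₁ n₂ q := fun q => by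
    simp [tube, hcT, hp1, hp2]
  have hjac : ∀ s, jac (tube c n₁ n₂) (pt 0 0 s) ≠ 0 := fun s => by
    rw [jac, det_eq_det3]
    simp only [fderiv_tube_axis hc h1 h2, (hcd s).deriv]
    have : det3 (n₁ s) (n₂ s) (κ • B (c s)) = κ * det3 (n₁ s) (n₂ s) (B (c s)) := by
      simp [det3]; ring
    simpa [this] using And.intro hκ.ne' (hdet s)
  obtain ⟨r₁, hr₁, -, H₁⟩ := exists_Dset_of_eventually
    (P := fun q => tube c n₁ n₂ q ∈ U ∧ jac (tube c n₁ n₂) q ≠ 0)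
    (fun q => by rw [hper, jac, jac, fderiv_periodic hper]) (fun s => by
      refine (hT.continuous.continuousAt.eventually (hU.mem_nhds ?_)).and
        ((continuousAt_jac hT.contDiffAt).eventually_ne (hjac s))
      rw [tube_axis]; exact hcU s) one_pos
  obtain ⟨r, hr, hrr, H⟩ := exists_Dset_injOn_mod hr₁ hT.continuous.continuousOn hper
    (fun s => exists_injOn_nhds hT.contDiffAt (hjac s))
    (fun s s' h => hci s s' (by simpa only [tube_axis] using h))
  have hsub := Dset_subset hr.le hrr
  refine ⟨r, tube c n₁ n₂, hr, hT, hper, fun q hq => (H₁ q (hsub hq)).1,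
    fun q hq => (H₁ q (hsub hq)).2, H, by simpa only [tube_axis] using hcγ, fun s x y hxy => ?_⟩
  have hd := hdet s
  have o1 := ho1 s
  have o2 := ho2 s
  rw [tube_axis, fderiv_tube_axis hc h1 h2]
  simp only [pt_zero, pt_one, pt_two, zero_smul, add_zero]
  refine ⟨fun h => ?_, ?_⟩
  · have hx : x * det3 (n₁ s) (n₂ s) (B (c s)) =
        det3 (x • n₁ s + y • n₂ s) (n₂ s) (B (c s)) := by simp [det3]; ring
    have hy : y * det3 (n₁ s) (n₂ s) (B (c s)) =
        det3 (n₁ s) (x • n₁ s + y • n₂ s) (B (c s)) := by simp [det3]; ring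
    rw [h] at hx hy
    rw [show det3 0 (n₂ s) (B (c s)) = 0 by simp [det3]] at hx
    rw [show det3 (n₁ s) 0 (B (c s)) = 0 by simp [det3]] at hy
    have hx0 : x = 0 := (mul_eq_zero.1 hx).resolve_right hd
    have hy0 : y = 0 := (mul_eq_zero.1 hy).resolve_right hd
    simp [hx0, hy0] at hxy
  · have : dot3 (x • n₁ s + y • n₂ s) (B (c s)) =
        x * dot3 (n₁ s) (B (c s)) + y * dot3 (n₂ s) (B (c s)) := by simp [dot3]; ring
    rw [this, o1, o2]; ring

theorem exists_adapted_chart {U : Set R3} {p : R3 → ℝ} {T : R3 → R3} {γ : Set R3} {r₀ : ℝ}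
    (hU : IsOpen U) (hp : ContDiffOn ℝ ∞ p U) (hr₀ : 0 < r₀) (hT : ContDiff ℝ ∞ T)
    (hper : ∀ q, T (shift (2 * Real.pi) q) = T q) (hTU : ∀ q ∈ Dset r₀, T q ∈ U)
    (hjac : ∀ q ∈ Dset r₀, jac T q ≠ 0)
    (hinj : ∀ q ∈ Dset r₀, ∀ q' ∈ Dset r₀, T q = T q' → ∃ n : ℤ, q = shift (2 * Real.pi * n) q')
    (hγ : Set.range (fun s : ℝ => T (pt 0 0 s)) = γ)
    (h1 : ∀ s, fderiv ℝ p (T (pt 0 0 s)) = 0)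
    (h2 : ∀ s x y, (x ≠ 0 ∨ y ≠ 0) → 0 < fderiv ℝ (fderiv ℝ p) (T (pt 0 0 s))
      (fderiv ℝ T (pt 0 0 s) (pt x y 0)) (fderiv ℝ T (pt 0 0 s) (pt x y 0))) :
    ∃ (r p₀ : ℝ) (Ψ : R3 → R3), 0 < r ∧ ContDiffOn ℝ ∞ Ψ (Dset r) ∧
      (∀ q, Ψ (shift (2 * Real.pi) q) = Ψ q) ∧ (∀ q ∈ Dset r, Ψ q ∈ U) ∧
      (∀ q ∈ Dset r, p (Ψ q) = p₀ + psi q) ∧ (∀ q ∈ Dset r, jac Ψ q ≠ 0) ∧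
      (∀ q ∈ Dset r, ∀ q' ∈ Dset r, Ψ q = Ψ q' → ∃ n : ℤ, q = shift (2 * Real.pi * n) q') ∧
      Set.range (fun s : ℝ => Ψ (pt 0 0 s)) = γ := by
  have hax := axis_mem_Dset hr₀
  have hpT : ∀ q ∈ Dset r₀, ContDiffAt ℝ ∞ p (T q) := fun q hq =>
    hp.contDiffAt (hU.mem_nhds (hTU q hq))
  have hd : ∀ s, HasFDerivAt (fun q => p (T q)) (0 : R3 →L[ℝ] ℝ) (pt 0 0 s) := fun s => by
    have := ((hpT _ (hax s)).differentiableAt (by simp)).hasFDerivAt.comp (pt 0 0 s)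
      (hT.differentiable (by simp) _).hasFDerivAt
    rwa [h1, ContinuousLinearMap.zero_comp] at this
  have hconst : ∀ s, p (T (pt 0 0 s)) = p (T (pt 0 0 0)) := fun s => by
    have hd' : ∀ s, HasDerivAt (fun s => p (T (pt 0 0 s))) 0 s := fun s => by
      have := (hd s).comp_hasDerivAt s
        (HasDerivAt.pt (hasDerivAt_const s 0) (hasDerivAt_const s 0) (hasDerivAt_id s))
      simpa [Function.comp_def] using this
    exact is_const_of_deriv_eq_zero (fun s => (hd' s).differentiableAt) (fun s => (hd' s).deriv) s 0
  obtain ⟨r, N, hr, hN, hNp, hNr, hNi, hNj, hNa, hNa', hPN⟩ := exists_morse_chart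
    (P := fun q => p (T q)) hr₀ (hp.comp hT.contDiffOn hTU) (fun q => by rw [hper]) hconst
    (fun s => (hd s).fderiv) (fun s x y hxy => by
      rw [fderiv_fderiv_comp_of_critical (hpT _ (hax s)) hT.contDiffAt (h1 s)]
      exact h2 s x y hxy)
  refine ⟨r, p (T (pt 0 0 0)), fun q => T (N q), hr, hT.comp_contDiffOn hN,
    fun q => by simp only [hNp, hper], fun q hq => hTU _ (hNr q hq), hPN, fun q hq => ?_,
    fun q hq q' hq' h => ?_, ?_⟩
  · rw [jac_mul_of_comp_eq ((hN.contDiffAt ((isOpen_Dset r).mem_nhds hq)).differentiableAt (by simp))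
      (hT.differentiable (by simp) _)]
    exact mul_ne_zero (hjac _ (hNr q hq)) (hNj q hq)
  · obtain ⟨n, hn⟩ := hinj _ (hNr q hq) _ (hNr q' hq') h
    exact ⟨n, hNi q hq q' hq' n hn⟩
  · rw [← hγ]
    refine Set.Subset.antisymm ?_ ?_
    · rintro _ ⟨s, rfl⟩
      obtain ⟨s', hs'⟩ := hNa s
      exact ⟨s', by simp only [hs']⟩
    · rintro _ ⟨s, rfl⟩
      obtain ⟨s', hs'⟩ := hNa' s
      exact ⟨s', by simp only [hs']⟩

theorem forall_pos_or_forall_neg {h : ℝ → ℝ} (hc : Continuous h) (h0 : ∀ s, h s ≠ 0) :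
    (∀ s, 0 < h s) ∨ ∀ s, h s < 0 := by
  by_contra! ⟨⟨s, hs⟩, ⟨t, ht⟩⟩
  obtain ⟨u, hu⟩ := mem_range_of_exists_le_of_exists_ge hc ⟨s, hs⟩ ⟨t, ht⟩
  exact h0 u hu

end AdaptedChart

/-- **Near-axis Boozer coordinates** (Theorem 3), for an MHS integrable field:
`div B = 0` and `(curl B) × B = ∇p` on `U`. -/
theorem near_axis_boozer
    (U : Set R3) (B : R3 → R3) (p : R3 → ℝ) (γ : Set R3)
    (hU : IsOpen U)
    (hB : ContDiffOn ℝ (⊤ : ℕ∞) B U) (hp : ContDiffOn ℝ (⊤ : ℕ∞) p U)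
    (hBne : ∀ z ∈ U, B z ≠ 0)
    (hdiv : ∀ z ∈ U, divg B z = 0)
    (hMHS : ∀ z ∈ U, cross3 (curl B z) (B z) = gradient p z)
    (hγ : IsNondegenerateEllipticAxis U B p γ) :
    ∃ (r δ : ℝ) (Φ : R3 → R3) (P f g k l : ℝ → ℝ),
      0 < r ∧ 0 < δ ∧
      -- Φ is C^∞ on D_r × ℝ, with values in U
      ContDiffOn ℝ (⊤ : ℕ∞) Φ (Dset r) ∧ (∀ q ∈ Dset r, Φ q ∈ U) ∧
      -- P, f, g, k, l are C^∞ on (−δ, r²/2)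
      ContDiffOn ℝ (⊤ : ℕ∞) P (Set.Ioo (-δ) (r ^ 2 / 2)) ∧
      ContDiffOn ℝ (⊤ : ℕ∞) f (Set.Ioo (-δ) (r ^ 2 / 2)) ∧
      ContDiffOn ℝ (⊤ : ℕ∞) g (Set.Ioo (-δ) (r ^ 2 / 2)) ∧
      ContDiffOn ℝ (⊤ : ℕ∞) k (Set.Ioo (-δ) (r ^ 2 / 2)) ∧
      ContDiffOn ℝ (⊤ : ℕ∞) l (Set.Ioo (-δ) (r ^ 2 / 2)) ∧
      -- (i) periodicity in φ
      (∀ x y φ : ℝ, Φ (pt x y (φ + 2 * Real.pi)) = Φ (pt x y φ)) ∧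
      -- (ii) everywhere invertible differential …
      (∀ q ∈ Dset r, LinearMap.det (fderiv ℝ Φ q).toLinearMap ≠ 0) ∧
      IsOpen (Φ '' Dset r) ∧ γ ⊆ Φ '' Dset r ∧
      Set.range (fun φ : ℝ => Φ (pt 0 0 φ)) = γ ∧
      (∀ q ∈ Dset r, ∀ q' ∈ Dset r,
        (Φ q = Φ q' ↔ (q 0 = q' 0 ∧ q 1 = q' 1 ∧
          ∃ n : ℤ, q 2 - q' 2 = 2 * Real.pi * (n : ℝ)))) ∧
      -- (iii) with ψ = (x² + y²)/2: p ∘ Φ = P(ψ), and the pulled-back flux fields of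
      -- B and B × ∇p are (−g′(ψ)·y, g′(ψ)·x, f′(ψ)) and (−l′(ψ)·y, l′(ψ)·x, k′(ψ)),
      -- expressed as DΦ(w) = det(DΦ) • (X ∘ Φ)
      (∀ q ∈ Dset r,
        p (Φ q) = P (((q 0) ^ 2 + (q 1) ^ 2) / 2) ∧
        (fderiv ℝ Φ q
            (pt (-(deriv g (((q 0) ^ 2 + (q 1) ^ 2) / 2)) * q 1)
                ((deriv g (((q 0) ^ 2 + (q 1) ^ 2) / 2)) * q 0)
                (deriv f (((q 0) ^ 2 + (q 1) ^ 2) / 2)))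
          = LinearMap.det (fderiv ℝ Φ q).toLinearMap • B (Φ q)) ∧
        (fderiv ℝ Φ q
            (pt (-(deriv l (((q 0) ^ 2 + (q 1) ^ 2) / 2)) * q 1)
                ((deriv l (((q 0) ^ 2 + (q 1) ^ 2) / 2)) * q 0)
                (deriv k (((q 0) ^ 2 + (q 1) ^ 2) / 2)))
          = LinearMap.det (fderiv ℝ Φ q).toLinearMap •
              cross3 (B (Φ q)) (gradient p (Φ q)))) := by
  obtain ⟨-, -, horb, hgrad, hhess⟩ := hγ
  obtain ⟨r₀, T, hr₀, hT, hper, hTU, hjac, hinj, hTγ, hTB⟩ := horb.exists_tube hU hB hBne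
  have hax := axis_mem_Dset hr₀
  have hmem : ∀ s, T (pt 0 0 s) ∈ γ := fun s => hTγ ▸ ⟨s, rfl⟩
  have h1 : ∀ s, fderiv ℝ p (T (pt 0 0 s)) = 0 := fun s => by
    ext v
    rw [fderiv_eq_dot3, hgrad _ (hmem s)]
    simp [dot3]
  let Q : ℝ → R3 → ℝ := fun s v => fderiv ℝ (fderiv ℝ p) (T (pt 0 0 s))
    (fderiv ℝ T (pt 0 0 s) v) (fderiv ℝ T (pt 0 0 s) v)
  have hQ : ∀ s, (∀ x y, (x ≠ 0 ∨ y ≠ 0) → 0 < Q s (pt x y 0)) ∨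
      ∀ x y, (x ≠ 0 ∨ y ≠ 0) → Q s (pt x y 0) < 0 := fun s => by
    refine (hhess _ (hmem s)).imp (fun h x y hxy => ?_) fun h x y hxy => ?_ <;>
    · have := h _ (hTB s x y hxy).1 (by rw [inner_eq_dot3]; exact (hTB s x y hxy).2)
      rwa [hess, iteratedFDeriv_two_apply] at this
  have hQc : Continuous fun s => Q s (pt 1 0 0) := by
    have hD : Continuous fun s : ℝ => fderiv ℝ T (pt 0 0 s) (pt 1 0 0) :=
      ((hT.continuous_fderiv (by simp)).comp contDiff_axis.continuous).clm_apply continuous_const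
    have hD2 : Continuous fun s : ℝ => fderiv ℝ (fderiv ℝ p) (T (pt 0 0 s)) :=
      continuous_iff_continuousAt.2 fun s => by
        have h := hp.contDiffAt (hU.mem_nhds (hTU _ (hax s)))
        exact ContinuousAt.comp (f := fun s : ℝ => T (pt 0 0 s))
          ((h.fderiv_right (m := ∞) (by simp)).fderiv_right (m := ∞) (by simp)).continuousAt
          (hT.continuous.comp contDiff_axis.continuous).continuousAt
    exact (hD2.clm_apply hD).clm_apply hD
  have h10 : ((1 : ℝ) ≠ 0 ∨ (0 : ℝ) ≠ 0) := Or.inl one_ne_zero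
  rcases forall_pos_or_forall_neg hQc fun s => (hQ s).elim (fun h => (h 1 0 h10).ne')
    fun h => (h 1 0 h10).ne with hs | hs
  · have h2 := fun s => (hQ s).resolve_right fun h => (hs s).not_gt (h 1 0 h10)
    obtain ⟨r, p₀, Ψ, hr, hΨ, hΨp, hΨU, hpΨ, hΨj, hΨi, hΨγ⟩ :=
      exists_adapted_chart hU hp hr₀ hT hper hTU hjac hinj hTγ h1 h2
    exact near_axis_of_chart hU hB hp hBne hdiv hMHS hr hΨ hΨp hΨU
      (fun q hq => by rw [hpΨ q hq, one_mul]) one_ne_zero hΨj hΨi hΨγ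
  · have h2 := fun s => (hQ s).resolve_left fun h => (hs s).not_gt (h 1 0 h10)
    have hneg : (fderiv ℝ fun z => -p z) = fun z => -fderiv ℝ p z := funext fun z => fderiv_fun_neg
    obtain ⟨r, p₀, Ψ, hr, hΨ, hΨp, hΨU, hpΨ, hΨj, hΨi, hΨγ⟩ :=
      exists_adapted_chart (p := fun z => -p z) hU hp.neg hr₀ hT hper hTU hjac hinj hTγ
        (fun s => by rw [hneg]; simp [h1 s])
        (fun s x y hxy => by
          rw [hneg, fderiv_fun_neg]
          simpa using h2 s x y hxy)
    exact near_axis_of_chart (p₀ := -p₀) (σ := -1) hU hB hp hBne hdiv hMHS hr hΨ hΨp hΨU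
      (fun q hq => by linarith [hpΨ q hq]) (by norm_num) hΨj hΨi hΨγ
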